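/- Let n ∈ ℕ with n ≥ 2, let I ⊆ ℝ be an open interval, and let 𝓕 be a finite family of maps f : I → ℝⁿ all nondegenerate at the same point x₀ ∈ I. Let W be a finite or countable subset of R_n satisfying inf{τ(r) : r ∈ W} > 0. Then dim ⋂_{f ∈ 𝓕} ⋂_{r ∈ W} f⁻¹(Bad(r)) = 1. -/

import Mathlib

open MeasureTheory ENNReal

/-- Distance from a real number to the nearest integer. -/
noncomputable def distNearestInt (x : ℝ) : ℝ := ⨅ p : ℤ, |x - (p : ℝ)|

/-- `badPow ρ x = x ^ (1/ρ)`, with the convention `x ^ (1/0) = 0`. -/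
noncomputable def badPow (ρ x : ℝ) : ℝ := if ρ = 0 then 0 else x ^ (1 / ρ)

/-- The set `R_n` of weight vectors: nonnegative components summing to `1`. -/
def Weights (n : ℕ) : Set (Fin n → ℝ) := {r | (∑ i, r i) = 1 ∧ ∀ i, 0 ≤ r i}

/-- `τ(r)`: the smallest strictly positive component of `r`. -/
noncomputable def tauW {n : ℕ} (r : Fin n → ℝ) : ℝ := sInf {t | 0 < t ∧ ∃ i, r i = t}

/-- The set `Bad(r)` of `r`-badly approximable points of `ℝⁿ`. -/
def BadSet {n : ℕ} (r : Fin n → ℝ) : Set (Fin n → ℝ) :=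
  {y | ∃ c > 0, ∀ q : ℕ, 1 ≤ q →
    ∃ i, c * (q : ℝ)⁻¹ ≤ badPow (r i) (distNearestInt (q * y i))}

/-- A map `f = (f₁,…,fₙ) : ℝ → ℝⁿ` is nondegenerate at `x₀` if it is `Cⁿ` on a
neighbourhood of `x₀` and the Wronskian of `f₁',…,fₙ'` does not vanish at `x₀`. -/
def NondegAt {n : ℕ} (f : ℝ → Fin n → ℝ) (x₀ : ℝ) : Prop :=
  (∃ U ∈ nhds x₀, ∀ j : Fin n, ContDiffOn ℝ n (fun x => f x j) U) ∧
  Matrix.det (Matrix.of fun i j : Fin n =>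
    iteratedDeriv (i.1 + 1) (fun x => f x j) x₀) ≠ 0

open MeasureTheory ENNReal

namespace BB

/-! ### Part A : minors -/

/-- minor of `Y` on the (ordered) columns `c` -/
def mnr {R ι : Type*} [CommRing R] {k : ℕ} (Y : Matrix (Fin k) ι R) (c : Fin k → ι) : R :=
  (Y.submatrix id c).det

section minors
variable {R ι : Type*} [CommRing R] {k : ℕ}

lemma mnr_eq_zero_of_eq (Y : Matrix (Fin k) ι R) (c : Fin k → ι) {l l' : Fin k} (h : l ≠ l')
    (hc : c l = c l') : mnr Y c = 0 :=
  Matrix.det_zero_of_column_eq h (fun i => by simp [hc])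

lemma mnr_mul (T : Matrix (Fin k) (Fin k) R) (Y : Matrix (Fin k) ι R) (c : Fin k → ι) :
    mnr (T * Y) c = T.det * mnr Y c := by
  unfold mnr
  rw [← Matrix.det_mul]
  rfl

lemma mnr_update [DecidableEq ι] (Y : Matrix (Fin k) ι R) (c : Fin k → ι) (l : Fin k) (i : ι) :
    mnr Y (Function.update c l i) = ((Y.submatrix id c).updateCol l (fun x => Y x i)).det := by
  unfold mnr
  congr 1
  ext a b
  by_cases h : b = l
  · subst h; simp
  · simp [h]

/-- the exchange (Plücker) identity -/
lemma mnr_exchange [DecidableEq ι] (Y : Matrix (Fin k) ι R) (c d : Fin k → ι) (l : Fin k) :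
    mnr Y c * mnr Y d =
      ∑ l', mnr Y (Function.update c l (d l')) * mnr Y (Function.update d l' (c l)) := by
  classical
  set B := Y.submatrix id c with hB
  set D := Y.submatrix id d with hD
  have h1 := Matrix.mulVec_cramer D (fun x => Y x (c l))
  have h2 : mnr Y c * mnr Y d = (B.updateCol l (D.det • (fun x => Y x (c l)))).det := by
    rw [Matrix.det_updateCol_smul, ← mnr_update, Function.update_eq_self, mul_comm]
    rfl
  rw [h2, ← h1]
  rw [← Matrix.cramer_apply]
  have h3 : D.mulVec (D.cramer fun x => Y x (c l)) =
      ∑ l', (D.cramer (fun x => Y x (c l)) l') • (fun x => Y x (d l')) := by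
    ext x
    simp [Matrix.mulVec, dotProduct, hD, mul_comm]
  rw [h3, map_sum, Finset.sum_apply]
  refine Finset.sum_congr rfl fun l' _ => ?_
  rw [map_smul, Pi.smul_apply, Matrix.cramer_apply, Matrix.cramer_apply, ← mnr_update,
    ← mnr_update, smul_eq_mul, mul_comm]

lemma mnr_cons (v : ι → R) (Y : Matrix (Fin k) ι R) (c : Fin (k+1) → ι) :
    mnr (Matrix.of (Fin.cons v Y : Fin (k+1) → ι → R)) c =
      ∑ l : Fin (k+1), (-1) ^ (l : ℕ) * v (c l) * mnr Y (c ∘ l.succAbove) := by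
  unfold mnr
  rw [Matrix.det_succ_row_zero]
  rfl

lemma mnr_scale (Y : Matrix (Fin k) ι R) (w : ι → R) (c : Fin k → ι) :
    mnr (Matrix.of fun l i => w i * Y l i) c = (∏ l, w (c l)) * mnr Y c := by
  unfold mnr
  rw [← Matrix.det_mul_row]
  rfl

end minors

lemma mnr_cons_le {ι : Type*} {k : ℕ} (v : ι → ℝ) (Y : Matrix (Fin k) ι ℝ) (c : Fin (k+1) → ι)
    {ε S : ℝ} (hv : ∀ i, |v i| ≤ ε) (hY : ∀ c', |mnr Y c'| ≤ S) :
    |mnr (Matrix.of (Fin.cons v Y : Fin (k+1) → ι → ℝ)) c| ≤ (k+1) * (ε * S) := by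
  rw [mnr_cons]
  have hε : 0 ≤ ε := (abs_nonneg _).trans (hv (c 0))
  refine (Finset.abs_sum_le_sum_abs _ _).trans ?_
  calc _ ≤ ∑ l : Fin (k+1), ε * S := by
        refine Finset.sum_le_sum fun l _ => ?_
        rw [abs_mul, abs_mul, abs_pow, abs_neg, abs_one, one_pow, one_mul]
        exact mul_le_mul (hv _) (hY _) (abs_nonneg _) hε
    _ = _ := by simp

lemma mnr_intCast {ι : Type*} {k : ℕ} (A : Matrix (Fin k) ι ℤ) (c : Fin k → ι) :
    mnr (A.map (Int.cast : ℤ → ℝ)) c = ((mnr A c : ℤ) : ℝ) := by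
  unfold mnr
  rw [Int.cast_det]
  rfl

/-- Minkowski's theorem on linear forms -/
lemma minkowski_forms {k : ℕ} (hk : 1 ≤ k) (B : Matrix (Fin k) (Fin k) ℝ) {η : ℝ} (hη : 0 < η)
    (h0 : B.det ≠ 0) (hB : |B.det| ≤ η ^ k) :
    ∃ u : Fin k → ℤ, u ≠ 0 ∧ ∀ l, |∑ x, (u x : ℝ) * B x l| ≤ 2 * η := by
  classical
  let b := Pi.basisFun ℝ (Fin k)
  have fund := ZSpan.isAddFundamentalDomain b (volume : Measure (Fin k → ℝ))
  let f : (Fin k → ℝ) →ₗ[ℝ] (Fin k → ℝ) := Matrix.vecMulLinear B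
  have hf : f = Matrix.toLin' B.transpose := by
    ext x l
    simp [f, Matrix.vecMul_eq_sum, Matrix.mulVec, dotProduct, mul_comm]
  have hdet : LinearMap.det f = B.det := by
    rw [hf, LinearMap.det_toLin', Matrix.det_transpose]
  let s : Set (Fin k → ℝ) := f ⁻¹' (Set.Icc (fun _ => -(2*η)) (fun _ => 2*η))
  have hsv : volume s = ENNReal.ofReal (|B.det|⁻¹ * (4*η)^k) := by
    rw [Measure.addHaar_preimage_linearMap _ (by rw [hdet]; exact h0), hdet, Real.volume_Icc_pi,
      ENNReal.ofReal_mul (by positivity), abs_inv]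
    congr 1
    rw [← ENNReal.ofReal_prod_of_nonneg]
    · congr 1
      simp; ring
    · intro i _; linarith
  haveI : Countable (Submodule.span ℤ (Set.range b)).toAddSubgroup :=
    inferInstanceAs (Countable (Submodule.span ℤ (Set.range b)))
  obtain ⟨x, hx0, hxs⟩ := exists_ne_zero_mem_lattice_of_measure_mul_two_pow_lt_measure
    (s := s) (L := (Submodule.span ℤ (Set.range b)).toAddSubgroup) fund (by
      intro x hx
      simp only [s, Set.mem_preimage, map_neg, Set.mem_Icc, Pi.le_def, Pi.neg_apply] at hx ⊢
      exact ⟨fun i => by linarith [hx.2 i], fun i => by linarith [hx.1 i]⟩)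
    ((convex_Icc _ _).linear_preimage f) (by
      rw [ZSpan.fundamentalDomain_pi_basisFun, Real.volume_pi_Ico, hsv]
      simp only [sub_zero, ENNReal.ofReal_one, Finset.prod_const_one, one_mul,
        Module.finrank_pi, Fintype.card_fin]
      rw [show (2:ℝ≥0∞)^k = ENNReal.ofReal (2^k) by
        rw [ENNReal.ofReal_pow (by norm_num)]; norm_num]
      have hd : 0 < |B.det| := abs_pos.2 h0
      have h4 : (2:ℝ)^k < |B.det|⁻¹ * (4*η)^k := by
        rw [inv_mul_eq_div, lt_div_iff₀ hd]
        calc (2:ℝ)^k * |B.det| ≤ 2^k * η^k := by gcongr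
          _ = (2*η)^k := by rw [mul_pow]
          _ < (4*η)^k := pow_lt_pow_left₀ (by linarith) (by positivity) (by omega)
      exact (ENNReal.ofReal_lt_ofReal_iff (lt_trans (by positivity) h4)).2 h4)
  have hmem : (x : Fin k → ℝ) ∈ Submodule.span ℤ (Set.range b) := x.2
  have h_int : ∀ i, ∃ z : ℤ, (z : ℝ) = (x : Fin k → ℝ) i := by
    intro i
    have := (Module.Basis.mem_span_iff_repr_mem ℤ b (x : Fin k → ℝ)).1 hmem i
    simpa [b] using this
  choose u hu using h_int
  refine ⟨u, ?_, ?_⟩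
  · rintro rfl
    apply hx0
    ext i
    simp [← hu]
  · intro l
    have h := hxs
    simp only [s, Set.mem_preimage, Set.mem_Icc, Pi.le_def] at h
    have h5 : f (x : Fin k → ℝ) l = ∑ x, (u x : ℝ) * B x l := by
      simp [f, Matrix.vecMul, dotProduct, hu]
    rw [← h5]
    exact abs_le.2 ⟨h.1 l, h.2 l⟩

/-- A5 -/
lemma exists_short {ι : Type*} [Fintype ι] [DecidableEq ι] {k : ℕ} (hk : 1 ≤ k)
    (Y : Matrix (Fin k) ι ℝ) {η : ℝ}
    (hη : 0 < η) (hY : ∀ c, |mnr Y c| ≤ η ^ k) (h0 : ∃ c, mnr Y c ≠ 0) :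
    ∃ u : Fin k → ℤ, u ≠ 0 ∧ ∀ i, |∑ l, (u l : ℝ) * Y l i| ≤ 2 * k * η := by
  obtain ⟨c0, hc0⟩ := h0
  haveI : Nonempty (Fin k → ι) := ⟨c0⟩
  obtain ⟨c, hc⟩ := Finite.exists_max (fun c : Fin k → ι => |mnr Y c|)
  have hpos : 0 < |mnr Y c| := lt_of_lt_of_le (abs_pos.2 hc0) (hc c0)
  have hne : (Y.submatrix id c).det ≠ 0 := abs_pos.1 hpos
  obtain ⟨u, hu0, hu⟩ := minkowski_forms hk (Y.submatrix id c) hη hne (hY c)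
  refine ⟨u, hu0, fun i => ?_⟩
  have h1 := Matrix.mulVec_cramer (Y.submatrix id c) (fun x => Y x i)
  have h2 : ∀ l, |(Y.submatrix id c).cramer (fun x => Y x i) l| ≤ |mnr Y c| := by
    intro l
    rw [Matrix.cramer_apply, ← mnr_update]
    exact hc _
  have h3 : mnr Y c * ∑ l, (u l : ℝ) * Y l i =
      ∑ l', (Y.submatrix id c).cramer (fun x => Y x i) l' * ∑ x, (u x : ℝ) * Y x (c l') := by
    calc _ = ∑ l, (u l : ℝ) * (mnr Y c * Y l i) := by
          rw [Finset.mul_sum]; exact Finset.sum_congr rfl fun l _ => by ring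
      _ = ∑ l, (u l : ℝ) * ∑ l', Y l (c l') * (Y.submatrix id c).cramer (fun x => Y x i) l' := by
          refine Finset.sum_congr rfl fun l _ => ?_
          have := congrFun h1 l
          simp only [Matrix.mulVec, dotProduct, Matrix.submatrix_apply, id, Pi.smul_apply,
            smul_eq_mul] at this
          rw [this]; rfl
      _ = _ := by
          simp_rw [Finset.mul_sum]
          rw [Finset.sum_comm]
          refine Finset.sum_congr rfl fun l _ => Finset.sum_congr rfl fun l' _ => by ring
  have h4 : |mnr Y c| * |∑ l, (u l : ℝ) * Y l i| ≤ |mnr Y c| * (2 * k * η) := by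
    rw [← abs_mul, h3]
    refine (Finset.abs_sum_le_sum_abs _ _).trans ?_
    calc _ ≤ ∑ l' : Fin k, |mnr Y c| * (2 * η) := by
          refine Finset.sum_le_sum fun l _ => ?_
          rw [abs_mul]
          exact mul_le_mul (h2 l) (hu l) (abs_nonneg _) (abs_nonneg _)
      _ = _ := by simp; ring
  exact le_of_mul_le_mul_left h4 hpos

end BB

set_option linter.unusedVariables false
open MeasureTheory ENNReal

namespace BB

/-! ### Part B : Markov-Lipschitz functions -/

/-- Markov-Lipschitz functions -/
def ML (C lo hi : ℝ) (h : ℝ → ℝ) : Prop :=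
  ∀ u v, lo ≤ u → u < v → v ≤ hi → ∀ S, (∀ z ∈ Set.Icc u v, |h z| ≤ S) →
    ∀ x ∈ Set.Icc u v, ∀ y ∈ Set.Icc u v, |h x - h y| ≤ C * (|x - y| / (v - u)) * S

lemma ML.mono {C C' lo hi : ℝ} {h : ℝ → ℝ} (H : ML C lo hi h) (hC : C ≤ C') : ML C' lo hi h := by
  intro u v hu huv hv S hS x hx y hy
  refine (H u v hu huv hv S hS x hx y hy).trans ?_
  have hS0 : 0 ≤ S := (abs_nonneg _).trans (hS x hx)
  have : 0 ≤ |x - y| / (v - u) := div_nonneg (abs_nonneg _) (by linarith)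
  gcongr

lemma ML.sub {C lo hi lo' hi' : ℝ} {h : ℝ → ℝ} (H : ML C lo hi h) (h1 : lo ≤ lo') (h2 : hi' ≤ hi) :
    ML C lo' hi' h := by
  intro u v hu huv hv S hS x hx y hy
  exact H u v (by linarith) huv (by linarith) S hS x hx y hy

lemma ML.pi_norm {κ : Type*} [Fintype κ] {C lo hi : ℝ} (hC : 0 ≤ C) {h : ℝ → κ → ℝ}
    (H : ∀ i, ML C lo hi (fun x => h x i)) : ML C lo hi (fun x => ‖h x‖) := by
  intro u v hu huv hv S hS x hx y hy
  have hS0 : 0 ≤ S := (abs_nonneg _).trans (hS x hx)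
  have h0 : 0 ≤ |x - y| / (v - u) := div_nonneg (abs_nonneg _) (by linarith)
  refine (abs_norm_sub_norm_le _ _).trans ?_
  rw [pi_norm_le_iff_of_nonneg (by positivity)]
  intro i
  refine H i u v hu huv hv S (fun z hz => ?_) x hx y hy
  have := hS z hz
  rw [abs_norm] at this
  exact (norm_le_pi_norm (h z) i).trans this

lemma ML.const_mul {C lo hi : ℝ} (hC : 0 ≤ C) {h : ℝ → ℝ} (H : ML C lo hi h) (w : ℝ) :
    ML C lo hi (fun x => w * h x) := by
  rcases eq_or_ne w 0 with rfl | hw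
  · intro u v hu huv hv S hS x hx y hy
    have hS0 : 0 ≤ S := (abs_nonneg _).trans (hS x hx)
    have : 0 ≤ |x - y| / (v - u) := div_nonneg (abs_nonneg _) (by linarith)
    simp; positivity
  · intro u v hu huv hv S hS x hx y hy
    have hw' : 0 < |w| := abs_pos.2 hw
    have := H u v hu huv hv (S / |w|) (fun z hz => by
      rw [le_div_iff₀ hw', mul_comm, ← abs_mul]; exact hS z hz) x hx y hy
    rw [← mul_sub, abs_mul]
    calc |w| * |h x - h y| ≤ |w| * (C * (|x - y| / (v - u)) * (S / |w|)) := by gcongr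
      _ = _ := by field_simp

lemma ML.const {C lo hi : ℝ} (hC : 0 ≤ C) (w : ℝ) : ML C lo hi (fun _ => w) := by
  intro u v hu huv hv S hS x hx y hy
  have hS0 : 0 ≤ S := (abs_nonneg _).trans (hS x hx)
  have : 0 ≤ |x - y| / (v - u) := div_nonneg (abs_nonneg _) (by linarith)
  simp; positivity

lemma ML.remez {C lo hi : ℝ} {h : ℝ → ℝ} (hC : 1 ≤ C) (H : ML C lo hi h)
    (hc : ContinuousOn h (Set.Icc lo hi)) {u0 u v v0 S : ℝ} (h1 : lo ≤ u0) (h2 : u0 ≤ u)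
    (h3 : u < v) (h4 : v ≤ v0) (h5 : v0 ≤ hi) (hS : ∀ z ∈ Set.Icc u v, |h z| ≤ S) (N : ℕ)
    (hN : v0 - u0 ≤ N * ((v - u) / (2 * C))) : ∀ z ∈ Set.Icc u0 v0, |h z| ≤ 2 ^ N * S := by
  set d := (v - u) / (2 * C) with hd
  have hd0 : 0 < d := div_pos (by linarith) (by linarith)
  have key : ∀ N : ℕ, ∀ z ∈ Set.Icc (max u0 (u - N * d)) (min v0 (v + N * d)),
      |h z| ≤ 2 ^ N * S := by
    intro N
    induction N with
    | zero =>
      intro z hz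
      simp only [Nat.cast_zero, zero_mul, sub_zero, add_zero, max_eq_right h2, min_eq_right h4] at hz
      simpa using hS z hz
    | succ N ih =>
      set u' := max u0 (u - (N+1 : ℕ) * d) with hu'
      set v' := min v0 (v + (N+1 : ℕ) * d) with hv'
      have hNd : (0:ℝ) ≤ N * d := by positivity
      have e1 : u' ≤ u := max_le h2 (by push_cast; nlinarith)
      have e2 : v ≤ v' := le_min h4 (by push_cast; nlinarith)
      have e3 : lo ≤ u' := h1.trans (le_max_left _ _)
      have e4 : v' ≤ hi := (min_le_left _ _).trans h5
      have hsub : Set.Icc u' v' ⊆ Set.Icc lo hi := Set.Icc_subset_Icc e3 e4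
      obtain ⟨w, hw, hmax⟩ := isCompact_Icc.exists_isMaxOn
        (Set.nonempty_Icc.2 (by linarith : u' ≤ v')) ((hc.mono hsub).abs)
      have hmax' : ∀ z ∈ Set.Icc u' v', |h z| ≤ |h w| := fun z hz => hmax hz
      -- nearest point
      obtain ⟨y, hy, hyd⟩ : ∃ y ∈ Set.Icc (max u0 (u - N * d)) (min v0 (v + N * d)),
          |w - y| ≤ d := by
        have f1 : max u0 (u - N * d) ≤ u := max_le h2 (by linarith)
        have f2 : v ≤ min v0 (v + N * d) := le_min h4 (by linarith)
        have f3 : max u0 (u - N * d) ≤ u' + d := by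
          refine max_le (by have := le_max_left u0 (u - (N+1 : ℕ) * d); linarith) ?_
          have := le_max_right u0 (u - (N+1 : ℕ) * d)
          push_cast at this hu'; rw [hu'] ; push_cast; linarith
        have f4 : v' - d ≤ min v0 (v + N * d) := by
          have := min_le_right v0 (v + (N+1 : ℕ) * d)
          refine le_min (by have := min_le_left v0 (v + (N+1 : ℕ) * d); linarith) ?_
          push_cast at this; rw [hv']; push_cast; linarith
        refine ⟨max (max u0 (u - N * d)) (min w (min v0 (v + N * d))),
          ⟨le_max_left _ _, max_le (by linarith) (min_le_right _ _)⟩, ?_⟩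
        rw [abs_le]
        constructor
        · have : max (max u0 (u - N * d)) (min w (min v0 (v + N * d))) ≤ w + d :=
            max_le (by linarith [hw.1]) ((min_le_left _ _).trans (by linarith))
          linarith
        · have : w - d ≤ max (max u0 (u - N * d)) (min w (min v0 (v + N * d))) :=
            le_trans (le_min (by linarith) (by linarith [hw.2])) (le_max_right _ _)
          linarith
      have hy' : y ∈ Set.Icc u' v' := by
        refine ⟨le_trans (max_le_max le_rfl ?_) hy.1, hy.2.trans (min_le_min le_rfl ?_)⟩ <;>
          (push_cast; nlinarith)
      have hb := H u' v' e3 (by linarith) e4 |h w| hmax' w hw y hy'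
      have hw0 := abs_nonneg (h w)
      have hb2 : C * (|w - y| / (v' - u')) * |h w| ≤ (1/2) * |h w| := by
        gcongr
        calc C * (|w - y| / (v' - u')) ≤ C * (d / (v - u)) := by
              have : 0 < v - u := by linarith
              gcongr
          _ = 1/2 := by
              have : v - u ≠ 0 := by linarith
              rw [hd]; field_simp
      have hyS := ih y hy
      have htri : |h w| ≤ |h w - h y| + |h y| := by
        have := abs_add_le (h w - h y) (h y); simpa using this
      intro z hz
      refine (hmax' z hz).trans ?_
      rw [pow_succ]
      linarith
  intro z hz
  refine key N z ⟨max_le hz.1 ?_, le_min hz.2 ?_⟩ <;> linarith [hz.1, hz.2]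

lemma ML.good_aux {C lo hi : ℝ} {h : ℝ → ℝ} (hC : 1 ≤ C) (H : ML C lo hi h)
    (hc : ContinuousOn h (Set.Icc lo hi)) (K : ℕ) (hK : 2 * C ≤ K) (m : ℕ) :
    ∀ u v S, lo ≤ u → u < v → v ≤ hi → 0 < S → (∃ x ∈ Set.Icc u v, S ≤ |h x|) →
    volume {x ∈ Set.Icc u v | |h x| < ((1/2 : ℝ) ^ (K * K + 1)) ^ m * S} ≤
      ENNReal.ofReal ((1 - 1 / (K:ℝ)) ^ m * (v - u)) := by
  have hK2 : (2:ℝ) ≤ K := by linarith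
  have hKN : 2 ≤ K := by exact_mod_cast hK2
  have hK0 : (0:ℝ) < K := by linarith
  induction m with
  | zero =>
    intro u v S _ _ _ _ _
    refine (measure_mono (Set.sep_subset _ _)).trans ?_
    simp
  | succ m ih =>
    rintro u v S hu huv hv hS0 ⟨x0, hx0, hSx0⟩
    set c1 : ℝ := (1/2 : ℝ) ^ (K * K + 1) with hc1
    have hc1p : 0 < c1 := by positivity
    have hc1h : c1 ≤ 1/2 := by
      rw [hc1, pow_succ]
      have : (1/2:ℝ)^(K*K) ≤ 1 := pow_le_one₀ (by norm_num) (by norm_num)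
      linarith
    set L := (v - u) / K with hL
    have hLp : 0 < L := div_pos (by linarith) hK0
    have hLK : K * L = v - u := by rw [hL]; field_simp
    let P : ℕ → Set ℝ := fun i => Set.Icc (u + i * L) (u + (i+1) * L)
    have hcover : ∀ x ∈ Set.Icc u v, ∃ i < K, x ∈ P i := by
      intro x hx
      by_cases hxv : x = v
      · refine ⟨K - 1, by omega, ?_⟩
        have : ((K - 1 : ℕ) : ℝ) = K - 1 := by rw [Nat.cast_sub (by omega)]; simp
        simp only [P, this, Set.mem_Icc, hxv]
        constructor <;> nlinarith
      · have hxv' : x < v := lt_of_le_of_ne hx.2 hxv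
        refine ⟨⌊(x - u) / L⌋₊, ?_, ?_, ?_⟩
        · rw [Nat.floor_lt (div_nonneg (by linarith [hx.1]) hLp.le), div_lt_iff₀ hLp, hLK]
          linarith
        · have := Nat.floor_le (div_nonneg (by linarith [hx.1] : 0 ≤ x - u) hLp.le)
          rw [le_div_iff₀ hLp] at this
          linarith
        · have := Nat.lt_floor_add_one ((x - u) / L)
          rw [div_lt_iff₀ hLp] at this
          linarith
    have hPl : ∀ i < K, u ≤ u + i * L ∧ u + (i+1) * L ≤ v := by
      intro i hi
      have : ((i:ℝ) + 1) ≤ K := by exact_mod_cast hi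
      constructor
      · nlinarith [Nat.cast_nonneg (α := ℝ) i]
      · nlinarith
    have hsub : Set.Icc u v ⊆ Set.Icc lo hi := Set.Icc_subset_Icc hu hv
    obtain ⟨w, hw, hmax⟩ := isCompact_Icc.exists_isMaxOn
        (Set.nonempty_Icc.2 huv.le) ((hc.mono hsub).abs)
    have hmax' : ∀ z ∈ Set.Icc u v, |h z| ≤ |h w| := fun z hz => hmax hz
    have hwS : S ≤ |h w| := hSx0.trans (hmax' x0 hx0)
    obtain ⟨i0, hi0, hwi⟩ := hcover w hw
    have hpart : ∀ i ∈ Finset.range K,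
        volume {x ∈ P i | |h x| < c1 ^ (m+1) * S} ≤
          if i = i0 then 0 else ENNReal.ofReal ((1 - 1 / (K:ℝ)) ^ m * L) := by
      intro i hi
      have hi := Finset.mem_range.1 hi
      split_ifs with hii
      · subst hii
        rw [nonpos_iff_eq_zero]
        convert measure_empty (μ := (volume : Measure ℝ))
        rw [Set.eq_empty_iff_forall_notMem]
        rintro x ⟨hx, hxs⟩
        have hxB : x ∈ Set.Icc u v := ⟨(hPl i hi).1.trans hx.1, hx.2.trans (hPl i hi).2⟩
        have h1 := H u v hu huv hv _ hmax' w hw x hxB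
        have h2 : |w - x| ≤ L := by
          rw [abs_le]; constructor <;> nlinarith [hx.1, hx.2, hwi.1, hwi.2]
        have h3 : C * (|w - x| / (v - u)) ≤ 1/2 := by
          rw [← hLK, mul_div_assoc', div_le_iff₀ (by positivity)]
          nlinarith [abs_nonneg (w - x)]
        have h4 : |h w - h x| ≤ 1/2 * |h w| :=
          h1.trans (mul_le_mul_of_nonneg_right h3 (abs_nonneg _))
        have h5 : |h w| - |h x| ≤ |h w - h x| := abs_sub_abs_le_abs_sub _ _
        have h6 : c1 ^ (m+1) ≤ 1/2 := by
          rw [pow_succ]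
          have : c1 ^ m ≤ 1 := pow_le_one₀ hc1p.le (by linarith)
          nlinarith
        nlinarith
      · have h1 := ih (u + i * L) (u + (i+1) * L) (c1 * S) (by linarith [(hPl i hi).1])
          (by nlinarith) (by linarith [(hPl i hi).2]) (by positivity) (by
            by_contra hcon
            push Not at hcon
            have := H.remez hC hc hu (hPl i hi).1 (by nlinarith) (hPl i hi).2 hv
              (fun z hz => (hcon z hz).le) (K * K) (by
                rw [← hLK, show u + (i+1) * L - (u + i * L) = L by ring]
                push_cast
                rw [mul_assoc]
                gcongr
                rw [mul_div_assoc', le_div_iff₀ (by linarith)]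
                nlinarith) x0 hx0
            have e : (2:ℝ) ^ (K*K) * (c1 * S) = S / 2 := by
              rw [hc1, pow_succ, one_div, inv_pow]; field_simp
            rw [e] at this
            linarith)
        rw [show c1 ^ (m+1) * S = c1 ^ m * (c1 * S) by ring]
        refine h1.trans (le_of_eq ?_)
        congr 2; ring
    have hset : {x ∈ Set.Icc u v | |h x| < c1 ^ (m+1) * S} ⊆
        ⋃ i ∈ Finset.range K, {x ∈ P i | |h x| < c1 ^ (m+1) * S} := by
      rintro x ⟨hx, hxs⟩
      obtain ⟨i, hi, hxi⟩ := hcover x hx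
      simp only [Set.mem_iUnion]
      exact ⟨i, Finset.mem_range.2 hi, hxi, hxs⟩
    refine (measure_mono hset).trans ((measure_biUnion_finset_le _ _).trans
      ((Finset.sum_le_sum hpart).trans ?_))
    rw [Finset.sum_ite, Finset.sum_const_zero, zero_add, Finset.sum_const]
    have hcard : ((Finset.range K).filter (fun x => ¬ x = i0)).card = K - 1 := by
      rw [Finset.filter_ne', Finset.card_erase_of_mem (Finset.mem_range.2 hi0), Finset.card_range]
    rw [hcard, nsmul_eq_mul, ← ENNReal.ofReal_natCast, ← ENNReal.ofReal_mul (by positivity)]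
    apply ENNReal.ofReal_le_ofReal
    rw [Nat.cast_sub (by omega), ← hLK, pow_succ]
    apply le_of_eq
    push_cast
    field_simp

/-- Remez, ready to use constants -/
lemma remez_half (C : ℝ) (hC : 1 ≤ C) : ∃ c : ℝ, 0 < c ∧ c ≤ 1 ∧ ∀ lo hi h, ML C lo hi h →
    ContinuousOn h (Set.Icc lo hi) → ∀ u0 u v v0 S, lo ≤ u0 → u0 ≤ u → u < v → v ≤ v0 → v0 ≤ hi →
    v0 - u0 ≤ 2 * (v - u) → (∃ x ∈ Set.Icc u0 v0, S ≤ |h x|) → 0 < S →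
    ∃ x ∈ Set.Icc u v, c * S ≤ |h x| := by
  obtain ⟨N, hN⟩ := exists_nat_ge (4 * C)
  refine ⟨(1/2)^(N+1), by positivity, pow_le_one₀ (by norm_num) (by norm_num), ?_⟩
  rintro lo hi h H hc u0 u v v0 S h1 h2 h3 h4 h5 h6 ⟨x, hx, hxS⟩ hS
  by_contra hcon
  push Not at hcon
  have := H.remez hC hc h1 h2 h3 h4 h5 (fun z hz => (hcon z hz).le) N (by
    rw [mul_div_assoc', le_div_iff₀ (by linarith)]
    nlinarith) x hx
  have e : (2:ℝ) ^ N * ((1/2)^(N+1) * S) = S / 2 := by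
    rw [pow_succ, one_div, inv_pow]; field_simp
  rw [e] at this
  linarith

/-- goodness -/
lemma ML.good (C : ℝ) (hC : 1 ≤ C) : ∃ K α : ℝ, 0 < K ∧ 0 < α ∧ ∀ lo hi h, ML C lo hi h →
    ContinuousOn h (Set.Icc lo hi) → ∀ u v S ε, lo ≤ u → u < v → v ≤ hi → 0 < S → 0 < ε → ε ≤ 1 →
    (∃ x ∈ Set.Icc u v, S ≤ |h x|) →
    volume {x ∈ Set.Icc u v | |h x| < ε * S} ≤ ENNReal.ofReal (K * ε ^ α * (v - u)) := by
  obtain ⟨K, hK⟩ := exists_nat_ge (2 * C)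
  have hK2 : (2:ℝ) ≤ K := by linarith
  set c1 : ℝ := (1/2 : ℝ) ^ (K * K + 1) with hc1
  have hc1p : 0 < c1 := by positivity
  have hc1h : c1 < 1 := pow_lt_one₀ (by norm_num) (by norm_num) (by omega)
  set θ : ℝ := 1 - 1 / (K:ℝ) with hθ
  have hKi : 1 / (K:ℝ) ≤ 1/2 := by
    apply one_div_le_one_div_of_le <;> linarith
  have hKi0 : 0 < 1 / (K:ℝ) := by positivity
  have hθ0 : 0 < θ := by linarith
  have hθ1 : θ < 1 := by linarith
  have hlc : Real.log c1 < 0 := Real.log_neg hc1p hc1h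
  have hlθ : Real.log θ < 0 := Real.log_neg hθ0 hθ1
  refine ⟨θ⁻¹, Real.log θ / Real.log c1, by positivity, div_pos_of_neg_of_neg hlθ hlc, ?_⟩
  intro lo hi h H hc u v S ε hu huv hv hS hε hε1 hex
  set y := Real.log ε / Real.log c1 with hy
  have hy0 : 0 ≤ y := div_nonneg_of_nonpos (Real.log_nonpos hε.le hε1) hlc.le
  set m := ⌊y⌋₊ with hm
  have hmy : (m:ℝ) ≤ y := Nat.floor_le hy0
  have hmy' : y < m + 1 := Nat.lt_floor_add_one y
  have hε2 : ε ≤ c1 ^ m := by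
    rw [← Real.log_le_log_iff hε (by positivity), Real.log_pow]
    rw [hy, le_div_iff_of_neg hlc] at hmy
    exact hmy
  refine (measure_mono ?_).trans ((H.good_aux hC hc K hK m u v S hu huv hv hS hex).trans ?_)
  · rintro x ⟨hx, hxs⟩
    exact ⟨hx, hxs.trans_le (by gcongr)⟩
  · apply ENNReal.ofReal_le_ofReal
    have : 0 < v - u := by linarith
    gcongr
    rw [← div_eq_inv_mul, le_div_iff₀ hθ0, ← pow_succ]
    rw [← Real.log_le_log_iff (by positivity) (by positivity), Real.log_pow, Real.log_rpow hε]
    push_cast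
    rw [div_mul_eq_mul_div, mul_div_assoc, mul_comm (Real.log θ)]
    exact mul_le_mul_of_nonpos_right hmy'.le hlθ.le

end BB

set_option linter.unusedVariables false
open MeasureTheory ENNReal

namespace BB

/-! ### Part B2 : function spaces with Markov inequalities -/

/-- linear combination -/
def lin {ι : Type*} [Fintype ι] (b : ι → ℝ) (φ : ι → ℝ → ℝ) (x : ℝ) : ℝ := ∑ i, b i * φ i x

/-- finite dimensional function space (with constants) satisfying Markov inequalities -/
structure FS {ι : Type*} [Fintype ι] (o : ι) (C lo hi : ℝ) (φ φ1 φ2 : ι → ℝ → ℝ) : Prop where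
  hC : 1 ≤ C
  d0 : ∀ i, ∀ x ∈ Set.Icc lo hi, HasDerivAt (φ i) (φ1 i x) x
  d1 : ∀ i, ∀ x ∈ Set.Icc lo hi, HasDerivAt (φ1 i) (φ2 i x) x
  one : ∀ x, φ o x = 1
  one1 : ∀ x, φ1 o x = 0
  one2 : ∀ x, φ2 o x = 0
  M : ∀ (b : ι → ℝ) u v, lo ≤ u → u < v → v ≤ hi → ∀ S, (∀ z ∈ Set.Icc u v, |lin b φ z| ≤ S) →
    ∀ z ∈ Set.Icc u v, |lin b φ1 z| ≤ C * S / (v - u) ∧ |lin b φ2 z| ≤ C * S / (v - u)^2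

lemma abs_sub_le_of_deriv {g g' : ℝ → ℝ} {u v B : ℝ}
    (hd : ∀ x ∈ Set.Icc u v, HasDerivAt g (g' x) x) (hB : ∀ x ∈ Set.Icc u v, |g' x| ≤ B)
    {x y : ℝ} (hx : x ∈ Set.Icc u v) (hy : y ∈ Set.Icc u v) : |g x - g y| ≤ B * |x - y| :=
  Convex.norm_image_sub_le_of_norm_hasDerivWithin_le (f := g) (f' := g') (s := Set.Icc u v)
    (fun z hz => (hd z hz).hasDerivWithinAt) hB (convex_Icc u v) hy hx

lemma ML_of_deriv {C lo hi : ℝ} {g g' : ℝ → ℝ} (hd : ∀ x ∈ Set.Icc lo hi, HasDerivAt g (g' x) x)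
    (H : ∀ u v, lo ≤ u → u < v → v ≤ hi → ∀ S, (∀ z ∈ Set.Icc u v, |g z| ≤ S) →
    ∀ z ∈ Set.Icc u v, |g' z| ≤ C * S / (v - u)) : ML C lo hi g := by
  intro u v hu huv hv S hS x hx y hy
  have h1 := abs_sub_le_of_deriv (g := g) (g' := g') (u := u) (v := v) (B := C * S / (v-u))
    (fun z hz => hd z ⟨hu.trans hz.1, hz.2.trans hv⟩) (H u v hu huv hv S hS) hx hy
  refine h1.trans (le_of_eq ?_)
  ring

namespace FS
variable {ι : Type*} [Fintype ι] {o : ι} {C lo hi : ℝ} {φ φ1 φ2 : ι → ℝ → ℝ}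

lemma hd0 (h : FS o C lo hi φ φ1 φ2) (b : ι → ℝ) {x : ℝ} (hx : x ∈ Set.Icc lo hi) :
    HasDerivAt (lin b φ) (lin b φ1 x) x := by
  unfold lin
  exact HasDerivAt.fun_sum fun i _ => (h.d0 i x hx).const_mul (b i)

lemma hd1 (h : FS o C lo hi φ φ1 φ2) (b : ι → ℝ) {x : ℝ} (hx : x ∈ Set.Icc lo hi) :
    HasDerivAt (lin b φ1) (lin b φ2 x) x := by
  unfold lin
  exact HasDerivAt.fun_sum fun i _ => (h.d1 i x hx).const_mul (b i)

lemma sub (h : FS o C lo hi φ φ1 φ2) {lo' hi' : ℝ} (h1 : lo ≤ lo') (h2 : hi' ≤ hi) :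
    FS o C lo' hi' φ φ1 φ2 :=
  ⟨h.hC, fun i x hx => h.d0 i x ⟨h1.trans hx.1, hx.2.trans h2⟩,
    fun i x hx => h.d1 i x ⟨h1.trans hx.1, hx.2.trans h2⟩, h.one, h.one1, h.one2,
    fun b u v hu huv hv => h.M b u v (h1.trans hu) huv (hv.trans h2)⟩

lemma cont0 (h : FS o C lo hi φ φ1 φ2) (b : ι → ℝ) : ContinuousOn (lin b φ) (Set.Icc lo hi) :=
  fun x hx => (h.hd0 b hx).continuousAt.continuousWithinAt

lemma cont1 (h : FS o C lo hi φ φ1 φ2) (b : ι → ℝ) : ContinuousOn (lin b φ1) (Set.Icc lo hi) :=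
  fun x hx => (h.hd1 b hx).continuousAt.continuousWithinAt

lemma ML0 (h : FS o C lo hi φ φ1 φ2) (b : ι → ℝ) : ML C lo hi (lin b φ) :=
  ML_of_deriv (fun x hx => h.hd0 b hx) fun u v hu huv hv S hS z hz => (h.M b u v hu huv hv S hS z hz).1

lemma lin_sub_const [DecidableEq ι] (h : FS o C lo hi φ φ1 φ2) (b : ι → ℝ) (w x : ℝ) :
    lin (b - Pi.single o w) φ x = lin b φ x - w ∧ lin (b - Pi.single o w) φ1 x = lin b φ1 x ∧
    lin (b - Pi.single o w) φ2 x = lin b φ2 x := by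
  refine ⟨?_, ?_, ?_⟩ <;>
  simp [lin, sub_mul, Finset.sum_sub_distrib, Pi.single_apply, h.one, h.one1, h.one2]

lemma M1 (h : FS o C lo hi φ φ1 φ2) (b : ι → ℝ) {u v : ℝ} (hu : lo ≤ u) (huv : u < v) (hv : v ≤ hi)
    {S : ℝ} (hS : ∀ z ∈ Set.Icc u v, |lin b φ1 z| ≤ S) {z : ℝ} (hz : z ∈ Set.Icc u v) :
    |lin b φ2 z| ≤ C * S / (v - u) := by
  classical
  have hu' : u ∈ Set.Icc u v := ⟨le_rfl, huv.le⟩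
  have hL : 0 < v - u := by linarith
  have hS0 : 0 ≤ S := (abs_nonneg _).trans (hS u hu')
  have h1 := (h.M (b - Pi.single o (lin b φ u)) u v hu huv hv (S * (v - u)) (fun z hz => by
    rw [(h.lin_sub_const b _ z).1]
    refine (abs_sub_le_of_deriv (g := lin b φ) (g' := lin b φ1) (u := u) (v := v) (B := S)
      (fun z hz => h.hd0 b ⟨hu.trans hz.1, hz.2.trans hv⟩) hS hz hu').trans ?_
    rw [abs_of_nonneg (by linarith [hz.1])]
    gcongr
    linarith [hz.2]) z hz).2
  rw [(h.lin_sub_const b _ z).2.2] at h1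
  refine h1.trans (le_of_eq ?_)
  field_simp

lemma ML1 (h : FS o C lo hi φ φ1 φ2) (b : ι → ℝ) : ML C lo hi (lin b φ1) :=
  ML_of_deriv (fun x hx => h.hd1 b hx) fun _ _ hu huv hv _ hS _ hz => h.M1 b hu huv hv hS hz

lemma lin_comb (b1 b2 : ι → ℝ) (s t : ℝ) (ψ : ι → ℝ → ℝ) (x : ℝ) :
    lin (s • b1 + t • b2) ψ x = s * lin b1 ψ x + t * lin b2 ψ x := by
  simp only [lin, Finset.mul_sum, ← Finset.sum_add_distrib]
  refine Finset.sum_congr rfl fun i _ => ?_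
  simp; ring

/-- key bound for the Wronskian -/
lemma wr_key (h : FS o C lo hi φ φ1 φ2) {N : ℕ} (hN : 4 * C ^ 2 ≤ N) (b1 b2 : ι → ℝ)
    {u v : ℝ} (hu : lo ≤ u) (huv : u < v) (hv : v ≤ hi) {S : ℝ}
    (hS : ∀ z ∈ Set.Icc u v, |lin b1 φ z * lin b2 φ1 z - lin b2 φ z * lin b1 φ1 z| ≤ S) :
    ∀ x ∈ Set.Icc u v, ∀ y ∈ Set.Icc u v,
      |lin b1 φ x * lin b2 φ y - lin b2 φ x * lin b1 φ y| ≤ 2 ^ (N+1) * S * (v - u) := by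
  have hC := h.hC
  set g1 := lin b1 φ with hg1
  set g2 := lin b2 φ with hg2
  set L := v - u with hL
  have hL0 : 0 < L := by linarith
  have hu' : u ∈ Set.Icc u v := ⟨le_rfl, huv.le⟩
  have hS0 : 0 ≤ S := (abs_nonneg _).trans (hS u hu')
  have hsub : Set.Icc u v ⊆ Set.Icc lo hi := Set.Icc_subset_Icc hu hv
  let K : ℝ × ℝ → ℝ := fun p => g1 p.1 * g2 p.2 - g2 p.1 * g1 p.2
  have hKc : ContinuousOn K (Set.Icc u v ×ˢ Set.Icc u v) := by
    have c1 := (h.cont0 b1).mono hsub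
    have c2 := (h.cont0 b2).mono hsub
    exact ((c1.comp continuousOn_fst fun p hp => hp.1).mul
        (c2.comp continuousOn_snd fun p hp => hp.2)).sub
      ((c2.comp continuousOn_fst fun p hp => hp.1).mul
        (c1.comp continuousOn_snd fun p hp => hp.2))
  obtain ⟨⟨x0, y0⟩, ⟨hx0, hy0⟩, hmax⟩ := (isCompact_Icc.prod isCompact_Icc).exists_isMaxOn
    ⟨(u, u), hu', hu'⟩ hKc.abs
  set κ := |K (x0, y0)| with hκ
  have hmax' : ∀ x ∈ Set.Icc u v, ∀ y ∈ Set.Icc u v, |K (x, y)| ≤ κ := fun x hx y hy =>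
    hmax (a := (x, y)) ⟨hx, hy⟩
  suffices hs : κ ≤ 2 ^ (N+1) * S * L from fun x hx y hy => (hmax' x hx y hy).trans hs
  rcases eq_or_lt_of_le (abs_nonneg (K (x0, y0))) with h0 | hκ0
  · rw [hκ, ← h0]; positivity
  -- h1 and h2
  have hlin : ∀ p : ℝ, ∀ y, lin ((g1 p) • b2 + (-(g2 p)) • b1) φ y = K (p, y) := fun p y => by
    rw [lin_comb]; simp only [K]; ring
  set c1 := (g1 x0) • b2 + (-(g2 x0)) • b1 with hc1
  set c2 := (g1 y0) • b2 + (-(g2 y0)) • b1 with hc2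
  have hb1 : ∀ z ∈ Set.Icc u v, |lin c1 φ z| ≤ κ := fun z hz => by
    rw [hlin]; exact hmax' x0 hx0 z hz
  have hW : ∀ z, lin c1 φ z * lin c2 φ1 z - lin c2 φ z * lin c1 φ1 z =
      K (x0, y0) * (lin b1 φ z * lin b2 φ1 z - lin b2 φ z * lin b1 φ1 z) := fun z => by
    simp only [hc1, hc2, lin_comb, K]; ring
  -- the small interval
  set d := L / (2 * C) with hd
  have hd0 : 0 < d := by positivity
  have hdL : d ≤ L / 2 := by
    rw [hd]; apply div_le_div_of_nonneg_left <;> linarith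
  obtain ⟨u1, v1, hu1, hv1, hl1, hy1⟩ : ∃ u1 v1, u ≤ u1 ∧ v1 ≤ v ∧ v1 - u1 = d ∧
      y0 ∈ Set.Icc u1 v1 := by
    by_cases hy : y0 ≤ u + L/2
    · exact ⟨y0, y0 + d, hy0.1, by linarith, by ring, le_rfl, by linarith⟩
    · exact ⟨y0 - d, y0, by linarith, hy0.2, by ring, by linarith, le_rfl⟩
  have hs1 : Set.Icc u1 v1 ⊆ Set.Icc u v := Set.Icc_subset_Icc hu1 hv1
  have hlow : ∀ z ∈ Set.Icc u1 v1, κ / 2 ≤ |lin c1 φ z| := by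
    intro z hz
    have e1 := h.ML0 c1 u v hu huv hv κ hb1 y0 hy0 z (hs1 hz)
    have e2 : |y0 - z| ≤ d := by
      rw [abs_le]; constructor <;> linarith [hy1.1, hy1.2, hz.1, hz.2]
    have e3 : C * (|y0 - z| / (v - u)) ≤ 1/2 := by
      calc C * (|y0 - z| / (v - u)) ≤ C * (d / (v - u)) := by gcongr
        _ = 1/2 := by rw [hd, ← hL]; field_simp
    have e4 : |lin c1 φ y0 - lin c1 φ z| ≤ 1/2 * κ :=
      e1.trans (mul_le_mul_of_nonneg_right e3 hκ0.le)
    have e5 : |lin c1 φ y0| = κ := by rw [hlin]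
    have e6 := abs_sub_abs_le_abs_sub (lin c1 φ y0) (lin c1 φ z)
    linarith
  have hquot : ∀ z ∈ Set.Icc u1 v1, HasDerivAt (fun z => lin c2 φ z / lin c1 φ z)
      ((lin c2 φ1 z * lin c1 φ z - lin c2 φ z * lin c1 φ1 z) / (lin c1 φ z)^2) z := by
    intro z hz
    have hne : lin c1 φ z ≠ 0 := by
      have := hlow z hz
      exact abs_pos.1 (by linarith)
    exact (h.hd0 c2 (hsub (hs1 hz))).div (h.hd0 c1 (hsub (hs1 hz))) hne
  have hsmall : ∀ z ∈ Set.Icc u1 v1, |lin c2 φ z| ≤ 2 * S * L := by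
    intro z hz
    have e1 := abs_sub_le_of_deriv hquot (B := 4 * S / κ) (fun w hw => by
      have e2 : lin c2 φ1 w * lin c1 φ w - lin c2 φ w * lin c1 φ1 w =
        K (x0, y0) * (lin b1 φ w * lin b2 φ1 w - lin b2 φ w * lin b1 φ1 w) := by
        rw [← hW]; ring
      have hl := hlow w hw
      have hpw : 0 < |lin c1 φ w| := by linarith
      rw [e2, abs_div, abs_mul, abs_pow, div_le_div_iff₀ (by positivity) hκ0]
      calc |K (x0, y0)| * |lin b1 φ w * lin b2 φ1 w - lin b2 φ w * lin b1 φ1 w| * κ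
          ≤ κ * S * κ := by gcongr; exact hS w (hs1 hw)
        _ = 4 * S * (κ/2)^2 := by ring
        _ ≤ _ := by gcongr) hz hy1
    have e0 : lin c2 φ y0 = 0 := by rw [hlin]; simp only [K]; ring
    rw [e0, zero_div, sub_zero, abs_div] at e1
    have e2 : |z - y0| ≤ d := by
      rw [abs_le]; constructor <;> linarith [hy1.1, hy1.2, hz.1, hz.2]
    have hl := hlow z hz
    have hp : 0 < |lin c1 φ z| := by linarith
    rw [div_le_iff₀ hp] at e1
    calc |lin c2 φ z| ≤ 4 * S / κ * |z - y0| * |lin c1 φ z| := e1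
      _ ≤ 4 * S / κ * (L/2) * κ := by
          gcongr
          · exact e2.trans hdL
          · exact hb1 z (hs1 hz)
      _ = 2 * S * L := by
          have : κ ≠ 0 := by rw [hκ]; exact hκ0.ne'
          field_simp; ring
  have := (h.ML0 c2).remez hC (h.cont0 c2) hu hu1 (by linarith) hv1 hv hsmall N (by
    rw [hl1, hd, ← hL]
    rw [div_div, mul_div_assoc', le_div_iff₀ (by positivity)]
    nlinarith) x0 hx0
  rw [hlin] at this
  have hsym : |K (y0, x0)| = κ := by
    rw [hκ, ← abs_neg]; congr 1; simp only [K]; ring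
  rw [hsym] at this
  rw [pow_succ]; linarith

lemma MLW (h : FS o C lo hi φ φ1 φ2) {N : ℕ} (hN : 4 * C ^ 2 ≤ N) (b1 b2 : ι → ℝ) :
    ML (C * 2 ^ (N+1)) lo hi
      (fun x => lin b1 φ x * lin b2 φ1 x - lin b2 φ x * lin b1 φ1 x) := by
  refine ML_of_deriv (g' := fun x => lin b1 φ x * lin b2 φ2 x - lin b2 φ x * lin b1 φ2 x) ?_ ?_
  · intro x hx
    have := ((h.hd0 b1 hx).mul (h.hd1 b2 hx)).sub ((h.hd0 b2 hx).mul (h.hd1 b1 hx))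
    refine this.congr_deriv ?_
    ring
  · intro u v hu huv hv S hS z hz
    have hk := h.wr_key hN b1 b2 hu huv hv hS z hz
    have := (h.M ((lin b1 φ z) • b2 + (-(lin b2 φ z)) • b1) u v hu huv hv
      (2 ^ (N+1) * S * (v-u)) (fun y hy => by
        rw [lin_comb]
        convert hk y hy using 2
        ring) z hz).2
    rw [lin_comb] at this
    have hL0 : 0 < v - u := by linarith
    calc _ = |lin b1 φ z * lin b2 φ2 z + -lin b2 φ z * lin b1 φ2 z| := by congr 1; ring
      _ ≤ _ := this
      _ = _ := by field_simp

end FS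
end BB

set_option linter.unusedVariables false
open MeasureTheory ENNReal

namespace BB

/-! ### Part B3 : minors of `A * M x` -/

section comp
variable {ι : Type*} [Fintype ι] [DecidableEq ι]

/-- the matrix `M(x)` (weighted) -/
def Mx (o j : ι) (w : ι → ℝ) (φ φ1 : ι → ℝ → ℝ) (x : ℝ) : Matrix ι ι ℝ :=
  Matrix.of fun i' i => w i * (if i = o then φ i' x else if i = j then φ1 i' x else
    if i' = i then 1 else 0)

lemma mul_Mx {κ : Type*} (A : Matrix κ ι ℝ) (o j : ι) (w : ι → ℝ) (φ φ1 : ι → ℝ → ℝ) (x : ℝ)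
    (l : κ) (i : ι) :
    (A * Mx o j w φ φ1 x) l i =
      w i * (if i = o then lin (A l) φ x else if i = j then lin (A l) φ1 x else A l i) := by
  simp only [Matrix.mul_apply, Mx, Matrix.of_apply, lin]
  split_ifs
  · rw [Finset.mul_sum]; exact Finset.sum_congr rfl fun _ _ => by ring
  · rw [Finset.mul_sum]; exact Finset.sum_congr rfl fun _ _ => by ring
  · simp [mul_comm]

lemma mnr_mul_Mx {k : ℕ} (A : Matrix (Fin k) ι ℝ) (o j : ι) (w : ι → ℝ) (φ φ1 : ι → ℝ → ℝ) (x : ℝ)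
    (c : Fin k → ι) :
    mnr (A * Mx o j w φ φ1 x) c = (∏ l, w (c l)) * mnr (A * Mx o j 1 φ φ1 x) c := by
  rw [← mnr_scale]
  congr 1
  ext l i
  simp [mul_Mx]

lemma submatrix_update {κ : Type*} {k : ℕ} (Y : Matrix κ ι ℝ) (c : Fin k → ι) (l : Fin k) (i : ι) :
    Y.submatrix id (Function.update c l i) = (Y.submatrix id c).updateCol l (fun x => Y x i) := by
  ext a b
  by_cases h : b = l
  · subst h; simp
  · simp [h]

lemma det_updateCol_lin {k : ℕ} (X : Matrix (Fin k) (Fin k) ℝ) (A : Matrix (Fin k) ι ℝ)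
    (l : Fin k) (ψ : ι → ℝ → ℝ) (x : ℝ) :
    (X.updateCol l (fun a => lin (A a) ψ x)).det =
      ∑ i, ψ i x * (X.updateCol l (fun a => A a i)).det := by
  have : (fun a => lin (A a) ψ x) = ∑ i, ψ i x • (fun a => A a i) := by
    ext a; simp [lin, mul_comm]
  rw [← Matrix.cramer_apply, this, map_sum, Finset.sum_apply]
  refine Finset.sum_congr rfl fun i _ => ?_
  rw [map_smul, Pi.smul_apply, Matrix.cramer_apply, smul_eq_mul]

variable {k : ℕ} (A : Matrix (Fin k) ι ℝ) (o j : ι) (φ φ1 : ι → ℝ → ℝ) (x : ℝ)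
  (c : Fin k → ι)

lemma mnr_none (h : ∀ l, c l ≠ o ∧ c l ≠ j) : mnr (A * Mx o j 1 φ φ1 x) c = mnr A c := by
  unfold mnr
  congr 1
  ext a b
  simp [mul_Mx, (h b).1, (h b).2]

lemma mnr_o (l : Fin k) (hl : c l = o) (h : ∀ l', l' ≠ l → c l' ≠ o ∧ c l' ≠ j) :
    mnr (A * Mx o j 1 φ φ1 x) c = lin (fun i => mnr A (Function.update c l i)) φ x := by
  have : (A * Mx o j 1 φ φ1 x).submatrix id c =
      (A.submatrix id c).updateCol l (fun a => lin (A a) φ x) := by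
    ext a b
    by_cases hb : b = l
    · subst hb; simp [mul_Mx, hl]
    · simp [mul_Mx, hb, (h b hb).1, (h b hb).2]
  unfold mnr
  rw [this, det_updateCol_lin]
  simp only [lin, submatrix_update]
  exact Finset.sum_congr rfl fun _ _ => by ring

lemma mnr_j (hoj : o ≠ j) (l : Fin k) (hl : c l = j) (h : ∀ l', l' ≠ l → c l' ≠ o ∧ c l' ≠ j) :
    mnr (A * Mx o j 1 φ φ1 x) c = lin (fun i => mnr A (Function.update c l i)) φ1 x := by
  have : (A * Mx o j 1 φ φ1 x).submatrix id c =
      (A.submatrix id c).updateCol l (fun a => lin (A a) φ1 x) := by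
    ext a b
    by_cases hb : b = l
    · subst hb; simp [mul_Mx, hl, hoj.symm]
    · simp [mul_Mx, hb, (h b hb).1, (h b hb).2]
  unfold mnr
  rw [this, det_updateCol_lin]
  simp only [lin, submatrix_update]
  exact Finset.sum_congr rfl fun _ _ => by ring

lemma mnr_oj (hoj : o ≠ j) (l l' : Fin k) (hl : c l = o) (hl' : c l' = j)
    (h : ∀ b, b ≠ l → b ≠ l' → c b ≠ o ∧ c b ≠ j) :
    mnr (A * Mx o j 1 φ φ1 x) c = ∑ i, ∑ i',
      mnr A (Function.update (Function.update c l i) l' i') * (φ i x * φ1 i' x) := by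
  have hll : l ≠ l' := by rintro rfl; exact hoj (hl.symm.trans hl')
  have : (A * Mx o j 1 φ φ1 x).submatrix id c =
      ((A.submatrix id c).updateCol l (fun a => lin (A a) φ x)).updateCol l'
        (fun a => lin (A a) φ1 x) := by
    ext a b
    by_cases hb : b = l'
    · subst hb; simp [mul_Mx, hl', hoj.symm]
    · by_cases hb' : b = l
      · subst hb'; simp [mul_Mx, hl, hb]
      · simp [mul_Mx, hb, hb', (h b hb' hb).1, (h b hb' hb).2]
  unfold mnr
  rw [this, det_updateCol_lin, Finset.sum_comm]
  refine Finset.sum_congr rfl fun i' _ => ?_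
  have h2 : ((A.submatrix id c).updateCol l (fun a => lin (A a) φ x)).updateCol l'
      (fun a => A a i') = ((A.submatrix id c).updateCol l' (fun a => A a i')).updateCol l
        (fun a => lin (A a) φ x) := by
    ext a b
    by_cases hb : b = l'
    · subst hb; simp [hll.symm]
    · by_cases hb' : b = l
      · subst hb'; simp [hb]
      · simp [hb, hb']
  rw [h2, det_updateCol_lin, Finset.mul_sum]
  refine Finset.sum_congr rfl fun i _ => ?_
  rw [Function.update_comm hll, submatrix_update, submatrix_update]
  ring

lemma mnr_swap {k : ℕ} (A : Matrix (Fin k) ι ℝ) (c : Fin k → ι) {l l' : Fin k} (hll : l ≠ l')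
    (i i' : ι) : mnr A (Function.update (Function.update c l i) l' i') =
      - mnr A (Function.update (Function.update c l i') l' i) := by
  have : Function.update (Function.update c l i) l' i' =
      (Function.update (Function.update c l i') l' i) ∘ (Equiv.swap l l') := by
    ext b
    by_cases hb : b = l'
    · subst hb; simp [hll]
    · by_cases hb' : b = l
      · subst hb'; simp [hb]
      · simp [hb, hb', Equiv.swap_apply_of_ne_of_ne hb' hb]
  unfold mnr
  rw [this]
  have := Matrix.det_permute' (Equiv.swap l l')
    (A.submatrix id (Function.update (Function.update c l i') l' i))
  rw [Equiv.Perm.sign_swap hll] at this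
  simpa using this

/-- decomposability of the `{o,j}` part -/
lemma mnr_plucker {k : ℕ} (A : Matrix (Fin k) ι ℝ) (c : Fin k → ι) {l l' : Fin k} (hll : l ≠ l')
    (i i' p q : ι) :
    mnr A (Function.update (Function.update c l i) l' i') *
      mnr A (Function.update (Function.update c l p) l' q) =
    mnr A (Function.update (Function.update c l i) l' q) *
      mnr A (Function.update (Function.update c l p) l' i') -
    mnr A (Function.update (Function.update c l p) l' i) *
      mnr A (Function.update (Function.update c l i') l' q) := by
  rw [mnr_exchange A _ _ l']
  have h1 : ∀ b, b ≠ l → b ≠ l' → mnr A (Function.update (Function.update (Function.update c l i) l' i') l'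
      (Function.update (Function.update c l p) l' q b)) = 0 := by
    intro b hb hb'
    apply mnr_eq_zero_of_eq A _ hb'
    simp [hb, hb']
  rw [Finset.sum_eq_add l l' hll (fun b _ hb => by rw [h1 b hb.1 hb.2, zero_mul])
    (by simp) (by simp)]
  have e1 : Function.update (Function.update (Function.update c l i) l' i') l'
      (Function.update (Function.update c l p) l' q l) =
      Function.update (Function.update c l i) l' p := by simp [hll]
  have e2 : Function.update (Function.update (Function.update c l i) l' i') l'
      (Function.update (Function.update c l p) l' q l') =
      Function.update (Function.update c l i) l' q := by simp
  have e3 : Function.update (Function.update (Function.update c l p) l' q) l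
      (Function.update (Function.update c l i) l' i' l') =
      Function.update (Function.update c l i') l' q := by
    rw [Function.update_comm hll.symm]; simp
  have e4 : Function.update (Function.update (Function.update c l p) l' q) l'
      (Function.update (Function.update c l i) l' i' l') =
      Function.update (Function.update c l p) l' i' := by
    simp
  rw [e1, e2, e3, e4, mnr_swap A c hll i p]
  ring

lemma mnr_oj_wr (hoj : o ≠ j) (l l' : Fin k) (hl : c l = o) (hl' : c l' = j)
    (h : ∀ b, b ≠ l → b ≠ l' → c b ≠ o ∧ c b ≠ j) :
    ∃ (s : ℝ) (b1 b2 : ι → ℝ), ∀ x, mnr (A * Mx o j 1 φ φ1 x) c =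
      s * (lin b1 φ x * lin b2 φ1 x - lin b2 φ x * lin b1 φ1 x) := by
  have hll : l ≠ l' := by rintro rfl; exact hoj (hl.symm.trans hl')
  set K : ι → ι → ℝ := fun i i' => mnr A (Function.update (Function.update c l i) l' i') with hK
  by_cases h0 : ∀ i i', K i i' = 0
  · refine ⟨0, 0, 0, fun x => ?_⟩
    rw [mnr_oj A o j φ φ1 x c hoj l l' hl hl' h, zero_mul]
    refine Finset.sum_eq_zero fun i _ => Finset.sum_eq_zero fun i' _ => ?_
    have := h0 i i'
    simp only [hK] at this
    rw [this, zero_mul]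
  · push Not at h0
    obtain ⟨p, q, hpq⟩ := h0
    refine ⟨(K p q)⁻¹, fun i => K i q, fun i => K p i, fun x => ?_⟩
    rw [mnr_oj A o j φ φ1 x c hoj l l' hl hl' h, eq_inv_mul_iff_mul_eq₀ hpq]
    simp only [lin, Finset.mul_sum, Finset.sum_mul, ← Finset.sum_sub_distrib]
    rw [Finset.sum_comm]
    refine Finset.sum_congr rfl fun i' _ => ?_
    refine Finset.sum_congr rfl fun i _ => ?_
    have := mnr_plucker A c hll i i' p q
    simp only [hK]
    linear_combination (φ i x * φ1 i' x) * this

end comp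

/-- cases for the columns -/
lemma cols_cases {ι : Type*} {k : ℕ} (o j : ι) (c : Fin k → ι) (hc : Function.Injective c) :
    (∀ l, c l ≠ o ∧ c l ≠ j) ∨
    (∃ l, c l = o ∧ ∀ l', l' ≠ l → c l' ≠ o ∧ c l' ≠ j) ∨
    (∃ l, c l = j ∧ ∀ l', l' ≠ l → c l' ≠ o ∧ c l' ≠ j) ∨
    (∃ l l', c l = o ∧ c l' = j ∧ ∀ b, b ≠ l → b ≠ l' → c b ≠ o ∧ c b ≠ j) := by
  by_cases h1 : ∃ l, c l = o
  · obtain ⟨l, hl⟩ := h1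
    by_cases h2 : ∃ l', c l' = j
    · obtain ⟨l', hl'⟩ := h2
      refine Or.inr (Or.inr (Or.inr ⟨l, l', hl, hl', fun b hb hb' => ⟨?_, ?_⟩⟩))
      · rw [← hl]; exact fun e => hb (hc e)
      · rw [← hl']; exact fun e => hb' (hc e)
    · push Not at h2
      refine Or.inr (Or.inl ⟨l, hl, fun b hb => ⟨?_, h2 b⟩⟩)
      rw [← hl]; exact fun e => hb (hc e)
  · push Not at h1
    by_cases h2 : ∃ l', c l' = j
    · obtain ⟨l', hl'⟩ := h2
      refine Or.inr (Or.inr (Or.inl ⟨l', hl', fun b hb => ⟨h1 b, ?_⟩⟩))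
      rw [← hl']; exact fun e => hb (hc e)
    · push Not at h2
      exact Or.inl fun l => ⟨h1 l, h2 l⟩

/-- vector of all minors, with the sup norm -/
noncomputable def Psi {ι : Type*} [Fintype ι] {k : ℕ} (Y : Matrix (Fin k) ι ℝ) : ℝ :=
  ‖(fun c => mnr Y c : (Fin k → ι) → ℝ)‖

lemma le_Psi {ι : Type*} [Fintype ι] {k : ℕ} (Y : Matrix (Fin k) ι ℝ) (c : Fin k → ι) :
    |mnr Y c| ≤ Psi Y := norm_le_pi_norm (fun c => mnr Y c : (Fin k → ι) → ℝ) c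

lemma Psi_le {ι : Type*} [Fintype ι] {k : ℕ} (Y : Matrix (Fin k) ι ℝ) {S : ℝ} (hS : 0 ≤ S)
    (h : ∀ c, |mnr Y c| ≤ S) : Psi Y ≤ S := (pi_norm_le_iff_of_nonneg hS).2 h

lemma Psi_nonneg {ι : Type*} [Fintype ι] {k : ℕ} (Y : Matrix (Fin k) ι ℝ) : 0 ≤ Psi Y :=
  norm_nonneg _

lemma FS.psi {ι : Type*} [Fintype ι] [DecidableEq ι] {o : ι} {C lo hi : ℝ}
    {φ φ1 φ2 : ι → ℝ → ℝ} (h : FS o C lo hi φ φ1 φ2) {N : ℕ} (hN : 4 * C ^ 2 ≤ N) {j : ι}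
    (hoj : o ≠ j) (w : ι → ℝ) {k : ℕ} (A : Matrix (Fin k) ι ℝ) :
    ML (C * 2 ^ (N+1)) lo hi (fun x => Psi (A * Mx o j w φ φ1 x)) ∧
      ContinuousOn (fun x => Psi (A * Mx o j w φ φ1 x)) (Set.Icc lo hi) := by
  have hC := h.hC
  have hC0 : 0 ≤ C * 2 ^ (N+1) := by positivity
  have hCC : C ≤ C * 2 ^ (N+1) := le_mul_of_one_le_right (by linarith) (one_le_pow₀ (by norm_num))
  have key : ∀ c : Fin k → ι, ML (C * 2 ^ (N+1)) lo hi (fun x => mnr (A * Mx o j 1 φ φ1 x) c) ∧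
      ContinuousOn (fun x => mnr (A * Mx o j 1 φ φ1 x) c) (Set.Icc lo hi) := by
    intro c
    by_cases hc : Function.Injective c
    · rcases cols_cases o j c hc with h1 | ⟨l, hl, h1⟩ | ⟨l, hl, h1⟩ | ⟨l, l', hl, hl', h1⟩
      · simp_rw [mnr_none A o j φ φ1 _ c h1]
        exact ⟨ML.const hC0 _, continuousOn_const⟩
      · simp_rw [mnr_o A o j φ φ1 _ c l hl h1]
        exact ⟨(h.ML0 _).mono hCC, h.cont0 _⟩
      · simp_rw [mnr_j A o j φ φ1 _ c hoj l hl h1]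
        exact ⟨(h.ML1 _).mono hCC, h.cont1 _⟩
      · obtain ⟨s, b1, b2, hs⟩ := mnr_oj_wr A o j φ φ1 c hoj l l' hl hl' h1
        simp_rw [hs]
        exact ⟨(h.MLW hN b1 b2).const_mul hC0 s, continuousOn_const.mul
          (((h.cont0 b1).mul (h.cont1 b2)).sub ((h.cont0 b2).mul (h.cont1 b1)))⟩
    · rw [Function.Injective] at hc
      push Not at hc
      obtain ⟨l, l', he, hne⟩ := hc
      simp_rw [mnr_eq_zero_of_eq _ c hne he]
      exact ⟨ML.const hC0 _, continuousOn_const⟩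
  have key2 : ∀ c : Fin k → ι, ML (C * 2 ^ (N+1)) lo hi (fun x => mnr (A * Mx o j w φ φ1 x) c) ∧
      ContinuousOn (fun x => mnr (A * Mx o j w φ φ1 x) c) (Set.Icc lo hi) := by
    intro c
    simp_rw [mnr_mul_Mx A o j w]
    exact ⟨(key c).1.const_mul hC0 _, continuousOn_const.mul (key c).2⟩
  refine ⟨ML.pi_norm hC0 fun c => (key2 c).1, ?_⟩
  exact ContinuousOn.norm (continuousOn_pi.2 fun c => (key2 c).2)

end BB

set_option linter.unusedVariables false
open MeasureTheory ENNReal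

namespace BB

/-! ### Part C : quantitative nondivergence -/

lemma vol_split (X : Set ℝ) {u w v a b : ℝ}
    (h1 : volume (X ∩ Set.Icc u w) ≤ ENNReal.ofReal a) (h2 : volume (X ∩ Set.Icc w v) ≤ ENNReal.ofReal b)
    (ha : 0 ≤ a) (hb : 0 ≤ b) : volume (X ∩ Set.Icc u v) ≤ ENNReal.ofReal (a + b) := by
  rw [ENNReal.ofReal_add ha hb]
  refine (measure_mono ?_).trans ((measure_union_le _ _).trans (add_le_add h1 h2))
  rintro x ⟨hx, hx2⟩
  rcases le_total x w with h | h
  · exact Or.inl ⟨hx, hx2.1, h⟩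
  · exact Or.inr ⟨hx, h, hx2.2⟩

lemma nondiv_abs (C : ℝ) (hC : 1 ≤ C) (m : ℕ) : ∃ K α : ℝ, 0 < K ∧ 0 < α ∧
    ∀ {β : Type} [PartialOrder β] (P : Finset β) (ψ : β → ℝ → ℝ) (lo hi : ℝ) (B : Set ℝ) (ε : ℝ),
    lo < hi → 0 < ε → ε ≤ 1 →
    (∀ E ∈ P, ML C lo hi (ψ E)) → (∀ E ∈ P, ContinuousOn (ψ E) (Set.Icc lo hi)) →
    (∀ E ∈ P, ∀ x, 0 ≤ ψ E x) →
    (∀ F ⊆ P, IsChain (· ≤ ·) (F : Set β) → F.card ≤ m) →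
    (∀ E ∈ P, ∃ x ∈ Set.Icc lo hi, 1 ≤ ψ E x) →
    (∀ x ∈ Set.Icc lo hi, ∀ F ⊆ P, IsChain (· ≤ ·) (F : Set β) →
      (∀ E ∈ F, ε ≤ ψ E x ∧ ψ E x ≤ 1) →
      (∀ E ∈ P, E ∉ F → (∀ G ∈ F, E ≤ G ∨ G ≤ E) → ε ≤ ψ E x) → x ∉ B) →
    volume (B ∩ Set.Icc lo hi) ≤ ENNReal.ofReal (K * ε ^ α * (hi - lo)) := by
  obtain ⟨c1, hc1, hc11, hremez⟩ := remez_half C hC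
  obtain ⟨K, α, hK, hα, hgood⟩ := ML.good C hC
  set ρ : ℕ → ℝ := fun δ => c1 ^ (m + 1 - δ) with hρ
  have hρ0 : ∀ δ, 0 < ρ δ := fun δ => by simp only [hρ]; positivity
  have hρ1 : ∀ δ, ρ δ ≤ 1 := fun δ => pow_le_one₀ hc1.le hc11
  have hρs : ∀ δ, δ ≤ m → ρ δ = c1 * ρ (δ+1) := fun δ hδ => by
    simp only [hρ]
    rw [← pow_succ']
    congr 1; omega
  have hρm : ∀ δ, ρ 0 ≤ ρ δ := fun δ =>
    pow_le_pow_of_le_one hc1.le hc11 (by omega)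
  set s0 := ρ 0 / 2 with hs0
  have hs0p : 0 < s0 := by have := hρ0 0; positivity
  refine ⟨(m+1) * K * (1/s0) ^ α + (1/s0) ^ α, α, by positivity, hα, ?_⟩
  intro β _ P ψ lo hi B ε hlohi hε hε1 hML hcont hpos hchain hLB hmark
  classical
  rcases lt_or_ge s0 ε with hbig | hsmall
  · refine (measure_mono Set.inter_subset_right).trans ?_
    rw [Real.volume_Icc]
    apply ENNReal.ofReal_le_ofReal
    have h1 : 1 ≤ (1/s0)^α * ε^α := by
      rw [← Real.mul_rpow (by positivity) hε.le]
      apply Real.one_le_rpow _ hα.le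
      rw [one_div_mul_eq_div, le_div_iff₀ hs0p]; linarith
    have h2 : 0 ≤ (m+1) * K * (1/s0) ^ α * ε ^ α := by positivity
    have h3 : 0 < hi - lo := by linarith
    nlinarith
  set g := K * (ε / ρ 0) ^ α with hg
  have hg0 : 0 ≤ g := by have := hρ0 0; positivity
  have claim : ∀ δ : ℕ, δ ≤ m + 1 → ∀ F ⊆ P, IsChain (· ≤ ·) (F : Set β) → m + 1 ≤ F.card + δ →
      ∀ u v, lo ≤ u → u < v → v ≤ hi →
      (∀ E ∈ P, E ∉ F → (∀ G ∈ F, E ≤ G ∨ G ≤ E) → ∃ x ∈ Set.Icc u v, ρ δ ≤ ψ E x) →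
      (∀ E ∈ F, ∀ x ∈ Set.Icc u v, ψ E x ≤ 1) →
      volume ({x | x ∈ B ∧ ∀ E ∈ F, ε ≤ ψ E x} ∩ Set.Icc u v) ≤
        ENNReal.ofReal (δ * g * (v - u)) := by
    intro δ
    induction δ with
    | zero =>
      intro _ F hF hFc hcard
      have := hchain F hF hFc
      omega
    | succ δ ih =>
      intro hδ F hF hFc hcard
      -- modulus of continuity
      obtain ⟨η, hη, huc⟩ : ∃ η > 0, ∀ E ∈ P, ∀ x ∈ Set.Icc lo hi, ∀ y ∈ Set.Icc lo hi,
          |x - y| ≤ η → |ψ E x - ψ E y| ≤ s0 := by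
        have h1 : ∀ E ∈ P, ∃ η > 0, ∀ x ∈ Set.Icc lo hi, ∀ y ∈ Set.Icc lo hi,
          |x - y| ≤ η → |ψ E x - ψ E y| ≤ s0 := by
          intro E hE
          have := isCompact_Icc.uniformContinuousOn_of_continuous (hcont E hE)
          rw [Metric.uniformContinuousOn_iff] at this
          obtain ⟨η, hη, h⟩ := this s0 hs0p
          refine ⟨η/2, by positivity, fun x hx y hy hxy => ?_⟩
          have := h x hx y hy (by rw [Real.dist_eq]; linarith)
          rw [Real.dist_eq] at this
          exact this.le
        choose! η hη h using h1
        by_cases hP : P.Nonempty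
        · refine ⟨P.inf' hP η, ?_, fun E hE x hx y hy hxy =>
            h E hE x hx y hy (hxy.trans (Finset.inf'_le _ hE))⟩
          rw [gt_iff_lt, Finset.lt_inf'_iff]
          exact hη
        · exact ⟨1, one_pos, fun E hE => (hP ⟨E, hE⟩).elim⟩
      have inner : ∀ N : ℕ, ∀ u v, v - u ≤ 2 ^ N * η → lo ≤ u → u < v → v ≤ hi →
          (∀ E ∈ P, E ∉ F → (∀ G ∈ F, E ≤ G ∨ G ≤ E) → ∃ x ∈ Set.Icc u v, ρ (δ+1) ≤ ψ E x) →
          (∀ E ∈ F, ∀ x ∈ Set.Icc u v, ψ E x ≤ 1) →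
          volume ({x | x ∈ B ∧ ∀ E ∈ F, ε ≤ ψ E x} ∩ Set.Icc u v) ≤
            ENNReal.ofReal ((δ + 1 : ℕ) * g * (v - u)) := by
        intro N
        induction N with
        | zero =>
          intro u v hN hu huv hv hsup hle
          have hsub : Set.Icc u v ⊆ Set.Icc lo hi := Set.Icc_subset_Icc hu hv
          suffices hemp : {x | x ∈ B ∧ ∀ E ∈ F, ε ≤ ψ E x} ∩ Set.Icc u v = ∅ by
            rw [hemp]; simp
          rw [Set.eq_empty_iff_forall_notMem]
          rintro x ⟨⟨hxB, hxF⟩, hx⟩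
          refine hmark x (hsub hx) F hF hFc (fun E hE => ⟨hxF E hE, hle E hE x hx⟩) ?_ hxB
          intro E hE hEF hcomp
          obtain ⟨y, hy, hyρ⟩ := hsup E hE hEF hcomp
          have h1 := huc E hE y (hsub hy) x (hsub hx) (by
            rw [abs_le]; constructor <;> linarith [hy.1, hy.2, hx.1, hx.2])
          have h2 := hρm (δ+1)
          have h3 := (abs_le.1 h1).2
          linarith
        | succ N ihN =>
          intro u v hN hu huv hv hsup hle
          -- treat a half
          have half : ∀ p q, u ≤ p → p < q → q ≤ v → v - u = 2 * (q - p) →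
              volume ({x | x ∈ B ∧ ∀ E ∈ F, ε ≤ ψ E x} ∩ Set.Icc p q) ≤
            ENNReal.ofReal ((δ + 1 : ℕ) * g * (q - p)) := by
            intro p q hp hpq hq hlen
            have hsub : Set.Icc p q ⊆ Set.Icc u v := Set.Icc_subset_Icc hp hq
            by_cases hall : ∀ E ∈ P, E ∉ F → (∀ G ∈ F, E ≤ G ∨ G ≤ E) →
                ∃ x ∈ Set.Icc p q, ρ (δ+1) ≤ ψ E x
            · refine ihN p q ?_ (by linarith) hpq (by linarith) hall
                (fun E hE x hx => hle E hE x (hsub hx))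
              rw [pow_succ] at hN
              linarith
            · push Not at hall
              obtain ⟨E, hE, hEF, hcomp, hElt⟩ := hall
              have hP' : ∀ E' ∈ P, E' ∉ F → (∀ G ∈ F, E' ≤ G ∨ G ≤ E') →
                  ∃ x ∈ Set.Icc p q, ρ δ ≤ ψ E' x := by
                intro E' hE' hE'F hcomp'
                obtain ⟨x, hx, hxx⟩ := hremez lo hi (ψ E') (hML E' hE') (hcont E' hE') u p q v
                  (ρ (δ+1)) hu hp hpq hq hv hlen.le (by
                    obtain ⟨y, hy, hyy⟩ := hsup E' hE' hE'F hcomp'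
                    exact ⟨y, hy, hyy.trans (le_abs_self _)⟩) (hρ0 _)
                refine ⟨x, hx, ?_⟩
                rw [abs_of_nonneg (hpos E' hE' x)] at hxx
                rw [hρs δ (by omega)]; exact hxx
              have hF' : insert E F ⊆ P := Finset.insert_subset hE hF
              have hF'c : IsChain (· ≤ ·) ((insert E F : Finset β) : Set β) := by
                rw [Finset.coe_insert]
                exact hFc.insert fun G hG _ => hcomp G hG
              have h1 := ih (by omega) (insert E F) hF' hF'c (by
                rw [Finset.card_insert_of_notMem hEF]; omega) p q (by linarith) hpq (by linarith)
                (fun E' hE' hE'F hcomp' => hP' E' hE' (fun h => hE'F (Finset.mem_insert_of_mem h))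
                  fun G hG => hcomp' G (Finset.mem_insert_of_mem hG))
                (fun E' hE' x hx => by
                  rcases Finset.mem_insert.1 hE' with rfl | h
                  · exact (hElt x hx).le.trans (hρ1 _)
                  · exact hle E' h x (hsub hx))
              have h2 := hgood lo hi (ψ E) (hML E hE) (hcont E hE) p q (ρ 0) (ε / ρ 0)
                (by linarith) hpq (by linarith) (hρ0 0) (div_pos hε (hρ0 0))
                (by rw [div_le_one (hρ0 0)]; linarith) (by
                  obtain ⟨x, hx, hxx⟩ := hP' E hE hEF hcomp
                  exact ⟨x, hx, ((hρm δ).trans hxx).trans (le_abs_self _)⟩)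
              rw [div_mul_cancel₀ _ (hρ0 0).ne'] at h2
              have h3 : ENNReal.ofReal ((δ + 1 : ℕ) * g * (q - p)) =
                  ENNReal.ofReal (δ * g * (q - p)) + ENNReal.ofReal (g * (q - p)) := by
                have : 0 ≤ q - p := by linarith
                rw [← ENNReal.ofReal_add (by positivity) (by positivity)]
                congr 1; push_cast; ring
              rw [h3]
              refine (measure_mono ?_).trans ((measure_union_le _ _).trans (add_le_add h1 h2))
              rintro x ⟨⟨hxB, hxF⟩, hx⟩
              by_cases hxE : ε ≤ ψ E x
              · left
                refine ⟨⟨hxB, fun G hG => ?_⟩, hx⟩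
                rcases Finset.mem_insert.1 hG with rfl | h
                · exact hxE
                · exact hxF G h
              · right
                refine ⟨hx, ?_⟩
                rw [abs_of_nonneg (hpos E hE x)]
                exact not_le.1 hxE
          have hA := half u ((u+v)/2) le_rfl (by linarith) (by linarith) (by ring)
          have hB := half ((u+v)/2) v (by linarith) (by linarith) le_rfl (by ring)
          have := vol_split _ hA hB (mul_nonneg (by positivity) (by linarith))
            (mul_nonneg (by positivity) (by linarith))
          refine this.trans (le_of_eq ?_)
          congr 1; ring
      intro u v hu huv hv hsup hle
      obtain ⟨N, hN⟩ := pow_unbounded_of_one_lt ((v - u) / η) (one_lt_two (α := ℝ))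
      exact inner N u v ((div_lt_iff₀ hη).1 hN).le hu huv hv hsup hle
  have := claim (m+1) le_rfl ∅ (Finset.empty_subset _) (by simp) (by simp) lo hi le_rfl hlohi le_rfl
    (fun E hE _ _ => by
      obtain ⟨x, hx, hx1⟩ := hLB E hE
      exact ⟨x, hx, (hρ1 _).trans hx1⟩) (by simp)
  simp only [Finset.notMem_empty, IsEmpty.forall_iff, implies_true, and_true, Set.ofPred_mem_eq] at this
  refine this.trans (ENNReal.ofReal_le_ofReal ?_)
  have h3 : 0 < hi - lo := by linarith
  refine mul_le_mul_of_nonneg_right ?_ h3.le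
  rw [hg]
  have h4 : (ε / ρ 0)^α ≤ (1/s0)^α * ε^α := by
    rw [← Real.mul_rpow (by positivity) hε.le]
    apply Real.rpow_le_rpow (div_nonneg hε.le (hρ0 0).le) _ hα.le
    rw [one_div_mul_eq_div]
    have := hρ0 0
    apply div_le_div_of_nonneg_left hε.le hs0p; rw [hs0]; linarith
  have h5 : 0 ≤ (1/s0)^α * ε^α := by positivity
  push_cast
  calc ((m:ℝ)+1) * (K * (ε / ρ 0)^α) ≤ ((m:ℝ)+1) * (K * ((1/s0)^α * ε^α)) := by gcongr
    _ ≤ _ := by nlinarith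

end BB

set_option linter.unusedVariables false
open MeasureTheory ENNReal

namespace BB

/-! ### Part C2 : concrete nondivergence -/

section
variable {ι : Type*} [Fintype ι] [DecidableEq ι]

lemma exists_mnr_ne_zero {k : ℕ} (Y : Matrix (Fin k) ι ℝ) (h : LinearIndependent ℝ Y.row) :
    ∃ c, mnr Y c ≠ 0 := by
  have h1 := h.rank_matrix
  rw [Matrix.rank_eq_finrank_span_cols, Fintype.card_fin] at h1
  obtain ⟨f, hf1, hf2, hf3⟩ := Submodule.exists_fun_fin_finrank_span_eq ℝ (Set.range Y.col)
  choose c hc using hf1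
  have e : Fin k = Fin (Module.finrank ℝ (Submodule.span ℝ (Set.range Y.col))) := by rw [h1]
  refine ⟨fun l => c (Fin.cast h1.symm l), ?_⟩
  unfold mnr
  have h2 : LinearIndependent ℝ (Y.submatrix id (fun l => c (Fin.cast h1.symm l))).col := by
    have := hf3.comp (Fin.cast h1.symm) (Fin.cast_injective _)
    have e2 : (Y.submatrix id (fun l => c (Fin.cast h1.symm l))).col = f ∘ Fin.cast h1.symm := by
      ext l i
      simp only [Function.comp, ← hc]
      rfl
    rw [e2]; exact this
  rw [Matrix.linearIndependent_cols_iff_isUnit, Matrix.isUnit_iff_isUnit_det] at h2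
  exact h2.ne_zero

lemma linInd_of_mnr {k : ℕ} (Y : Matrix (Fin k) ι ℝ) (c : Fin k → ι) (h : mnr Y c ≠ 0) :
    LinearIndependent ℝ Y.row := by
  have h1 := Matrix.linearIndependent_rows_of_det_ne_zero h
  have : (fun l => Y.submatrix id c l) = (LinearMap.funLeft ℝ ℝ c) ∘ Y.row := by
    ext l i; rfl
  rw [this] at h1
  exact LinearIndependent.of_comp _ h1

/-- integer vector as a real vector -/
def toR (a : ι → ℤ) : ι → ℝ := fun i => (a i : ℝ)

lemma exists_min (s : Set (ι → ℤ)) (E : Submodule ℝ (ι → ℝ)) (hE : E = Submodule.span ℝ (toR '' s)) :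
    ∃ A : Matrix (Fin (Module.finrank ℝ E)) ι ℤ, (∀ l, toR (A l) ∈ E) ∧
      (∃ c, mnr A c ≠ 0) ∧
      ∀ A' : Matrix (Fin (Module.finrank ℝ E)) ι ℤ, (∀ l, toR (A' l) ∈ E) → (∃ c, mnr A' c ≠ 0) →
        ∀ M : Matrix ι ι ℝ, Psi (A.map (Int.cast : ℤ → ℝ) * M) ≤ Psi (A'.map (Int.cast : ℤ → ℝ) * M) := by
  set k := Module.finrank ℝ E with hk
  let S : Set (Matrix (Fin k) ι ℤ) := {A | (∀ l, toR (A l) ∈ E) ∧ ∃ c, mnr A c ≠ 0}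
  have hS : S.Nonempty := by
    obtain ⟨f, hf1, hf2, hf3⟩ := Submodule.exists_fun_fin_finrank_span_eq ℝ (toR '' s)
    have h1 : Module.finrank ℝ (Submodule.span ℝ (toR '' s)) = k := by rw [← hE]
    choose g hg1 hg2 using hf1
    refine ⟨Matrix.of fun l => g (Fin.cast h1.symm l), fun l => ?_, ?_⟩
    · rw [hE]; exact Submodule.subset_span ⟨_, hg1 _, rfl⟩
    · have h2 := exists_mnr_ne_zero ((Matrix.of fun l => g (Fin.cast h1.symm l)).map (Int.cast : ℤ → ℝ)) (by
        have := hf3.comp (Fin.cast h1.symm) (Fin.cast_injective _)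
        have e2 : ((Matrix.of fun l => g (Fin.cast h1.symm l)).map (Int.cast : ℤ → ℝ)).row
            = f ∘ Fin.cast h1.symm := by
          ext l i
          simp only [Function.comp, ← hg2]
          rfl
        rw [e2]; exact this)
      obtain ⟨c, hc⟩ := h2
      rw [mnr_intCast] at hc
      exact ⟨c, by exact_mod_cast hc⟩
  let ht : Matrix (Fin k) ι ℤ → ℕ := fun A => Finset.univ.sup fun c => (mnr A c).natAbs
  obtain ⟨A, hA, hmin⟩ := WellFounded.has_min (InvImage.wf ht Nat.lt_wfRel.wf) S hS
  refine ⟨A, hA.1, hA.2, fun A' h1 h2 M => ?_⟩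
  have hm : ht A ≤ ht A' := not_lt.1 (hmin A' ⟨h1, h2⟩)
  obtain ⟨c0, hc0⟩ := hA.2
  have hli := linInd_of_mnr (A.map (Int.cast : ℤ → ℝ)) c0 (by rw [mnr_intCast]; exact_mod_cast hc0)
  have hspan : Submodule.span ℝ (Set.range (A.map (Int.cast : ℤ → ℝ)).row) = E := by
    apply Submodule.eq_of_le_of_finrank_eq
    · rw [Submodule.span_le]
      rintro _ ⟨l, rfl⟩
      exact hA.1 l
    · rw [finrank_span_eq_card hli, Fintype.card_fin]
  have hT : ∀ l, ∃ t : Fin k → ℝ, ∑ l', t l' • (A.map (Int.cast : ℤ → ℝ)).row l' = toR (A' l) := by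
    intro l
    have := h1 l
    rw [← hspan, Submodule.mem_span_range_iff_exists_fun] at this
    exact this
  choose T hT using hT
  have hA' : A'.map (Int.cast : ℤ → ℝ) = Matrix.of T * A.map (Int.cast : ℤ → ℝ) := by
    ext l i
    have := congrFun (hT l) i
    rw [Finset.sum_apply] at this
    simp only [Matrix.map_apply, Matrix.mul_apply, Matrix.of_apply]
    rw [show ((A' l i : ℤ) : ℝ) = toR (A' l) i from rfl, ← this]
    rfl
  have hdet : 1 ≤ |(Matrix.of T).det| := by
    have hpos : 0 < ht A := lt_of_lt_of_le (Int.natAbs_pos.2 hc0)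
      (Finset.le_sup (f := fun c => (mnr A c).natAbs) (Finset.mem_univ c0))
    obtain ⟨c, -, hc⟩ := Finset.exists_mem_eq_sup Finset.univ ⟨c0, Finset.mem_univ _⟩
      (fun c => (mnr A' c).natAbs)
    have e1 : (ht A' : ℝ) = |(Matrix.of T).det| * |((mnr A c : ℤ) : ℝ)| := by
      have : ht A' = (mnr A' c).natAbs := hc
      rw [this, ← abs_mul, ← mnr_intCast A c, ← mnr_mul, ← hA', mnr_intCast, Nat.cast_natAbs, Int.cast_abs]
    have e2 : |((mnr A c : ℤ) : ℝ)| ≤ ht A := by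
      rw [← Int.cast_abs, ← Nat.cast_natAbs]
      exact_mod_cast (Finset.le_sup (f := fun c => (mnr A c).natAbs) (Finset.mem_univ c))
    by_contra hlt
    push Not at hlt
    have e3 : (ht A : ℝ) ≤ ht A' := by exact_mod_cast hm
    have e4 : (0:ℝ) < ht A := by exact_mod_cast hpos
    have := abs_nonneg (Matrix.of T).det
    nlinarith [abs_nonneg ((mnr A c : ℤ) : ℝ)]
  refine Psi_le _ (Psi_nonneg _) fun c => ?_
  have := le_Psi (A'.map (Int.cast : ℤ → ℝ) * M) c
  rw [hA', Matrix.mul_assoc, mnr_mul, abs_mul] at this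
  rw [hA', Matrix.mul_assoc]
  nlinarith [abs_nonneg (mnr (A.map (Int.cast : ℤ → ℝ) * M) c)]

end

end BB

set_option linter.unusedVariables false
open MeasureTheory ENNReal

namespace BB

lemma chain_card_le {m : ℕ} {ι : Type} [Fintype ι] (hm : Fintype.card ι ≤ m)
    (F : Finset (Submodule ℝ (ι → ℝ))) (hb : ∀ E ∈ F, E ≠ ⊥)
    (hF : IsChain (· ≤ ·) (F : Set (Submodule ℝ (ι → ℝ)))) : F.card ≤ m := by
  have h : F.card ≤ (Finset.Icc 1 m).card := by
    refine Finset.card_le_card_of_injOn (fun E => Module.finrank ℝ E) ?_ ?_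
    · intro E hE
      simp only [Finset.coe_Icc, Set.mem_Icc]
      refine ⟨?_, ?_⟩
      · have := (Submodule.one_le_finrank_iff (S := E)).2 (hb E hE)
        exact this
      · have := Submodule.finrank_le E
        rw [Module.finrank_fintype_fun_eq_card] at this
        exact this.trans hm
    · intro E hE E' hE' he
      by_contra hne
      have he' : Module.finrank ℝ E = Module.finrank ℝ E' := he
      rcases hF hE hE' hne with h | h
      · exact absurd (Submodule.finrank_lt_finrank_of_lt (lt_of_le_of_ne h hne)) (by omega)
      · exact absurd (Submodule.finrank_lt_finrank_of_lt (lt_of_le_of_ne h (Ne.symm hne))) (by omega)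
  simpa using h

/-- vectors with short image -/
def badPts {ι : Type} [Fintype ι] (M : ℝ → Matrix ι ι ℝ) (ε : ℝ) (S : Set (ι → ℤ)) : Set ℝ :=
  {x | ∃ a ∈ S, a ≠ 0 ∧ ∀ i, |Matrix.vecMul (toR a) (M x) i| ≤ ε}

lemma nondiv (C : ℝ) (hC : 1 ≤ C) (m : ℕ) : ∃ K α : ℝ, 0 < K ∧ 0 < α ∧
    ∀ {ι : Type} [Fintype ι] [DecidableEq ι], Fintype.card ι ≤ m →
    ∀ (M : ℝ → Matrix ι ι ℝ) (lo hi ε : ℝ), lo < hi → 0 < ε →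
    (∀ k (A : Matrix (Fin k) ι ℤ), ML C lo hi (fun x => Psi (A.map (Int.cast : ℤ → ℝ) * M x)) ∧
      ContinuousOn (fun x => Psi (A.map (Int.cast : ℤ → ℝ) * M x)) (Set.Icc lo hi)) →
    (∀ k, 1 ≤ k → ∀ A : Matrix (Fin k) ι ℤ, (∃ c, mnr A c ≠ 0) →
      ∃ x ∈ Set.Icc lo hi, 1 ≤ Psi (A.map (Int.cast : ℤ → ℝ) * M x)) →
    volume (badPts M ε Set.univ ∩ Set.Icc lo hi) ≤ ENNReal.ofReal (K * ε ^ α * (hi - lo)) := by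
  obtain ⟨K, α, hK, hα, habs⟩ := nondiv_abs C hC m
  refine ⟨(K + 1) * (m + 2 : ℝ) ^ α, α, by positivity, hα, ?_⟩
  intro ι _ _ hcard M lo hi ε hlohi hε hML hLB
  have hlen : 0 < hi - lo := by linarith
  rcases lt_or_ge 1 ((m + 2 : ℝ) * ε) with hbig | hsmall
  · refine (measure_mono Set.inter_subset_right).trans ?_
    rw [Real.volume_Icc]
    apply ENNReal.ofReal_le_ofReal
    have h1 : 1 ≤ (m + 2 : ℝ) ^ α * ε ^ α := by
      rw [← Real.mul_rpow (by positivity) hε.le]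
      exact Real.one_le_rpow hbig.le hα.le
    have h2 : 1 ≤ (K + 1) * ((m + 2 : ℝ) ^ α * ε ^ α) := by nlinarith
    rw [mul_assoc (K+1)]
    nlinarith
  -- main case
  have key : ∀ Q : ℕ, volume (badPts M ε (Fintype.piFinset fun _ : ι => Finset.Icc (-(Q:ℤ)) Q)
      ∩ Set.Icc lo hi) ≤ ENNReal.ofReal (K * ((m + 2 : ℝ) * ε) ^ α * (hi - lo)) := by
    intro Q
    classical
    set box : Finset (ι → ℤ) := Fintype.piFinset fun _ : ι => Finset.Icc (-(Q:ℤ)) Q with hbox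
    set P : Finset (Submodule ℝ (ι → ℝ)) :=
      ((box.powerset).image (fun s : Finset (ι → ℤ) => Submodule.span ℝ (toR '' (s : Set (ι → ℤ))))).filter (· ≠ ⊥) with hP
    have hex : ∀ E : Submodule ℝ (ι → ℝ), ∃ A : Matrix (Fin (Module.finrank ℝ E)) ι ℤ,
        (∃ s : Finset (ι → ℤ), E = Submodule.span ℝ (toR '' (s : Set (ι → ℤ)))) →
        (∀ l, toR (A l) ∈ E) ∧ (∃ c, mnr A c ≠ 0) ∧
        ∀ A' : Matrix (Fin (Module.finrank ℝ E)) ι ℤ, (∀ l, toR (A' l) ∈ E) → (∃ c, mnr A' c ≠ 0) →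
        ∀ M : Matrix ι ι ℝ, Psi (A.map (Int.cast : ℤ → ℝ) * M) ≤ Psi (A'.map (Int.cast : ℤ → ℝ) * M) := by
      intro E
      by_cases h : ∃ s : Finset (ι → ℤ), E = Submodule.span ℝ (toR '' (s : Set (ι → ℤ)))
      · obtain ⟨s, hs⟩ := h
        obtain ⟨A, hA⟩ := exists_min (s : Set (ι → ℤ)) E hs
        exact ⟨A, fun _ => hA⟩
      · exact ⟨0, fun h' => absurd h' h⟩
    choose A hA using hex
    have hmemP : ∀ E ∈ P, (∃ s ⊆ box, E = Submodule.span ℝ (toR '' (s : Set (ι → ℤ)))) ∧ E ≠ ⊥ := by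
      intro E hE
      simp only [hP, Finset.mem_filter, Finset.mem_image, Finset.mem_powerset] at hE
      obtain ⟨⟨s, hs, rfl⟩, h2⟩ := hE
      exact ⟨⟨s, hs, rfl⟩, h2⟩
    refine habs P (fun E x => Psi ((A E).map (Int.cast : ℤ → ℝ) * M x)) lo hi _ ((m+2:ℝ) * ε) hlohi
      (by positivity) hsmall (fun E _ => (hML _ _).1) (fun E _ => (hML _ _).2)
      (fun E _ x => Psi_nonneg _) ?_ ?_ ?_
    · exact fun F hF hFc => chain_card_le hcard F (fun E hE => (hmemP E (hF hE)).2) hFc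
    · intro E hE
      obtain ⟨⟨s, -, hs⟩, hne⟩ := hmemP E hE
      exact hLB _ (Submodule.one_le_finrank_iff.2 hne) _ (hA E ⟨s, hs⟩).2.1
    · rintro x hx F hFP hFc hF1 hF2 ⟨a, haS, ha0, ha⟩
      have haS : a ∈ box := haS
      -- largest member of the chain not containing a
      have hane : toR a ≠ 0 := by
        intro h; apply ha0; ext i
        have := congrFun h i
        simpa [toR] using this
      obtain ⟨E0, hE0, hmax⟩ := Finset.exists_maximal (s := (insert ⊥ F).filter (fun E => toR a ∉ E))
        ⟨⊥, by simp [hane]⟩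
      rw [Finset.mem_filter] at hE0
      have hmax' : ∀ G ∈ F, toR a ∉ G → G ≤ E0 := by
        intro G hG haG
        have hGm : G ∈ (insert ⊥ F).filter (fun E => toR a ∉ E) := by simp [hG, haG]
        rcases Finset.mem_insert.1 hE0.1 with h | h
        · exact hmax hGm (h ▸ bot_le)
        · rcases eq_or_ne G E0 with e | e
          · exact e.le
          rcases hFc hG h e with h' | h'
          · exact h'
          · exact hmax hGm h'
      have hup : ∀ G ∈ F, toR a ∈ G → E0 ≤ G := by
        intro G hG haG
        rcases Finset.mem_insert.1 hE0.1 with h | h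
        · rw [h]; exact bot_le
        · rcases eq_or_ne G E0 with e | e
          · exact e.ge
          rcases hFc hG h e with h' | h'
          · exact absurd (h' haG) hE0.2
          · exact h'
      obtain ⟨s0, hs0b, hs0⟩ : ∃ s ⊆ box, E0 = Submodule.span ℝ (toR '' (s : Set (ι → ℤ))) := by
        rcases Finset.mem_insert.1 hE0.1 with h | h
        · exact ⟨∅, by simp, by simp [h]⟩
        · exact (hmemP E0 (hFP h)).1
      have hpsi0 : Psi ((A E0).map (Int.cast : ℤ → ℝ) * M x) ≤ 1 := by
        rcases Finset.mem_insert.1 hE0.1 with h | h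
        · refine Psi_le _ zero_le_one fun c => ?_
          have hz : Module.finrank ℝ E0 = 0 := by rw [h]; simp
          have : IsEmpty (Fin (Module.finrank ℝ E0)) := by rw [hz]; infer_instance
          unfold mnr
          rw [Matrix.det_isEmpty]; simp
        · exact (hF1 E0 h).2
      set E := Submodule.span ℝ (toR '' ((insert a s0 : Finset (ι → ℤ)) : Set (ι → ℤ))) with hE
      have hEeq : E = Submodule.span ℝ {toR a} ⊔ E0 := by
        rw [hE, hs0, Finset.coe_insert, Set.image_insert_eq, Submodule.span_insert]
      have haE : toR a ∈ E := by
        rw [hEeq]; exact Submodule.mem_sup_left (Submodule.mem_span_singleton_self _)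
      have hE0E : E0 ≤ E := by rw [hEeq]; exact le_sup_right
      have hEP : E ∈ P := by
        simp only [hP, Finset.mem_filter, Finset.mem_image, Finset.mem_powerset]
        refine ⟨⟨insert a s0, Finset.insert_subset haS hs0b, rfl⟩, ?_⟩
        intro hbot
        rw [hbot] at haE
        exact hane (by simpa using haE)
      have hcomp : ∀ G ∈ F, E ≤ G ∨ G ≤ E := by
        intro G hG
        by_cases haG : toR a ∈ G
        · left
          rw [hEeq]
          exact sup_le (by simpa [Submodule.span_le] using haG) (hup G hG haG)
        · right; exact (hmax' G hG haG).trans hE0E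
      have hlow : (m+2:ℝ) * ε ≤ Psi ((A E).map (Int.cast : ℤ → ℝ) * M x) := by
        by_cases hEF : E ∈ F
        · exact (hF1 E hEF).1
        · exact hF2 E hEP hEF hcomp
      -- the upper bound
      obtain ⟨hA01, ⟨c0, hc0⟩, -⟩ := hA E0 ⟨s0, hs0⟩
      have hA0li := linInd_of_mnr ((A E0).map (Int.cast : ℤ → ℝ)) c0
        (by rw [mnr_intCast]; exact_mod_cast hc0)
      let A' : Matrix (Fin (Module.finrank ℝ E0 + 1)) ι ℤ := Matrix.of (Fin.cons a (A E0))
      have hA'row : (A'.map (Int.cast : ℤ → ℝ)) =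
          Matrix.of (Fin.cons (toR a) ((A E0).map (Int.cast : ℤ → ℝ)) : Fin (Module.finrank ℝ E0 + 1) → ι → ℝ) := by
        ext l i
        refine Fin.cases ?_ (fun l => ?_) l
        · rfl
        · rfl
      have hspan0 : Submodule.span ℝ (Set.range ((A E0).map (Int.cast : ℤ → ℝ)).row) = E0 := by
        apply Submodule.eq_of_le_of_finrank_eq
        · rw [Submodule.span_le]
          rintro _ ⟨l, rfl⟩
          exact hA01 l
        · rw [finrank_span_eq_card hA0li, Fintype.card_fin]
      have hA'li : LinearIndependent ℝ (A'.map (Int.cast : ℤ → ℝ)).row := by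
        rw [hA'row]
        have : (Matrix.of (Fin.cons (toR a) ((A E0).map (Int.cast : ℤ → ℝ)) :
          Fin (Module.finrank ℝ E0 + 1) → ι → ℝ)).row = Fin.cons (toR a) ((A E0).map (Int.cast : ℤ → ℝ)).row := rfl
        rw [this, linearIndependent_finCons]
        exact ⟨hA0li, by rw [hspan0]; exact hE0.2⟩
      have hA'E : ∀ l, toR (A' l) ∈ E := by
        intro l
        refine Fin.cases ?_ (fun l => ?_) l
        · exact haE
        · exact hE0E (hA01 l)
      have hfr : Module.finrank ℝ E = Module.finrank ℝ E0 + 1 := by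
        have : Submodule.span ℝ (Set.range (A'.map (Int.cast : ℤ → ℝ)).row) = E := by
          apply le_antisymm
          · rw [Submodule.span_le]
            rintro _ ⟨l, rfl⟩
            exact hA'E l
          · rw [hEeq]
            refine sup_le ?_ ?_
            · rw [Submodule.span_singleton_le_iff_mem]
              exact Submodule.subset_span ⟨0, rfl⟩
            · refine hspan0.ge.trans ?_
              apply Submodule.span_mono
              rintro _ ⟨l, rfl⟩
              exact ⟨l.succ, rfl⟩
        rw [← this, finrank_span_eq_card hA'li, Fintype.card_fin]
      obtain ⟨-, -, hAmin⟩ := hA E ⟨_, hE⟩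
      obtain ⟨c', hc'⟩ := exists_mnr_ne_zero _ hA'li
      rw [mnr_intCast] at hc'
      have hle : Psi ((A E).map (Int.cast : ℤ → ℝ) * M x) ≤ Psi (A'.map (Int.cast : ℤ → ℝ) * M x) := by
        have gen : ∀ (k : ℕ) (hk : Module.finrank ℝ E = k) (A' : Matrix (Fin k) ι ℤ),
            (∀ l, toR (A' l) ∈ E) → (∃ c, mnr A' c ≠ 0) →
            Psi ((A E).map (Int.cast : ℤ → ℝ) * M x) ≤ Psi (A'.map (Int.cast : ℤ → ℝ) * M x) := by
          intro k hk; subst hk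
          exact fun A' h1 h2 => hAmin A' h1 h2 _
        exact gen _ hfr A' hA'E ⟨c', by exact_mod_cast hc'⟩
      have hfrm : Module.finrank ℝ E0 ≤ m := by
        have := Submodule.finrank_le E0
        rw [Module.finrank_fintype_fun_eq_card] at this
        exact this.trans hcard
      have hle2 : Psi (A'.map (Int.cast : ℤ → ℝ) * M x) ≤ (m + 1) * ε := by
        refine Psi_le _ (by positivity) fun c => ?_
        have e : A'.map (Int.cast : ℤ → ℝ) * M x = Matrix.of (Fin.cons (Matrix.vecMul (toR a) (M x))
            ((A E0).map (Int.cast : ℤ → ℝ) * M x) : Fin (Module.finrank ℝ E0 + 1) → ι → ℝ) := by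
          rw [hA'row]
          ext l i
          refine Fin.cases ?_ (fun l => ?_) l
          · rfl
          · rfl
        rw [e]
        refine (mnr_cons_le _ _ c ha (S := 1) (fun c' => (le_Psi _ c').trans hpsi0)).trans ?_
        have : (Module.finrank ℝ E0 : ℝ) ≤ m := by exact_mod_cast hfrm
        nlinarith
      nlinarith
  have hun : badPts M ε Set.univ ∩ Set.Icc lo hi = ⋃ Q : ℕ,
      (badPts M ε (Fintype.piFinset fun _ : ι => Finset.Icc (-(Q:ℤ)) Q) ∩ Set.Icc lo hi) := by
    ext x
    simp only [Set.mem_inter_iff, Set.mem_iUnion]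
    constructor
    · rintro ⟨⟨a, -, h1, h2⟩, hx⟩
      refine ⟨Finset.univ.sup fun i => (a i).natAbs, ⟨a, ?_, h1, h2⟩, hx⟩
      simp only [Finset.mem_coe, Fintype.mem_piFinset, Finset.mem_Icc]
      intro i
      have := Finset.le_sup (f := fun i => (a i).natAbs) (Finset.mem_univ i)
      omega
    · rintro ⟨Q, ⟨a, -, h1, h2⟩, hx⟩
      exact ⟨⟨a, trivial, h1, h2⟩, hx⟩
  rw [hun, Monotone.measure_iUnion]
  · refine iSup_le fun Q => (key Q).trans (ENNReal.ofReal_le_ofReal ?_)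
    rw [Real.mul_rpow (by positivity) hε.le]
    have : 0 ≤ (m + 2 : ℝ) ^ α * ε ^ α * (hi - lo) := by positivity
    nlinarith
  · intro Q Q' hQ x
    rintro ⟨⟨a, h0, h1, h2⟩, hx⟩
    refine ⟨⟨a, ?_, h1, h2⟩, hx⟩
    simp only [Finset.mem_coe, Fintype.mem_piFinset, Finset.mem_Icc] at h0 ⊢
    intro i
    have := h0 i
    omega

end BB

set_option linter.unusedVariables false
set_option linter.unusedSectionVars false
open MeasureTheory ENNReal

namespace BB

/-! ### Part D : the dynamical setup -/

/-- the full data attached to a map and a weight -/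
structure Sys {ι : Type} [Fintype ι] [DecidableEq ι] (o j : ι) (r : ι → ℝ) (ϖ C B lo hi : ℝ)
    (φ φ1 φ2 : ι → ℝ → ℝ) : Prop where
  fs : FS o C lo hi φ φ1 φ2
  oj : o ≠ j
  rsum : ∑ i, (if i = o then 0 else r i) = 1
  rge : ∀ i, i ≠ o → ϖ ≤ r i
  rle : ∀ i, i ≠ o → r i ≤ r j
  wpos : 0 < ϖ
  hB : 1 ≤ B
  lohi : lo < hi
  len : hi - lo ≤ 1
  lenB : 1 ≤ B * (hi - lo)
  b1 : ∀ i, ∀ x ∈ Set.Icc lo hi, |φ1 i x| ≤ B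
  b2 : ∀ i, ∀ x ∈ Set.Icc lo hi, |φ2 i x| ≤ B
  low : ∀ x ∈ Set.Icc lo hi, 1 ≤ B * |φ1 j x|
  N : ∀ (b : ι → ℝ) S, (∀ x ∈ Set.Icc lo hi, |lin b φ x| ≤ S) → ∀ i, |b i| ≤ B * S

section
variable {ι : Type} [Fintype ι] [DecidableEq ι]

/-- exponents -/
noncomputable def ex (o j : ι) (r : ι → ℝ) (t τ : ℝ) (i : ι) : ℝ :=
  if i = o then t + τ else if i = j then τ - r j * t else - (r i * (t + τ))

/-- weights -/
noncomputable def wt (o j : ι) (r : ι → ℝ) (t τ : ℝ) (i : ι) : ℝ := Real.exp (ex o j r t τ i)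

/-- weights away from o, j -/
noncomputable def rr (o j : ι) (r : ι → ℝ) (i : ι) : ℝ := if i = o ∨ i = j then 0 else r i

/-- sum of weights away from o, j -/
noncomputable def rI (o j : ι) (r : ι → ℝ) (S : Finset ι) : ℝ := ∑ i ∈ S, rr o j r i

/-- total exponent -/
noncomputable def gS (o j : ι) (r : ι → ℝ) (t τ : ℝ) (S : Finset ι) : ℝ :=
  (if o ∈ S then t + τ else 0) + (if j ∈ S then τ - r j * t else 0) - rI o j r S * (t + τ)

lemma prod_wt {o j : ι} (hoj : o ≠ j) (r : ι → ℝ) (t τ : ℝ) {k : ℕ} (c : Fin k → ι)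
    (hc : Function.Injective c) :
    ∏ l, wt o j r t τ (c l) = Real.exp (gS o j r t τ (Finset.univ.image c)) := by
  unfold wt
  rw [← Real.exp_sum]
  congr 1
  rw [← Finset.sum_image (f := ex o j r t τ) (fun x _ y _ h => hc h)]
  have : ∀ i, ex o j r t τ i = (if i = o then t + τ else 0) + (if i = j then τ - r j * t else 0)
      - rr o j r i * (t + τ) := by
    intro i
    unfold ex rr
    by_cases h1 : i = o
    · subst h1; simp [hoj]
    · by_cases h2 : i = j
      · subst h2; simp [h1]
      · simp [h1, h2]
  simp only [this, Finset.sum_sub_distrib, Finset.sum_add_distrib, Finset.sum_ite_eq', gS, rI,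
    Finset.sum_mul]

variable {o j : ι} {r : ι → ℝ} {ϖ C B lo hi : ℝ} {φ φ1 φ2 : ι → ℝ → ℝ}

namespace Sys

lemma rr_nonneg (h : Sys o j r ϖ C B lo hi φ φ1 φ2) (i : ι) : 0 ≤ rr o j r i := by
  unfold rr
  split_ifs with h1
  · exact le_rfl
  · push Not at h1; exact h.wpos.le.trans (h.rge i h1.1)

lemma rI_nonneg (h : Sys o j r ϖ C B lo hi φ φ1 φ2) (S : Finset ι) : 0 ≤ rI o j r S := Finset.sum_nonneg fun i _ => h.rr_nonneg i

lemma rI_univ (h : Sys o j r ϖ C B lo hi φ φ1 φ2) : rI o j r Finset.univ = 1 - r j := by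
  have h1 := h.rsum
  have : ∀ i, (if i = o then 0 else r i) = rr o j r i + (if i = j then r j else 0) := by
    intro i
    unfold rr
    by_cases h1 : i = o
    · subst h1; simp [h.oj]
    · by_cases h2 : i = j
      · subst h2; simp [h1]
      · simp [h1, h2]
  simp only [this, Finset.sum_add_distrib, Finset.sum_ite_eq', Finset.mem_univ, if_true] at h1
  unfold rI; linarith

lemma rI_le (h : Sys o j r ϖ C B lo hi φ φ1 φ2) (S : Finset ι) : rI o j r S ≤ 1 - r j := by
  rw [← h.rI_univ]
  exact Finset.sum_le_sum_of_subset_of_nonneg (Finset.subset_univ _) fun i _ _ => h.rr_nonneg i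

lemma rI_le' (h : Sys o j r ϖ C B lo hi φ φ1 φ2) (S : Finset ι) {i : ι} (hi : i ∉ S) (h1 : i ≠ o) (h2 : i ≠ j) :
    rI o j r S ≤ 1 - r j - ϖ := by
  have h3 := h.rI_le (insert i S)
  rw [rI, Finset.sum_insert hi] at h3
  have : rr o j r i = r i := by simp [rr, h1, h2]
  have := h.rge i h1
  unfold rI
  linarith

lemma rj (h : Sys o j r ϖ C B lo hi φ φ1 φ2) : ϖ ≤ r j := h.rge j h.oj.symm

lemma rj1 (h : Sys o j r ϖ C B lo hi φ φ1 φ2) : r j ≤ 1 := by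
  have := h.rI_le ∅
  simp [rI] at this
  linarith

lemma mnr_wt (h : Sys o j r ϖ C B lo hi φ φ1 φ2) (t τ : ℝ) {k : ℕ} (A : Matrix (Fin k) ι ℝ) (x : ℝ) (c : Fin k → ι)
    (hc : Function.Injective c) :
    mnr (A * Mx o j (wt o j r t τ) φ φ1 x) c =
      Real.exp (gS o j r t τ (Finset.univ.image c)) * mnr (A * Mx o j 1 φ φ1 x) c := by
  rw [mnr_mul_Mx, prod_wt h.oj r t τ c hc]

end Sys

lemma inj_of_mnr {k : ℕ} {A : Matrix (Fin k) ι ℝ} {c : Fin k → ι} (hc : mnr A c ≠ 0) :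
    Function.Injective c := by
  intro l l' he
  by_contra hne
  exact hc (mnr_eq_zero_of_eq _ c hne he)

lemma mem_im {k : ℕ} {c : Fin k → ι} {i : ι} : i ∈ Finset.univ.image c ↔ ∃ l, c l = i := by
  simp

namespace Sys

/-- if all non-zero minors contain both `o` and `j` -/
lemma LB_both (h : Sys o j r ϖ C B lo hi φ φ1 φ2) {t τ : ℝ} (ht : 0 ≤ t) (hτ : 0 ≤ τ) {k : ℕ} (A : Matrix (Fin k) ι ℝ)
    (c : Fin k → ι) (hc : 1 ≤ |mnr A c|)
    (hall : ∀ c, mnr A c ≠ 0 → (∃ l, c l = o) ∧ ∃ l, c l = j) (x : ℝ) (hx : x ∈ Set.Icc lo hi) :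
    Real.exp (ϖ * τ) ≤ B * Psi (A * Mx o j (wt o j r t τ) φ φ1 x) := by
  have hB := h.hB
  have hc0 : mnr A c ≠ 0 := by intro e; rw [e] at hc; norm_num at hc
  have hinj := inj_of_mnr hc0
  obtain ⟨⟨l, hl⟩, l', hl'⟩ := hall c hc0
  have hll : l ≠ l' := by rintro rfl; exact h.oj (hl.symm.trans hl')
  have h1 : mnr (A * Mx o j 1 φ φ1 x) c = mnr A c * φ1 j x := by
    rw [mnr_oj A o j φ φ1 x c h.oj l l' hl hl' (fun b hb hb' =>
      ⟨fun e => hb (hinj (e.trans hl.symm)), fun e => hb' (hinj (e.trans hl'.symm))⟩)]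
    have hz : ∀ i i', (¬ (i = o ∧ i' = j)) →
        mnr A (Function.update (Function.update c l i) l' i') * (φ i x * φ1 i' x) = 0 := by
      intro i i' hii
      by_cases hm : mnr A (Function.update (Function.update c l i) l' i') = 0
      · rw [hm, zero_mul]
      obtain ⟨⟨p, hp⟩, p', hp'⟩ := hall _ hm
      have hcases : ∀ q z, Function.update (Function.update c l i) l' i' q = z → 
          (q = l' ∧ i' = z) ∨ (q = l ∧ i = z) ∨ (q ≠ l ∧ q ≠ l' ∧ c q = z) := by
        intro q z hq
        by_cases e1 : q = l'
        · subst e1; simp at hq; exact Or.inl ⟨rfl, hq⟩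
        · by_cases e2 : q = l
          · subst e2; simp [e1] at hq; exact Or.inr (Or.inl ⟨rfl, hq⟩)
          · simp [e1, e2] at hq; exact Or.inr (Or.inr ⟨e2, e1, hq⟩)
      rcases hcases p o hp with ⟨_, e⟩ | ⟨_, e⟩ | ⟨e1, e2, e⟩
      · rw [e, h.fs.one1]; ring
      · rcases hcases p' j hp' with ⟨_, e'⟩ | ⟨_, e'⟩ | ⟨e1, e2, e'⟩
        · exact absurd ⟨e, e'⟩ hii
        · exact absurd (e.symm.trans e') h.oj
        · exact absurd (hinj (e'.trans hl'.symm)) e2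
      · exact absurd (hinj (e.trans hl.symm)) e1
    rw [Finset.sum_eq_single o, Finset.sum_eq_single j]
    · rw [h.fs.one, one_mul]
      congr 2
      rw [show Function.update c l o = c by rw [← hl]; exact Function.update_eq_self _ _, ← hl']
      exact Function.update_eq_self _ _
    · intro i' _ hi'; exact hz _ _ (fun e => hi' e.2)
    · simp
    · intro i _ hi'; exact Finset.sum_eq_zero fun i' _ => hz _ _ (fun e => hi' e.1)
    · simp
  have h2 := le_Psi (A * Mx o j (wt o j r t τ) φ φ1 x) c
  rw [h.mnr_wt t τ A x c hinj, h1, abs_mul, abs_mul, Real.abs_exp] at h2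
  have h3 : ϖ * τ ≤ gS o j r t τ (Finset.univ.image c) := by
    unfold gS
    rw [if_pos (mem_im.2 ⟨l, hl⟩), if_pos (mem_im.2 ⟨l', hl'⟩)]
    have := h.rI_le (Finset.univ.image c)
    have := h.rj
    nlinarith [mul_nonneg hτ h.wpos.le]
  have h4 := h.low x hx
  have h5 : 1 ≤ |mnr A c| * (B * |φ1 j x|) := by nlinarith
  calc Real.exp (ϖ * τ) ≤ Real.exp (gS o j r t τ (Finset.univ.image c)) := Real.exp_le_exp.2 h3
    _ ≤ Real.exp (gS o j r t τ (Finset.univ.image c)) * (|mnr A c| * (B * |φ1 j x|)) :=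
        le_mul_of_one_le_right (Real.exp_pos _).le h5
    _ = B * (Real.exp (gS o j r t τ (Finset.univ.image c)) * (|mnr A c| * |φ1 j x|)) := by ring
    _ ≤ _ := by gcongr

/-- global lower bound -/
lemma LB_global (h : Sys o j r ϖ C B lo hi φ φ1 φ2) {t τ : ℝ} (ht : 0 ≤ t) (hτ : 0 ≤ τ) {k : ℕ} (hk : 1 ≤ k) (A : Matrix (Fin k) ι ℝ)
    (hA : ∀ c, mnr A c ≠ 0 → 1 ≤ |mnr A c|) (c : Fin k → ι) (hc : mnr A c ≠ 0) :
    ∃ x ∈ Set.Icc lo hi, Real.exp (ϖ * τ) ≤ 2 * B * Psi (A * Mx o j (wt o j r t τ) φ φ1 x) := by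
  have hB := h.hB
  by_cases hall : ∀ c, mnr A c ≠ 0 → (∃ l, c l = o) ∧ ∃ l, c l = j
  · refine ⟨lo, ⟨le_rfl, h.lohi.le⟩, ?_⟩
    have := h.LB_both ht hτ A c (hA c hc) hall lo ⟨le_rfl, h.lohi.le⟩
    have := Psi_nonneg (A * Mx o j (wt o j r t τ) φ φ1 lo)
    nlinarith
  push Not at hall
  obtain ⟨c, hc, hoj⟩ := hall
  have hinj := inj_of_mnr hc
  obtain ⟨l, hl⟩ : ∃ l : Fin k, ∀ l', l' ≠ l → c l' ≠ o ∧ c l' ≠ j := by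
    rcases cols_cases o j c hinj with h1 | ⟨l, hl, h1⟩ | ⟨l, hl, h1⟩ | ⟨l, l', hl, hl', h1⟩
    · exact ⟨⟨0, hk⟩, fun l' _ => h1 l'⟩
    · exact ⟨l, h1⟩
    · exact ⟨l, h1⟩
    · exact absurd hl' (hoj ⟨l, hl⟩ l')
  set c' := Function.update c l o with hc'
  have hc'l : c' l = o := by simp [hc']
  have hc'2 : ∀ l', l' ≠ l → c' l' = c l' := fun l' hl' => by simp [hc', hl']
  have hc'3 : ∀ l', l' ≠ l → c' l' ≠ o ∧ c' l' ≠ j := fun l' hl' => by rw [hc'2 l' hl']; exact hl l' hl'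
  have hinj' : Function.Injective c' := by
    intro a b hab
    by_cases ha : a = l
    · by_cases hb : b = l
      · rw [ha, hb]
      · rw [ha, hc'l] at hab; exact absurd hab.symm (hc'3 b hb).1
    · by_cases hb : b = l
      · rw [hb, hc'l] at hab; exact absurd hab (hc'3 a ha).1
      · rw [hc'2 a ha, hc'2 b hb] at hab; exact hinj hab
  have hx : ∃ x ∈ Set.Icc lo hi, 1 ≤ 2 * B * |mnr (A * Mx o j 1 φ φ1 x) c'| := by
    by_contra hcon
    push Not at hcon
    have hN := h.N (fun i => mnr A (Function.update c' l i)) (1 / (2 * B)) (fun x hx => by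
      rw [← mnr_o A o j φ φ1 x c' l hc'l hc'3]
      rw [le_div_iff₀ (by positivity)]
      linarith [hcon x hx]) (c l)
    have e : Function.update c' l (c l) = c := by rw [hc']; simp
    simp only [e] at hN
    have := hA c hc
    have e2 : B * (1 / (2 * B)) = 1/2 := by field_simp
    rw [e2] at hN
    linarith
  obtain ⟨x, hx, hx1⟩ := hx
  refine ⟨x, hx, ?_⟩
  have h2 := le_Psi (A * Mx o j (wt o j r t τ) φ φ1 x) c'
  rw [h.mnr_wt t τ A x c' hinj', abs_mul, Real.abs_exp] at h2
  have h3 : ϖ * τ ≤ gS o j r t τ (Finset.univ.image c') := by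
    unfold gS
    have hj : j ∉ Finset.univ.image c' := by
      rw [mem_im]; rintro ⟨b, hb⟩
      by_cases e : b = l
      · rw [e, hc'l] at hb; exact h.oj hb
      · exact (hc'3 b e).2 hb
    rw [if_pos (mem_im.2 ⟨l, hc'l⟩), if_neg hj]
    have := h.rI_le (Finset.univ.image c')
    have := h.rj
    nlinarith [mul_nonneg hτ h.wpos.le, mul_nonneg ht h.wpos.le]
  calc Real.exp (ϖ * τ) ≤ Real.exp (gS o j r t τ (Finset.univ.image c')) := Real.exp_le_exp.2 h3
    _ ≤ Real.exp (gS o j r t τ (Finset.univ.image c')) * (2 * B * |mnr (A * Mx o j 1 φ φ1 x) c'|) :=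
        le_mul_of_one_le_right (Real.exp_pos _).le hx1
    _ = 2 * B * (Real.exp (gS o j r t τ (Finset.univ.image c')) * |mnr (A * Mx o j 1 φ φ1 x) c'|) := by ring
    _ ≤ _ := by gcongr

end Sys
end

end BB

set_option linter.unusedVariables false
set_option linter.unusedSectionVars false
open MeasureTheory ENNReal

namespace BB

section
variable {ι : Type} [Fintype ι] [DecidableEq ι]
variable {o j : ι} {r : ι → ℝ} {ϖ C B lo hi : ℝ} {φ φ1 φ2 : ι → ℝ → ℝ}

lemma rI_image (o j : ι) (r : ι → ℝ) {k : ℕ} (c : Fin k → ι) (hc : Function.Injective c) :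
    rI o j r (Finset.univ.image c) = ∑ l, rr o j r (c l) := by
  unfold rI
  rw [Finset.sum_image (fun x _ y _ h => hc h)]

lemma inj_update {k : ℕ} {c : Fin k → ι} (hc : Function.Injective c) (l : Fin k) {i : ι}
    (hi : ∀ l', c l' ≠ i) : Function.Injective (Function.update c l i) := by
  intro a b hab
  by_cases ha : a = l
  · by_cases hb : b = l
    · rw [ha, hb]
    · subst ha; simp [hb] at hab; exact absurd hab.symm (hi b)
  · by_cases hb : b = l
    · subst hb; simp [ha] at hab; exact absurd hab (hi a)
    · simp [ha, hb] at hab; exact hc hab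

lemma gS_T (o j : ι) (r : ι → ℝ) (t1 τ : ℝ) (S : Finset ι) :
    gS o j r t1 (2*τ) S = gS o j r (t1+τ) τ S + (if j ∈ S then (1 + r j) * τ else 0) := by
  unfold gS
  split_ifs <;> ring

lemma gS_ζ (o j : ι) (r : ι → ℝ) (t1 T ζ : ℝ) (S : Finset ι) :
    gS o j r t1 (T - ζ) S = gS o j r t1 T S - (if o ∈ S then ζ else 0) - (if j ∈ S then ζ else 0)
      + rI o j r S * ζ := by
  unfold gS
  split_ifs <;> ring

namespace Sys

lemma loc (h : Sys o j r ϖ C B lo hi φ φ1 φ2) {k : ℕ} (hk : 1 ≤ k) (hkm : k < Fintype.card ι)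
    (A : Matrix (Fin k) ι ℝ) {t1 τ u lo' hi' : ℝ} (ht1 : 0 ≤ t1) (hτ : 0 ≤ τ) (hu : 0 < u)
    (hlo : lo ≤ lo') (hhi : hi' ≤ hi) (hlen : hi' - lo' = (hi - lo) * Real.exp (-((1 + r j) * t1)))
    (hb : ∀ x ∈ Set.Icc lo' hi', ∀ c, |mnr (A * Mx o j (wt o j r (t1+τ) τ) φ φ1 x) c| ≤ u) :
    ∃ ζ, 0 ≤ ζ ∧ ζ ≤ τ ∧ ∀ c, |mnr (A * Mx o j (wt o j r t1 (2*τ-ζ)) φ φ1 lo') c| ≤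
      k * (C * B * u) * Real.exp (-(ϖ/2*ζ)) := by
  have hB := h.hB
  have hC := h.fs.hC
  have hoj := h.oj
  have hγ := h.rj
  have hw := h.wpos
  have hlen0 : 0 < hi' - lo' := by rw [hlen]; exact mul_pos (by linarith [h.lohi]) (Real.exp_pos _)
  have hlo' : lo' ∈ Set.Icc lo' hi' := ⟨le_rfl, by linarith⟩
  set D := C * B * u with hD
  have hCB : 1 ≤ C * B := by nlinarith
  have hDu : u ≤ D := by rw [hD]; nlinarith
  have hD0 : 0 < D := by linarith
  have hk1 : (1:ℝ) ≤ k := by exact_mod_cast hk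
  set Y := A * Mx o j (wt o j r t1 (2*τ)) φ φ1 lo' with hY
  have hYc : ∀ c, Function.Injective c → |mnr Y c| =
      Real.exp (gS o j r t1 (2*τ) (Finset.univ.image c)) * |mnr (A * Mx o j 1 φ φ1 lo') c| := by
    intro c hc
    rw [hY, h.mnr_wt _ _ A _ c hc, abs_mul, Real.abs_exp]
  have hY0 : ∀ c, Function.Injective c → |mnr Y c| =
      Real.exp (if j ∈ Finset.univ.image c then (1 + r j) * τ else 0) *
        |mnr (A * Mx o j (wt o j r (t1+τ) τ) φ φ1 lo') c| := by
    intro c hc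
    rw [hYc c hc, h.mnr_wt _ _ A _ c hc, abs_mul, Real.abs_exp, gS_T, Real.exp_add]
    ring
  -- class a
  have ha : ∀ c, Function.Injective c → (∀ l, c l ≠ j) → |mnr Y c| ≤ u := by
    intro c hc hj
    rw [hY0 c hc, if_neg (by rw [mem_im]; push Not; exact hj), Real.exp_zero, one_mul]
    exact hb lo' hlo' c
  have hc1 : ∀ c, Function.Injective c → |mnr Y c| ≤ u * Real.exp ((1 + r j) * τ) := by
    intro c hc
    rw [hY0 c hc, mul_comm]
    refine mul_le_mul (hb lo' hlo' c) (Real.exp_le_exp.2 ?_) (Real.exp_pos _).le hu.le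
    split_ifs
    · exact le_rfl
    · have : 0 ≤ r j := by linarith
      positivity
  -- class b
  have hbb : ∀ c, Function.Injective c → (∀ l, c l ≠ o) → |mnr Y c| ≤ D := by
    intro c hc ho
    rcases cols_cases o j c hc with h1 | ⟨l, hl, h1⟩ | ⟨l, hl, h1⟩ | ⟨l, l', hl, hl', h1⟩
    · exact (ha c hc fun l => (h1 l).2).trans hDu
    · exact absurd hl (ho l)
    · set c' := Function.update c l o with hc'
      have hc'i : Function.Injective c' := inj_update hc l ho
      have hc'l : c' l = o := by simp [hc']
      have hc'3 : ∀ l', l' ≠ l → c' l' ≠ o ∧ c' l' ≠ j := fun l' hl' => by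
        rw [show c' l' = c l' by simp [hc', hl']]; exact h1 l' hl'
      set b := fun i => mnr A (Function.update c l i) with hbdef
      set g' := gS o j r (t1+τ) τ (Finset.univ.image c') with hg'
      have e1 : ∀ x ∈ Set.Icc lo' hi', |lin b φ x| ≤ u * Real.exp (-g') := by
        intro x hx
        have := hb x hx c'
        rw [h.mnr_wt _ _ A _ c' hc'i, mnr_o A o j φ φ1 x c' l hc'l hc'3, abs_mul, Real.abs_exp] at this
        have e : (fun i => mnr A (Function.update c' l i)) = b := by
          ext i; rw [hc', Function.update_idem]
        rw [e] at this
        rw [Real.exp_neg, ← div_eq_mul_inv, le_div_iff₀ (Real.exp_pos _), mul_comm]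
        exact this
      have e2 := (h.fs.M b lo' hi' hlo (by linarith) hhi _ e1 lo' hlo').1
      rw [hYc c hc, mnr_j A o j φ φ1 lo' c hoj l hl h1]
      have e3 : gS o j r t1 (2*τ) (Finset.univ.image c) = g' - (1 + r j) * t1 := by
        rw [hg', gS, gS, if_neg (by rw [mem_im]; push Not; exact ho), if_pos (mem_im.2 ⟨l, hl⟩),
          if_pos (mem_im.2 ⟨l, hc'l⟩), if_neg, rI_image _ _ _ c hc, rI_image _ _ _ c' hc'i]
        · have : ∑ l, rr o j r (c l) = ∑ l, rr o j r (c' l) := by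
            refine Finset.sum_congr rfl fun l' _ => ?_
            by_cases e : l' = l
            · subst e; rw [hl, hc'l]; simp [rr]
            · simp [hc', e]
          rw [this]; ring
        · rw [mem_im]; rintro ⟨l', hl'⟩
          by_cases e : l' = l
          · rw [e, hc'l] at hl'; exact hoj hl'
          · exact (hc'3 l' e).2 hl'
      rw [e3]
      calc _ ≤ Real.exp (g' - (1 + r j) * t1) * (C * (u * Real.exp (-g')) / (hi' - lo')) := by gcongr
        _ = C * u / (hi - lo) := by
          rw [hlen, Real.exp_sub, Real.exp_neg, Real.exp_neg]
          have := Real.exp_pos g'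
          have := Real.exp_pos ((1 + r j) * t1)
          have : hi - lo ≠ 0 := by linarith [h.lohi]
          field_simp
        _ ≤ D := by
          rw [div_le_iff₀ (by linarith [h.lohi]), hD]
          have := h.lenB
          have : 0 ≤ C * u := by positivity
          nlinarith
    · exact absurd hl (ho l)
  -- exchange
  have hex : ∃ α, 0 ≤ α ∧ α ≤ (1 + r j) * τ ∧ (∀ c, Function.Injective c → |mnr Y c| ≤ D * Real.exp α) ∧
      ∀ c, Function.Injective c → (∀ l, c l ≠ o) → (∀ l, c l ≠ j) → |mnr Y c| ≤ k * D * Real.exp (-α) := by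
    have hne : Nonempty (Fin k → ι) := ⟨fun _ => o⟩
    obtain ⟨d, -, hd⟩ := Finset.exists_max_image (Finset.univ : Finset (Fin k → ι)) (fun c => |mnr Y c|)
      Finset.univ_nonempty
    rcases le_or_gt (|mnr Y d|) D with hQ | hQ
    · refine ⟨0, le_rfl, ?_, fun c _ => ?_, fun c _ _ _ => ?_⟩
      · have : 0 ≤ r j := by linarith
        positivity
      · rw [Real.exp_zero, mul_one]; exact (hd c (Finset.mem_univ _)).trans hQ
      · rw [neg_zero, Real.exp_zero, mul_one]
        refine ((hd c (Finset.mem_univ _)).trans hQ).trans ?_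
        nlinarith
    · set Q := |mnr Y d| with hQd
      have hQ0 : 0 < Q := by linarith
      have hdi : Function.Injective d := inj_of_mnr (A := Y) (fun e => by rw [hQd, e] at hQ0; simp at hQ0)
      have hdo : ∃ l, d l = o := by
        by_contra hcon; push Not at hcon
        exact absurd (hbb d hdi hcon) (not_le.2 hQ)
      obtain ⟨l, hl⟩ := hdo
      refine ⟨Real.log (Q / D), Real.log_nonneg ((one_le_div hD0).2 hQ.le), ?_, ?_, ?_⟩
      · rw [Real.log_le_iff_le_exp (by positivity), div_le_iff₀ hD0, mul_comm]
        exact (hc1 d hdi).trans (by gcongr)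
      · intro c _
        rw [Real.exp_log (by positivity), mul_div_cancel₀ _ hD0.ne']
        exact hd c (Finset.mem_univ _)
      · intro c hc ho hj
        rw [Real.exp_neg, Real.exp_log (by positivity), inv_div, mul_div_assoc', le_div_iff₀ hQ0]
        have e := mnr_exchange Y d c l
        have e2 : |mnr Y c| * Q = |mnr Y d * mnr Y c| := by rw [abs_mul, mul_comm]
        rw [e2, e]
        refine (Finset.abs_sum_le_sum_abs _ _).trans ?_
        calc _ ≤ ∑ l' : Fin k, D * D := by
              refine Finset.sum_le_sum fun l' _ => ?_
              rw [abs_mul]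
              refine mul_le_mul ?_ ?_ (abs_nonneg _) hD0.le
              · by_cases hin : Function.Injective (Function.update d l (c l'))
                · refine hbb _ hin fun l'' => ?_
                  by_cases e : l'' = l
                  · subst e; simp; exact ho l'
                  · simp [e]; exact fun e' => e (hdi (e'.trans hl.symm))
                · have : mnr Y (Function.update d l (c l')) = 0 := by
                    by_contra hne; exact hin (inj_of_mnr hne)
                  rw [this, abs_zero]; exact hD0.le
              · rw [hl]
                refine (ha _ (inj_update hc l' ho) fun l'' => ?_).trans hDu
                by_cases e : l'' = l'
                · subst e; simp; exact hoj
                · simp [e]; exact hj l''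
          _ = k * D * D := by simp; ring
  obtain ⟨α, hα0, hατ, hα1, hα2⟩ := hex
  have hg0 : 0 < 1 + r j + ϖ/2 := by linarith
  set ζ := α / (1 + r j + ϖ/2) with hζ
  have hζα : α = (1 + r j + ϖ/2) * ζ := by rw [hζ, mul_div_cancel₀ _ hg0.ne']
  have hζ0 : 0 ≤ ζ := by positivity
  refine ⟨ζ, hζ0, ?_, fun c => ?_⟩
  · rw [hζ, div_le_iff₀ hg0]; nlinarith
  by_cases hc : Function.Injective c
  · have e0 : |mnr (A * Mx o j (wt o j r t1 (2*τ-ζ)) φ φ1 lo') c| = |mnr Y c| *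
        Real.exp (- (if o ∈ Finset.univ.image c then ζ else 0) - (if j ∈ Finset.univ.image c then ζ else 0)
      + rI o j r (Finset.univ.image c) * ζ) := by
      rw [hYc c hc, h.mnr_wt _ _ A _ c hc, abs_mul, Real.abs_exp, gS_ζ]
      have : ∀ a b e f : ℝ, a - b - e + f = a + (-b - e + f) := by intros; ring
      rw [this, Real.exp_add]; ring
    rw [e0]
    have hrI := h.rI_le (Finset.univ.image c)
    have hkD : D ≤ k * D := by nlinarith
    rcases cols_cases o j c hc with h1 | ⟨l, hl, h1⟩ | ⟨l, hl, h1⟩ | ⟨l, l', hl, hl', h1⟩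
    · rw [if_neg (by rw [mem_im]; push Not; exact fun l => (h1 l).1),
        if_neg (by rw [mem_im]; push Not; exact fun l => (h1 l).2)]
      calc _ ≤ (k * D * Real.exp (-α)) * _ :=
            mul_le_mul_of_nonneg_right (hα2 c hc (fun l => (h1 l).1) (fun l => (h1 l).2)) (Real.exp_pos _).le
        _ = k * D * Real.exp (-α + (- 0 - 0 + rI o j r (Finset.univ.image c) * ζ)) := by
            rw [Real.exp_add (-α)]; ring
        _ ≤ _ := by
            gcongr
            rw [hζα]
            nlinarith
    · rw [if_pos (mem_im.2 ⟨l, hl⟩), if_neg]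
      · refine mul_le_mul ?_ ?_ (Real.exp_pos _).le (by positivity)
        · refine ((ha c hc fun l'' => ?_).trans hDu).trans hkD
          by_cases e : l'' = l
          · rw [e, hl]; exact hoj
          · exact (h1 l'' e).2
        · gcongr; nlinarith
      · rw [mem_im]; rintro ⟨l'', hl''⟩
        by_cases e : l'' = l
        · rw [e, hl] at hl''; exact hoj hl''
        · exact (h1 l'' e).2 hl''
    · have hno : ∀ l'', c l'' ≠ o := fun l'' => by
        by_cases e : l'' = l
        · rw [e, hl]; exact hoj.symm
        · exact (h1 l'' e).1
      rw [if_pos (mem_im.2 ⟨l, hl⟩), if_neg (by rw [mem_im]; push Not; exact hno)]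
      refine mul_le_mul ((hbb c hc hno).trans hkD) ?_ (Real.exp_pos _).le (by positivity)
      gcongr; nlinarith
    · rw [if_pos (mem_im.2 ⟨l, hl⟩), if_pos (mem_im.2 ⟨l', hl'⟩)]
      obtain ⟨i, hi⟩ : ∃ i, i ∉ Finset.univ.image c := by
        by_contra hcon; push Not at hcon
        have h2 : Fintype.card ι ≤ (Finset.univ.image c).card := by
          rw [← Finset.card_univ]; exact Finset.card_le_card fun i _ => hcon i
        have h3 := Finset.card_image_le (s := (Finset.univ : Finset (Fin k))) (f := c)
        rw [Finset.card_univ, Fintype.card_fin] at h3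
        omega
      have hr2 := h.rI_le' _ hi (fun e => hi (e ▸ mem_im.2 ⟨l, hl⟩)) (fun e => hi (e ▸ mem_im.2 ⟨l', hl'⟩))
      calc _ ≤ (D * Real.exp α) * _ :=
            mul_le_mul_of_nonneg_right (hα1 c hc) (Real.exp_pos _).le
        _ = D * Real.exp (α + (- ζ - ζ + rI o j r (Finset.univ.image c) * ζ)) := by
            rw [Real.exp_add α]; ring
        _ ≤ _ := by
            refine mul_le_mul hkD (Real.exp_le_exp.2 ?_) (Real.exp_pos _).le (by positivity)
            rw [hζα]
            nlinarith
  · have : mnr (A * Mx o j (wt o j r t1 (2*τ-ζ)) φ φ1 lo') c = 0 := by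
      by_contra hne; exact hc (inj_of_mnr hne)
    rw [this, abs_zero]; positivity

end Sys
end

end BB

set_option linter.unusedVariables false
set_option linter.unusedSectionVars false
open MeasureTheory ENNReal

namespace BB

section
variable {ι : Type} [Fintype ι] [DecidableEq ι]
variable {o j : ι} {r : ι → ℝ} {ϖ C B lo hi : ℝ} {φ φ1 φ2 : ι → ℝ → ℝ}

/-- coordinates -/
noncomputable def co (o j : ι) (φ φ1 : ι → ℝ → ℝ) (b : ι → ℝ) (x : ℝ) (i : ι) : ℝ :=
  if i = o then lin b φ x else if i = j then lin b φ1 x else b i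

lemma vecMul_Mx (b : ι → ℝ) (o j : ι) (w : ι → ℝ) (φ φ1 : ι → ℝ → ℝ) (x : ℝ) (i : ι) :
    Matrix.vecMul b (Mx o j w φ φ1 x) i = w i * co o j φ φ1 b x i := by
  have := mul_Mx (Matrix.of fun _ : Unit => b) o j w φ φ1 x () i
  rw [co]
  exact this

/-- small integer vectors -/
def Box (o j : ι) (r : ι → ℝ) (φ φ1 : ι → ℝ → ℝ) (κ s t τ x : ℝ) (a : ι → ℤ) : Prop :=
  a ≠ 0 ∧ ∀ i, wt o j r t τ i * |co o j φ φ1 (toR a) x i| ≤ κ * Real.exp (s * τ)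

lemma toR_eq_zero {a : ι → ℤ} (h : toR a = 0) : a = 0 := by
  ext i
  have := congrFun h i
  simpa [toR] using this

lemma Sys.co_inj (h : Sys o j r ϖ C B lo hi φ φ1 φ2) {x : ℝ} (hx : x ∈ Set.Icc lo hi) (b : ι → ℝ)
    (hb : ∀ i, co o j φ φ1 b x i = 0) : b = 0 := by
  have h1 : ∀ i, i ≠ o → i ≠ j → b i = 0 := fun i hio hij => by
    have := hb i; simpa [co, hio, hij] using this
  have hj : b j = 0 := by
    have h2 := hb j
    rw [co, if_neg h.oj.symm, if_pos rfl, lin, Finset.sum_eq_single j] at h2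
    · have h3 := h.low x hx
      rcases mul_eq_zero.1 h2 with e | e
      · exact e
      · rw [e] at h3; norm_num at h3
    · intro i _ hij
      by_cases hio : i = o
      · rw [hio, h.fs.one1, mul_zero]
      · rw [h1 i hio hij, zero_mul]
    · simp
  have ho : b o = 0 := by
    have h2 := hb o
    rw [co, if_pos rfl, lin, Finset.sum_eq_single o] at h2
    · rwa [h.fs.one, mul_one] at h2
    · intro i _ hio
      by_cases hij : i = j
      · rw [hij, hj, zero_mul]
      · rw [h1 i hio hij, zero_mul]
    · simp
  ext i
  by_cases hio : i = o
  · rw [hio, ho]; rfl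
  · by_cases hij : i = j
    · rw [hij, hj]; rfl
    · rw [h1 i hio hij]; rfl

lemma wt_pos (o j : ι) (r : ι → ℝ) (t τ : ℝ) (i : ι) : 0 < wt o j r t τ i := Real.exp_pos _

lemma Sys.mnr_ne (h : Sys o j r ϖ C B lo hi φ φ1 φ2) {x : ℝ} (hx : x ∈ Set.Icc lo hi) {k : ℕ}
    (A : Matrix (Fin k) ι ℝ) (c : Fin k → ι) (hc : mnr A c ≠ 0) (t τ : ℝ) :
    ∃ c, mnr (A * Mx o j (wt o j r t τ) φ φ1 x) c ≠ 0 := by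
  have h1 := linInd_of_mnr A c hc
  apply exists_mnr_ne_zero
  have e : (A * Mx o j (wt o j r t τ) φ φ1 x).row =
      (Matrix.vecMulLinear (Mx o j (wt o j r t τ) φ φ1 x)) ∘ A.row := by
    ext l i; rfl
  rw [e]
  refine h1.map' _ ?_
  rw [LinearMap.ker_eq_bot']
  intro b hb
  refine h.co_inj hx b fun i => ?_
  have := congrFun hb i
  rw [Matrix.vecMulLinear_apply, vecMul_Mx] at this
  rcases mul_eq_zero.1 this with e | e
  · exact absurd e (wt_pos _ _ _ _ _ _).ne'
  · exact e

lemma wt_round (h : Sys o j r ϖ C B lo hi φ φ1 φ2) {t τ1 τ2 d : ℝ} (h1 : τ1 ≤ τ2) (h2 : τ2 ≤ τ1 + d) (i : ι) :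
    wt o j r t τ1 i ≤ Real.exp d * wt o j r t τ2 i := by
  unfold wt
  rw [← Real.exp_add]
  refine Real.exp_le_exp.2 ?_
  unfold ex
  split_ifs with e1 e2
  · linarith
  · linarith
  · have h3 : r i ≤ 1 := (h.rle i e1).trans h.rj1
    have h4 : 0 ≤ r i := h.wpos.le.trans (h.rge i e1)
    nlinarith

lemma inj_card {k : ℕ} {c : Fin k → ι} (hc : Function.Injective c) : k ≤ Fintype.card ι := by
  simpa using Fintype.card_le_of_injective c hc

lemma Sys.LB_loc (h : Sys o j r ϖ C B lo hi φ φ1 φ2) {m : ℕ} (hm : Fintype.card ι ≤ m) {s d t1 : ℝ} {q : ℕ}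
    (hs : s = ϖ / (2 * m)) (hd : 0 < d) (ht1 : 0 ≤ t1)
    (hbig1 : 2 * B ≤ Real.exp (ϖ * (q * d) / 4))
    (hbig2 : 2 * m * (m * (C * B)) * Real.exp ((1 + s) * d) ≤ Real.exp (s * (q * d) / 2))
    {lo' hi' : ℝ} (hlo : lo ≤ lo') (hhi : hi' ≤ hi)
    (hlen : hi' - lo' = (hi - lo) * Real.exp (-((1 + r j) * t1)))
    (hal : ∀ q'' : ℕ, q ≤ q'' → q'' ≤ 2 * q → ∀ a, ¬ Box o j r φ φ1 1 s t1 (q'' * d) lo' a)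
    {k : ℕ} (hk : 1 ≤ k) (A : Matrix (Fin k) ι ℤ) (hA : ∃ c, mnr A c ≠ 0) :
    ∃ x ∈ Set.Icc lo' hi', Real.exp (k * (3/2 * s * (q * d))) ≤
      Psi (A.map (Int.cast : ℤ → ℝ) * Mx o j (wt o j r (t1 + q * d) (q * d)) φ φ1 x) := by
  obtain ⟨c, hcZ⟩ := hA
  set AR := A.map (Int.cast : ℤ → ℝ) with hAR
  have hA1 : ∀ c, mnr AR c ≠ 0 → 1 ≤ |mnr AR c| := by
    intro c hc
    rw [hAR, mnr_intCast] at hc ⊢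
    have : mnr A c ≠ 0 := by exact_mod_cast hc
    exact_mod_cast Int.one_le_abs this
  have hc : mnr AR c ≠ 0 := by rw [hAR, mnr_intCast]; exact_mod_cast hcZ
  have hinj : Function.Injective c := inj_of_mnr hc
  have hkc := inj_card hinj
  have hkm : (k:ℝ) ≤ m := by exact_mod_cast hkc.trans hm
  have hk1 : (1:ℝ) ≤ k := by exact_mod_cast hk
  have hm0 : (0:ℝ) < m := by linarith
  have hw := h.wpos
  have hs0 : 0 < s := by rw [hs]; positivity
  have hsm : s * m = ϖ / 2 := by rw [hs]; field_simp
  have hB := h.hB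
  have hC := h.fs.hC
  set τ := q * d with hτ
  have hτ0 : 0 ≤ τ := by positivity
  have hlen0 : 0 < hi' - lo' := by rw [hlen]; exact mul_pos (by linarith [h.lohi]) (Real.exp_pos _)
  have hlo' : lo' ∈ Set.Icc lo hi := ⟨hlo, by linarith⟩
  rcases hkc.lt_or_eq with hlt | heq
  · by_contra hcon
    push Not at hcon
    set u := Real.exp (k * (3/2 * s * τ)) with hu
    obtain ⟨ζ, hζ0, hζ1, hζ⟩ := h.loc hk hlt AR ht1 hτ0 (Real.exp_pos _ : 0 < u) hlo hhi hlen
      (fun x hx c => (le_Psi _ c).trans (hcon x hx).le)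
    set Y := AR * Mx o j (wt o j r t1 (2*τ-ζ)) φ φ1 lo' with hY
    set η := (m * (C * B)) * Real.exp (3/2 * s * τ - s * ζ) with hη
    have hCB : 1 ≤ C * B := by nlinarith
    have hmCB : 1 ≤ m * (C * B) := by nlinarith
    have hη0 : 0 < η := by positivity
    obtain ⟨v, hv0, hv⟩ := exists_short hk Y hη0 (fun c => by
      refine (hζ c).trans ?_
      rw [hη, mul_pow, ← Real.exp_nat_mul]
      have e1 : m * (C * B) ≤ (m * (C * B))^k := le_self_pow₀ hmCB (by omega)
      have e2 : k * (C * B * u) * Real.exp (-(ϖ/2*ζ)) = (k * (C * B)) * Real.exp (k * (3/2 * s * τ) - ϖ/2*ζ) := by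
        rw [hu, sub_eq_add_neg, Real.exp_add]; ring
      rw [e2]
      refine mul_le_mul ?_ (Real.exp_le_exp.2 ?_) (Real.exp_pos _).le (by positivity)
      · refine le_trans ?_ e1
        gcongr
      · have : s * k * ζ ≤ ϖ / 2 * ζ := by
          rw [← hsm]; gcongr
        linarith) (h.mnr_ne hlo' AR c hc _ _)
    set a : ι → ℤ := fun i => ∑ l, v l * A l i with ha
    have haR : toR a = ∑ l, (v l : ℝ) • AR.row l := by
      ext i
      simp [toR, ha, hAR, Matrix.row]
    have ha0 : a ≠ 0 := by
      intro e
      have e2 : ∑ l, (v l : ℝ) • AR.row l = 0 := by rw [← haR, e]; ext i; simp [toR]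
      have e3 := (Fintype.linearIndependent_iff.1 (linInd_of_mnr AR c hc)) _ e2
      apply hv0
      ext l
      have := e3 l
      exact_mod_cast this
    have hav : ∀ i, Matrix.vecMul (toR a) (Mx o j (wt o j r t1 (2*τ-ζ)) φ φ1 lo') i = ∑ l, (v l:ℝ) * Y l i := by
      intro i
      rw [haR, Matrix.sum_vecMul, Finset.sum_apply]
      refine Finset.sum_congr rfl fun l _ => ?_
      rw [Matrix.smul_vecMul]
      rfl
    set q'' := ⌊(2*τ-ζ)/d⌋₊ with hq''
    have hnn : 0 ≤ (2*τ-ζ)/d := by apply div_nonneg <;> linarith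
    have f1 : q'' * d ≤ 2*τ-ζ := by
      rw [← le_div_iff₀ hd]; exact Nat.floor_le hnn
    have f2 : 2*τ-ζ ≤ q'' * d + d := by
      have : (2*τ-ζ)/d < q'' + 1 := Nat.lt_floor_add_one _
      rw [div_lt_iff₀ hd] at this
      linarith
    have f3 : q ≤ q'' := by
      apply Nat.le_floor
      rw [le_div_iff₀ hd]
      linarith
    have f4 : q'' ≤ 2 * q := by
      have : (q'' : ℝ) ≤ (2*q : ℕ) := by
        have : q'' * d ≤ (2 * q) * d := by linarith
        push_cast
        exact le_of_mul_le_mul_right this hd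
      exact_mod_cast this
    refine hal q'' f3 f4 a ⟨ha0, fun i => ?_⟩
    have g1 := hv i
    rw [← hav i, vecMul_Mx, abs_mul, abs_of_pos (wt_pos _ _ _ _ _ _)] at g1
    calc _ ≤ (Real.exp d * wt o j r t1 (2*τ-ζ) i) * |co o j φ φ1 (toR a) lo' i| :=
          mul_le_mul_of_nonneg_right (wt_round h f1 f2 i) (abs_nonneg _)
      _ = Real.exp d * (wt o j r t1 (2*τ-ζ) i * |co o j φ φ1 (toR a) lo' i|) := by ring
      _ ≤ Real.exp d * (2 * k * η) := by gcongr
      _ ≤ Real.exp d * (2 * m * η) := by gcongr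
      _ = (2 * m * (m * (C * B)) * Real.exp ((1 + s) * d)) * Real.exp (3/2 * s * τ - s * ζ - s * d) := by
          have : Real.exp ((1 + s) * d) * Real.exp (3/2 * s * τ - s * ζ - s * d) = Real.exp d * Real.exp (3/2 * s * τ - s * ζ) := by
            rw [← Real.exp_add, ← Real.exp_add]; ring_nf
          rw [hη]
          linear_combination (-(2 * m * (m * (C * B)))) * this
      _ ≤ Real.exp (s * τ / 2) * Real.exp (3/2 * s * τ - s * ζ - s * d) := by gcongr
      _ ≤ 1 * Real.exp (s * (q'' * d)) := by
          rw [← Real.exp_add, one_mul]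
          refine Real.exp_le_exp.2 ?_
          have := mul_le_mul_of_nonneg_left f2 hs0.le
          linarith
  · refine ⟨lo', ⟨le_rfl, by linarith⟩, ?_⟩
    have hbij : ∀ c, mnr AR c ≠ 0 → (∃ l, c l = o) ∧ ∃ l, c l = j := by
      intro c hc
      have := (Fintype.bijective_iff_injective_and_card c).2 ⟨inj_of_mnr hc, by simpa using heq⟩
      exact ⟨this.2 o, this.2 j⟩
    have h1 := h.LB_both (t := t1 + τ) (by linarith) hτ0 AR c (hA1 c hc) hbij lo' hlo'
    set P := Psi (AR * Mx o j (wt o j r (t1 + τ) τ) φ φ1 lo') with hP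
    have hP0 : 0 ≤ P := Psi_nonneg _
    have h2 : Real.exp (ϖ * τ) ≤ Real.exp (ϖ * τ / 4) * P := by
      refine h1.trans ?_
      gcongr
      linarith
    have h3 : Real.exp (ϖ * τ) = Real.exp (ϖ * τ / 4) * Real.exp (3/4 * (ϖ * τ)) := by
      rw [← Real.exp_add]; ring_nf
    rw [h3] at h2
    refine le_trans (Real.exp_le_exp.2 ?_) (le_of_mul_le_mul_left h2 (Real.exp_pos _))
    have : s * k * τ ≤ ϖ / 2 * τ := by
      rw [← hsm]; gcongr
    linarith

lemma Sys.LB_glob (h : Sys o j r ϖ C B lo hi φ φ1 φ2) {m : ℕ} (hm : Fintype.card ι ≤ m) {s τ t : ℝ}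
    (hs : s = ϖ / (2 * m)) (ht : 0 ≤ t) (hτ0 : 0 ≤ τ)
    (hbig1 : 2 * B ≤ Real.exp (ϖ * τ / 4))
    {k : ℕ} (hk : 1 ≤ k) (A : Matrix (Fin k) ι ℤ) (hA : ∃ c, mnr A c ≠ 0) :
    ∃ x ∈ Set.Icc lo hi, Real.exp (k * (3/2 * s * τ)) ≤
      Psi (A.map (Int.cast : ℤ → ℝ) * Mx o j (wt o j r t τ) φ φ1 x) := by
  obtain ⟨c, hcZ⟩ := hA
  set AR := A.map (Int.cast : ℤ → ℝ) with hAR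
  have hA1 : ∀ c, mnr AR c ≠ 0 → 1 ≤ |mnr AR c| := by
    intro c hc
    rw [hAR, mnr_intCast] at hc ⊢
    have : mnr A c ≠ 0 := by exact_mod_cast hc
    exact_mod_cast Int.one_le_abs this
  have hc : mnr AR c ≠ 0 := by rw [hAR, mnr_intCast]; exact_mod_cast hcZ
  have hinj : Function.Injective c := inj_of_mnr hc
  have hkc := inj_card hinj
  have hkm : (k:ℝ) ≤ m := by exact_mod_cast hkc.trans hm
  have hk1 : (1:ℝ) ≤ k := by exact_mod_cast hk
  have hm0 : (0:ℝ) < m := by linarith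
  have hw := h.wpos
  have hs0 : 0 < s := by rw [hs]; positivity
  have hsm : s * m = ϖ / 2 := by rw [hs]; field_simp
  have hB := h.hB
  obtain ⟨x, hx, h1⟩ := h.LB_global ht hτ0 hk AR hA1 c hc
  refine ⟨x, hx, ?_⟩
  set P := Psi (AR * Mx o j (wt o j r t τ) φ φ1 x) with hP
  have hP0 : 0 ≤ P := Psi_nonneg _
  have h2 : Real.exp (ϖ * τ) ≤ Real.exp (ϖ * τ / 4) * P := by
    refine h1.trans ?_
    gcongr
  have h3 : Real.exp (ϖ * τ) = Real.exp (ϖ * τ / 4) * Real.exp (3/4 * (ϖ * τ)) := by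
    rw [← Real.exp_add]; ring_nf
  rw [h3] at h2
  refine le_trans (Real.exp_le_exp.2 ?_) (le_of_mul_le_mul_left h2 (Real.exp_pos _))
  have : s * k * τ ≤ ϖ / 2 * τ := by
    rw [← hsm]; gcongr
  linarith

end
end BB

set_option linter.unusedVariables false
set_option linter.unusedSectionVars false
open MeasureTheory ENNReal

namespace BB

/-- dyadic intervals -/
def J (lo L : ℝ) (p i : ℕ) : Set ℝ := Set.Icc (lo + i * (L / 2 ^ p)) (lo + (i + 1) * (L / 2 ^ p))

lemma J_sub {lo L : ℝ} (hL : 0 ≤ L) {p' p i : ℕ} (hp : p' ≤ p) :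
    J lo L p i ⊆ J lo L p' (i / 2 ^ (p - p')) := by
  have e : (2:ℝ)^p = 2^p' * 2^(p-p') := by rw [← pow_add]; congr 1; omega
  set N := 2^(p-p') with hN
  have hNpos : 0 < N := by positivity
  have hNR : (2:ℝ)^(p-p') = (N:ℝ) := by rw [hN]; push_cast; rfl
  have h1 : (i / N) * N ≤ i := Nat.div_mul_le_self i N
  have h2 : i + 1 ≤ (i / N + 1) * N := by
    have := Nat.lt_div_mul_add hNpos (a := i)
    rw [add_mul]; omega
  have h1' : ((i / N : ℕ):ℝ) * N ≤ i := by exact_mod_cast h1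
  have h2' : (i:ℝ) + 1 ≤ (((i / N : ℕ):ℝ) + 1) * N := by exact_mod_cast h2
  have hNR0 : (0:ℝ) < N := by exact_mod_cast hNpos
  have e3 : L / 2^p' = N * (L/2^p) := by
    rw [e, hNR]; field_simp
  have hδ : 0 ≤ L/2^p := by positivity
  unfold J
  apply Set.Icc_subset_Icc
  · rw [e3, ← mul_assoc]
    gcongr
  · rw [e3, ← mul_assoc]
    gcongr

lemma J_sub_root {lo L : ℝ} (hL : 0 ≤ L) {p i : ℕ} (hi : i < 2 ^ p) : J lo L p i ⊆ Set.Icc lo (lo + L) := by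
  have := J_sub (lo := lo) hL (i := i) (Nat.zero_le p)
  rw [Nat.sub_zero, Nat.div_eq_of_lt hi] at this
  simpa [J] using this

lemma count_vol {lo L V : ℝ} (hL : 0 < L) {p : ℕ} (R : Finset ℕ) (S : Set ℝ) (hV : 0 ≤ V)
    (hR : ∀ i ∈ R, J lo L p i ⊆ S) (hS : volume S ≤ ENNReal.ofReal (V * (L / 2^p))) :
    (R.card : ℝ) ≤ V := by
  set δ := L / 2^p with hδ
  have hδ0 : 0 < δ := by positivity
  have h1 : volume (⋃ i ∈ R, Set.Ioo (lo + (i:ℝ) * δ) (lo + (i+1) * δ)) = ∑ i ∈ R, ENNReal.ofReal δ := by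
    rw [measure_biUnion_finset]
    · refine Finset.sum_congr rfl fun i _ => ?_
      rw [Real.volume_Ioo]; congr 1; ring
    · have key : ∀ a b : ℕ, a < b → Disjoint (Set.Ioo (lo + (a:ℝ) * δ) (lo + (a+1) * δ))
          (Set.Ioo (lo + (b:ℝ) * δ) (lo + (b+1) * δ)) := by
        intro a b hab
        rw [Set.disjoint_left]
        intro x hx hx'
        have : (a:ℝ) + 1 ≤ b := by exact_mod_cast hab
        have := mul_le_mul_of_nonneg_right this hδ0.le
        linarith [hx.2, hx'.1]
      intro a _ b _ hab
      rcases lt_or_gt_of_ne hab with e | e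
      · exact key a b e
      · exact (key b a e).symm
    · intro i _; exact measurableSet_Ioo
  have h2 : (⋃ i ∈ R, Set.Ioo (lo + (i:ℝ) * δ) (lo + (i+1) * δ)) ⊆ S := by
    intro x hx
    simp only [Set.mem_iUnion] at hx
    obtain ⟨i, hi, hx⟩ := hx
    exact hR i hi (Set.Ioo_subset_Icc_self hx)
  have h3 := (measure_mono h2).trans hS
  rw [h1, Finset.sum_const, nsmul_eq_mul, ← ENNReal.ofReal_natCast, ← ENNReal.ofReal_mul (by positivity),
    ENNReal.ofReal_le_ofReal_iff (by positivity)] at h3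
  exact le_of_mul_le_mul_right h3 hδ0

section
variable {ι : Type} [Fintype ι] [DecidableEq ι]
variable {o j : ι} {r : ι → ℝ} {ϖ C B lo hi : ℝ} {φ φ1 φ2 : ι → ℝ → ℝ}

lemma meas (C : ℝ) (hC : 1 ≤ C) (m : ℕ) : ∃ K α : ℝ, 0 < K ∧ 0 < α ∧
    ∀ {ι : Type} [Fintype ι] [DecidableEq ι], Fintype.card ι ≤ m →
    ∀ {o j : ι} {r : ι → ℝ} {ϖ B lo hi : ℝ} {φ φ1 φ2 : ι → ℝ → ℝ}, Sys o j r ϖ C B lo hi φ φ1 φ2 →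
    ∀ {s t τ κ lo' hi' : ℝ}, 0 < κ → lo ≤ lo' → lo' < hi' → hi' ≤ hi →
    (∀ k, 1 ≤ k → ∀ A : Matrix (Fin k) ι ℤ, (∃ c, mnr A c ≠ 0) →
      ∃ x ∈ Set.Icc lo' hi', Real.exp (k * (3/2 * s * τ)) ≤
        Psi (A.map (Int.cast : ℤ → ℝ) * Mx o j (wt o j r t τ) φ φ1 x)) →
    volume ({x | ∃ a, Box o j r φ φ1 κ s t τ x a} ∩ Set.Icc lo' hi') ≤
      ENNReal.ofReal (K * (κ * Real.exp (-(s * τ / 2))) ^ α * (hi' - lo')) := by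
  obtain ⟨N, hN⟩ := exists_nat_ge (4 * C^2)
  have hC' : 1 ≤ C * 2^(N+1) := by
    have : (1:ℝ) ≤ 2^(N+1) := one_le_pow₀ (by norm_num)
    nlinarith
  obtain ⟨K, α, hK, hα, H⟩ := nondiv (C * 2^(N+1)) hC' m
  refine ⟨K, α, hK, hα, ?_⟩
  intro ι _ _ hm o j r ϖ B lo hi φ φ1 φ2 h s t τ κ lo' hi' hκ hlo hlt hhi hLB
  set E := Real.exp (-(3/2 * s * τ)) with hE
  have hE0 : 0 < E := Real.exp_pos _
  set w : ι → ℝ := fun i => E * wt o j r t τ i with hw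
  have hsc : ∀ {k : ℕ} (A : Matrix (Fin k) ι ℝ) x c, mnr (A * Mx o j w φ φ1 x) c =
      E^k * mnr (A * Mx o j (wt o j r t τ) φ φ1 x) c := by
    intro k A x c
    rw [mnr_mul_Mx A o j w, mnr_mul_Mx A o j (wt o j r t τ), hw, Finset.prod_mul_distrib]
    simp [mul_assoc]
  have hfs := h.fs.sub hlo hhi
  have := H hm (fun x => Mx o j w φ φ1 x) lo' hi' (κ * Real.exp (-(s * τ / 2))) hlt (by positivity)
    (fun k A => hfs.psi hN h.oj w _) (fun k hk A hA => by
      obtain ⟨x, hx, hP⟩ := hLB k hk A hA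
      refine ⟨x, hx, ?_⟩
      have h1 : Psi (A.map (Int.cast : ℤ → ℝ) * Mx o j (wt o j r t τ) φ φ1 x) ≤
          (E^k)⁻¹ * Psi (A.map (Int.cast : ℤ → ℝ) * Mx o j w φ φ1 x) := by
        refine Psi_le _ (mul_nonneg (by positivity) (Psi_nonneg _)) fun c => ?_
        have := le_Psi (A.map (Int.cast : ℤ → ℝ) * Mx o j w φ φ1 x) c
        rw [hsc, abs_mul, abs_of_pos (by positivity)] at this
        rw [inv_mul_eq_div, le_div_iff₀ (by positivity), mul_comm]
        exact this
      have h2 := hP.trans h1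
      have h3 : Real.exp (k * (3/2 * s * τ)) = (E^k)⁻¹ := by
        rw [hE, ← Real.exp_nat_mul, ← Real.exp_neg]; ring_nf
      rw [h3] at h2
      exact (le_mul_iff_one_le_right (by positivity)).1 h2)
  refine (measure_mono ?_).trans this
  refine Set.inter_subset_inter_left _ ?_
  rintro x ⟨a, ha0, ha⟩
  refine ⟨a, Set.mem_univ _, ha0, fun i => ?_⟩
  rw [vecMul_Mx, abs_mul, hw]
  simp only
  rw [abs_of_pos (mul_pos hE0 (wt_pos _ _ _ _ _ _)), mul_assoc]
  calc _ ≤ E * (κ * Real.exp (s * τ)) := mul_le_mul_of_nonneg_left (ha i) hE0.le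
    _ = κ * (E * Real.exp (s * τ)) := by ring
    _ = _ := by rw [hE, ← Real.exp_add]; ring_nf

/-- constant -/
noncomputable def C1 (m : ℕ) (B : ℝ) : ℝ := m * B * (B * (1 + m * B))

lemma Sys.coef (h : Sys o j r ϖ C B lo hi φ φ1 φ2) {m : ℕ} (hm : Fintype.card ι ≤ m) {b : ι → ℝ} {H x : ℝ}
    (hH : 0 ≤ H) (hx : x ∈ Set.Icc lo hi) (hb : ∀ i, i ≠ o → i ≠ j → |b i| ≤ H) (hF : |lin b φ1 x| ≤ H) :
    ∀ i, i ≠ o → |b i| ≤ B * (1 + m * B) * H := by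
  have hB := h.hB
  have hm0 : (0:ℝ) ≤ m := by positivity
  intro i hio
  by_cases hij : i = j
  · subst hij
    have e : b i * φ1 i x = lin b φ1 x - ∑ i' ∈ Finset.univ.erase i, b i' * φ1 i' x := by
      rw [lin, ← Finset.add_sum_erase _ _ (Finset.mem_univ i)]; ring
    have e2 : |∑ i' ∈ Finset.univ.erase i, b i' * φ1 i' x| ≤ m * (H * B) := by
      refine (Finset.abs_sum_le_sum_abs _ _).trans ?_
      refine (Finset.sum_le_card_nsmul _ _ (H*B) fun i' hi' => ?_).trans ?_
      · rw [abs_mul]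
        by_cases e : i' = o
        · rw [e, h.fs.one1, abs_zero, mul_zero]; positivity
        · exact mul_le_mul (hb i' e (Finset.ne_of_mem_erase hi')) (h.b1 i' x hx) (abs_nonneg _) hH
      · rw [nsmul_eq_mul]
        have : ((Finset.univ.erase i).card : ℝ) ≤ m := by
          exact_mod_cast ((Finset.card_le_univ _).trans hm)
        gcongr
    have e3 : |b i| * |φ1 i x| ≤ H + m * (H * B) := by
      rw [← abs_mul, e]
      exact (abs_sub _ _).trans (add_le_add hF e2)
    have e4 := h.low x hx
    have : |b i| * 1 ≤ |b i| * (B * |φ1 i x|) := mul_le_mul_of_nonneg_left e4 (abs_nonneg _)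
    have e5 : B * (|b i| * |φ1 i x|) ≤ B * (H + m * (H * B)) := mul_le_mul_of_nonneg_left e3 (by linarith)
    nlinarith
  · refine (hb i hio hij).trans ?_
    have : 1 ≤ B * (1 + m * B) := by
      have : 1 ≤ 1 + m * B := by nlinarith
      nlinarith
    nlinarith

lemma Sys.F2 (h : Sys o j r ϖ C B lo hi φ φ1 φ2) {m : ℕ} (hm : Fintype.card ι ≤ m) {b : ι → ℝ} {H x : ℝ}
    (hH : 0 ≤ H) (hx : x ∈ Set.Icc lo hi) (hb : ∀ i, i ≠ o → i ≠ j → |b i| ≤ H) (hF : |lin b φ1 x| ≤ H)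
    {z : ℝ} (hz : z ∈ Set.Icc lo hi) : |lin b φ2 z| ≤ C1 m B * H := by
  have hB := h.hB
  have h1 := h.coef hm hH hx hb hF
  have hm0 : (0:ℝ) ≤ m := by positivity
  rw [lin]
  refine (Finset.abs_sum_le_sum_abs _ _).trans ?_
  refine (Finset.sum_le_card_nsmul _ _ (B * (1 + m * B) * H * B) fun i' hi' => ?_).trans ?_
  · rw [abs_mul]
    by_cases e : i' = o
    · rw [e, h.fs.one2, abs_zero, mul_zero]; positivity
    · exact mul_le_mul (h1 i' e) (h.b2 i' z hz) (abs_nonneg _) (by positivity)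
  · rw [nsmul_eq_mul, Finset.card_univ]
    have : (Fintype.card ι : ℝ) ≤ m := by exact_mod_cast hm
    calc _ ≤ m * (B * (1 + m * B) * H * B) := by gcongr
      _ = _ := by unfold C1; ring

lemma Sys.persist (h : Sys o j r ϖ C B lo hi φ φ1 φ2) {m : ℕ} (hm : Fintype.card ι ≤ m) {s t τ x y lo' hi' : ℝ}
    (hτ0 : 0 ≤ τ) (hτ : τ ≤ t)
    (hlo : lo ≤ lo') (hhi : hi' ≤ hi) (hlen : hi' - lo' = (hi - lo) * Real.exp (-((1 + r j) * t)))
    (hx : x ∈ Set.Icc lo' hi') (hy : y ∈ Set.Icc lo' hi') {a : ι → ℤ} (ha : Box o j r φ φ1 1 s t τ x a) :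
    Box o j r φ φ1 (2 + C1 m B) s t τ y a := by
  have hB := h.hB
  have hC1 : 0 ≤ C1 m B := by unfold C1; positivity
  have hγ : 0 < r j := h.wpos.trans_le h.rj
  have hsub : Set.Icc lo' hi' ⊆ Set.Icc lo hi := Set.Icc_subset_Icc hlo hhi
  obtain ⟨ha0, ha⟩ := ha
  set E := Real.exp (s * τ) with hE
  have hE0 : 0 < E := Real.exp_pos _
  have bd : ∀ i, |co o j φ φ1 (toR a) x i| ≤ Real.exp (- ex o j r t τ i) * E := by
    intro i
    have := ha i
    rw [one_mul, wt, ← le_div_iff₀' (Real.exp_pos _)] at this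
    rw [Real.exp_neg, inv_mul_eq_div]; exact this
  have bo : |lin (toR a) φ x| ≤ Real.exp (-(t + τ)) * E := by simpa [co, ex] using bd o
  have bj : |lin (toR a) φ1 x| ≤ Real.exp (-(τ - r j * t)) * E := by simpa [co, ex, h.oj.symm] using bd j
  set H := Real.exp (r j * (t + τ)) * E with hH
  have hH0 : 0 ≤ H := by positivity
  have bi : ∀ i, i ≠ o → i ≠ j → |toR a i| ≤ H := by
    intro i hio hij
    have := bd i
    simp only [co, ex, hio, hij, if_false, neg_neg] at this
    refine this.trans ?_
    rw [hH]
    have := h.rle i hio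
    have : 0 ≤ t + τ := by linarith
    gcongr
  have bj' : |lin (toR a) φ1 x| ≤ H := by
    refine bj.trans ?_
    rw [hH]
    gcongr
    have : 0 ≤ r j * τ := by positivity
    nlinarith
  have b2 : ∀ z ∈ Set.Icc lo' hi', |lin (toR a) φ2 z| ≤ C1 m B * H := fun z hz =>
    h.F2 hm hH0 (hsub hx) bi bj' (hsub hz)
  have hL1 : hi' - lo' ≤ Real.exp (-((1 + r j) * t)) := by
    rw [hlen]; exact mul_le_of_le_one_left (Real.exp_pos _).le h.len
  have dist : ∀ y ∈ Set.Icc lo' hi', |y - x| ≤ Real.exp (-((1 + r j) * t)) := by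
    intro y hy
    refine le_trans ?_ hL1
    rw [abs_le]; constructor <;> linarith [hx.1, hx.2, hy.1, hy.2]
  set Q := Real.exp (-(τ - r j * t)) * E with hQ
  have c1 : ∀ y ∈ Set.Icc lo' hi', |lin (toR a) φ1 y| ≤ (1 + C1 m B) * Q := by
    intro y hy
    have e1 := abs_sub_le_of_deriv (g := lin (toR a) φ1) (g' := lin (toR a) φ2)
      (fun z hz => h.fs.hd1 _ (hsub hz)) b2 hy hx
    have e2 : C1 m B * H * |y - x| ≤ C1 m B * Q := by
      rw [mul_assoc]
      refine mul_le_mul_of_nonneg_left ?_ hC1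
      calc _ ≤ H * Real.exp (-((1 + r j) * t)) := mul_le_mul_of_nonneg_left (dist y hy) hH0
        _ = Real.exp (r j * (t + τ) + (-((1 + r j) * t))) * E := by rw [hH, Real.exp_add]; ring
        _ ≤ Q := by
          rw [hQ]
          gcongr
          nlinarith
    have := abs_sub_abs_le_abs_sub (lin (toR a) φ1 y) (lin (toR a) φ1 x)
    linarith
  have c0 : |lin (toR a) φ y| ≤ (2 + C1 m B) * (Real.exp (-(t + τ)) * E) := by
    have e1 := abs_sub_le_of_deriv (g := lin (toR a) φ) (g' := lin (toR a) φ1)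
      (fun z hz => h.fs.hd0 _ (hsub hz)) c1 hy hx
    have e2 : (1 + C1 m B) * Q * |y - x| ≤ (1 + C1 m B) * (Real.exp (-(t + τ)) * E) := by
      rw [mul_assoc]
      refine mul_le_mul_of_nonneg_left ?_ (by linarith)
      calc _ ≤ Q * Real.exp (-((1 + r j) * t)) := mul_le_mul_of_nonneg_left (dist y hy) (by positivity)
        _ = Real.exp (-(τ - r j * t) + (-((1 + r j) * t))) * E := by rw [hQ, Real.exp_add]; ring
        _ = _ := by ring_nf
    have := abs_sub_abs_le_abs_sub (lin (toR a) φ y) (lin (toR a) φ x)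
    linarith
  refine ⟨ha0, fun i => ?_⟩
  rw [wt, ← le_div_iff₀' (Real.exp_pos _), mul_div_assoc, div_eq_mul_inv, ← Real.exp_neg, mul_comm (Real.exp _)]
  have hpos : 0 ≤ Real.exp (-ex o j r t τ i) * E := by positivity
  by_cases hio : i = o
  · subst hio; simpa [co, ex] using c0
  · by_cases hij : i = j
    · subst hij
      have := c1 y hy
      simp only [co, ex, hio, if_false, if_true]
      refine this.trans ?_
      rw [hQ]
      have : 0 ≤ Real.exp (-(τ - r i * t)) * E := by positivity
      nlinarith
    · have := bd i
      simp only [co, hio, hij, if_false] at this ⊢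
      refine this.trans ?_
      nlinarith

end
end BB

set_option linter.unusedVariables false
set_option linter.unusedSectionVars false
open MeasureTheory ENNReal

namespace BB

/-- abstract removal strategy on the dyadic tree -/
structure Strat (ρ δ : ℝ) (k0 : ℕ) (Z : ℕ → ℕ → Set ℕ) (h : ℕ → ℕ → ℝ) : Prop where
  nonneg : ∀ p' p, 0 ≤ h p' p
  empty : ∀ p' p, p < k0 → Z p' p = ∅
  count : ∀ p' p, p' < p → ∀ i', i' < 2 ^ p' → (∀ p'', p'' < p' → i' ∉ Z p'' p') →
    ∀ R : Finset ℕ, (∀ i ∈ R, i ∈ Z p' p ∧ i / 2 ^ (p - p') = i') → (R.card : ℝ) ≤ h p' p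
  cost : ∀ p, ∑ p' ∈ Finset.range p, h p' p * (ρ ^ (p - 1 - p'))⁻¹ ≤ δ

/-- ancestor level -/
def anc (p q : ℕ) : ℕ := if 3 * q ≤ p then p - q else 0

section
variable {ι : Type} [Fintype ι] [DecidableEq ι]
variable {o j : ι} {r : ι → ℝ} {ϖ C B lo hi : ℝ} {φ φ1 φ2 : ι → ℝ → ℝ}

/-- interval meets the dangerous set -/
def Meets (o j : ι) (r : ι → ℝ) (φ φ1 : ι → ℝ → ℝ) (lo hi s d : ℝ) (p q i : ℕ) : Prop :=
  ∃ x ∈ J lo (hi - lo) p i, ∃ a, Box o j r φ φ1 1 s (p * d) (q * d) x a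

/-- first removal strategy -/
def Z1 (o j : ι) (r : ι → ℝ) (φ φ1 : ι → ℝ → ℝ) (lo hi s d : ℝ) (q0 p' p : ℕ) : Set ℕ :=
  {i | i < 2 ^ p ∧ ∃ q, q0 ≤ q ∧ q ≤ p ∧ p' = anc p q ∧ Meets o j r φ φ1 lo hi s d p q i}

lemma exp_d {γ : ℝ} (hγ : 0 ≤ γ) (p : ℕ) :
    Real.exp (-((1 + γ) * (p * (Real.log 2 / (1 + γ))))) = (2 ^ p)⁻¹ := by
  have : (1 + γ) * (p * (Real.log 2 / (1 + γ))) = p * Real.log 2 := by field_simp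
  rw [this, Real.exp_neg, Real.exp_nat_mul, Real.exp_log (by norm_num)]

lemma not_meets {q0 p' q i' : ℕ} {s d : ℝ} (hq0 : 1 ≤ q0) (hi' : i' < 2 ^ p')
    (hal : ∀ p'', p'' < p' → i' ∉ Z1 o j r φ φ1 lo hi s d q0 p'' p') (h1 : q0 ≤ q) (h2 : q ≤ p') :
    ¬ Meets o j r φ φ1 lo hi s d p' q i' := by
  intro hM
  refine hal (anc p' q) ?_ ⟨hi', q, h1, h2, rfl, hM⟩
  unfold anc; split_ifs <;> omega

lemma count1 (C : ℝ) (hC : 1 ≤ C) (m : ℕ) : ∃ K α : ℝ, 0 < K ∧ 0 < α ∧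
    ∀ {ι : Type} [Fintype ι] [DecidableEq ι], Fintype.card ι ≤ m →
    ∀ {o j : ι} {r : ι → ℝ} {ϖ B lo hi : ℝ} {φ φ1 φ2 : ι → ℝ → ℝ}, Sys o j r ϖ C B lo hi φ φ1 φ2 →
    ∀ {s d : ℝ}, s = ϖ / (2 * m) → d = Real.log 2 / (1 + r j) →
    ∀ {q0 : ℕ}, 1 ≤ q0 → (∀ q : ℕ, q0 ≤ q → 2 * B ≤ Real.exp (ϖ * (q * d) / 4) ∧
      2 * m * (m * (C * B)) * Real.exp ((1 + s) * d) ≤ Real.exp (s * (q * d) / 2)) →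
    ∀ {p q i' : ℕ}, q0 ≤ q → q ≤ p → i' < 2 ^ anc p q →
    (∀ p'', p'' < anc p q → i' ∉ Z1 o j r φ φ1 lo hi s d q0 p'' (anc p q)) →
    ∀ R : Finset ℕ, (∀ i ∈ R, Meets o j r φ φ1 lo hi s d p q i ∧ i / 2 ^ (p - anc p q) = i') →
    (R.card : ℝ) ≤ K * (2 + C1 m B) ^ α * Real.exp (-(α * s / 4 * Real.log 2)) ^ q * 2 ^ (p - anc p q) := by
  obtain ⟨K, α, hK, hα, H⟩ := meas C hC m
  refine ⟨K, α, hK, hα, ?_⟩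
  intro ι _ _ hm o j r ϖ B lo hi φ φ1 φ2 h s d hs hd q0 hq0 hbig p q i' hq hqp hi' hal R hR
  set p' := anc p q with hp'
  have hp'p : p' ≤ p := by rw [hp']; unfold anc; split_ifs <;> omega
  have hB := h.hB
  have hγ : 0 < r j := h.wpos.trans_le h.rj
  have hlog : 0 < Real.log 2 := Real.log_pos (by norm_num)
  have hd0 : 0 < d := by rw [hd]; positivity
  have hL : 0 < hi - lo := by linarith [h.lohi]
  have hC1 : 0 ≤ C1 m B := by unfold C1; positivity
  set κ := 2 + C1 m B with hκ
  have hκ0 : 0 < κ := by linarith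
  have hsub := J_sub_root (lo := lo) hL.le hi'
  rw [show lo + (hi - lo) = hi by ring] at hsub
  set lo' := lo + i' * ((hi - lo) / 2 ^ p') with hlo'
  set hi'' := lo + (i' + 1) * ((hi - lo) / 2 ^ p') with hhi'
  have hJ : J lo (hi - lo) p' i' = Set.Icc lo' hi'' := rfl
  have hlen : hi'' - lo' = (hi - lo) / 2^p' := by rw [hhi', hlo']; ring
  have hlt : lo' < hi'' := by
    have : 0 < (hi - lo) / 2^p' := by positivity
    linarith
  have e1 : lo ≤ lo' := (hsub ⟨le_rfl, hlt.le⟩).1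
  have e2 : hi'' ≤ hi := (hsub ⟨hlt.le, le_rfl⟩).2
  have hmq : (0:ℝ) ≤ q * d := by positivity
  have hs0 : 0 ≤ s := by rw [hs]; have := h.wpos; positivity
  have hvol := H hm h (s := s) (t := p * d) (τ := q * d) hκ0 e1 hlt e2 (by
    intro k hk A hA
    by_cases h3 : 3 * q ≤ p
    · have ep : p' = p - q := by rw [hp', anc, if_pos h3]
      have et : (p':ℝ) * d + q * d = p * d := by
        rw [ep, Nat.cast_sub hqp]; ring
      rw [← et]
      refine h.LB_loc hm hs hd0 (by positivity) (hbig q hq).1 (hbig q hq).2 e1 e2 ?_ ?_ hk A hA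
      · rw [hd, exp_d hγ.le, hlen]; rfl
      · intro q'' h1 h2 a ha
        exact not_meets hq0 hi' hal (hq.trans h1) (by omega) ⟨lo', ⟨le_rfl, hlt.le⟩, a, ha⟩
    · have ep : p' = 0 := by rw [hp', anc, if_neg h3]
      have ei : i' = 0 := by rw [ep] at hi'; simpa using hi'
      have e1' : lo' = lo := by rw [hlo', ei]; simp
      have e2' : hi'' = hi := by rw [hhi', ei, ep]; simp
      rw [e1', e2']
      exact h.LB_glob hm hs (by positivity) hmq (hbig q hq).1 hk A hA)
  have key := count_vol (lo := lo) (V := K * (κ * Real.exp (-(s * (q * d) / 2))) ^ α * 2 ^ (p - p')) hL (p := p) R _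
    (by positivity) (fun i hiR y hy => ?_) (hvol.trans (le_of_eq ?_))
  · refine key.trans ?_
    rw [Real.mul_rpow hκ0.le (Real.exp_pos _).le, ← mul_assoc]
    gcongr
    rw [← Real.exp_mul, ← Real.exp_nat_mul]
    refine Real.exp_le_exp.2 ?_
    have hd2 : Real.log 2 / 2 ≤ d := by
      rw [hd]; gcongr; linarith [h.rj1]
    have : (s * q * α / 2) * (Real.log 2 / 2) ≤ (s * q * α / 2) * d := by gcongr
    nlinarith
  · obtain ⟨⟨x, hx, a, ha⟩, hdiv⟩ := hR i hiR
    have hJJ := J_sub (lo := lo) hL.le (i := i) hp'p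
    rw [hdiv, hJ] at hJJ
    refine ⟨⟨a, ?_⟩, hJJ hy⟩
    have hsm : lo + i * ((hi - lo)/2^p) ≤ lo + (i+1) * ((hi - lo)/2^p) := by
      have : 0 < (hi - lo) / 2^p := by positivity
      linarith
    have f1 := hJJ ⟨le_rfl, hsm⟩
    have f2 := hJJ ⟨hsm, le_rfl⟩
    refine h.persist hm hmq (by gcongr) (e1.trans f1.1) (f2.2.trans e2) ?_ hx hy ha
    rw [hd, exp_d hγ.le]
    ring
  · rw [hlen]
    congr 1
    have : (2:ℝ)^p = 2^p' * 2^(p-p') := by rw [← pow_add]; congr 1; omega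
    rw [this]
    field_simp

lemma strat1 (C : ℝ) (hC : 1 ≤ C) (m : ℕ) : ∃ α : ℝ, 0 < α ∧
    ∀ {ι : Type} [Fintype ι] [DecidableEq ι], Fintype.card ι ≤ m →
    ∀ {o j : ι} {r : ι → ℝ} {ϖ B lo hi : ℝ} {φ φ1 φ2 : ι → ℝ → ℝ}, Sys o j r ϖ C B lo hi φ φ1 φ2 →
    ∀ {s d ρ : ℝ}, 0 < s → s = ϖ / (2 * m) → d = Real.log 2 / (1 + r j) → 0 < ρ → ρ ≤ 2 →
      Real.exp (-(α * s / 4 * Real.log 2)) * (2 / ρ) ^ 3 < 1 →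
    ∀ δ : ℝ, 0 < δ → ∀ k0 : ℕ, ∃ q0 h1, 1 ≤ q0 ∧ k0 ≤ q0 ∧ Strat ρ δ k0 (Z1 o j r φ φ1 lo hi s d q0) h1 := by
  obtain ⟨K, α, hK, hα, H⟩ := count1 C hC m
  refine ⟨α, hα, ?_⟩
  intro ι _ _ hm o j r ϖ B lo hi φ φ1 φ2 h s d ρ hs0 hs hd hρ0 hρ2 hθ δ hδ k0
  set θ := Real.exp (-(α * s / 4 * Real.log 2)) with hθd
  have hθ0 : 0 < θ := Real.exp_pos _
  set Θ := θ * (2/ρ)^3 with hΘ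
  have hΘ0 : 0 < Θ := by positivity
  have hB := h.hB
  have hγ : 0 < r j := h.wpos.trans_le h.rj
  have hlog : 0 < Real.log 2 := Real.log_pos (by norm_num)
  have hd0 : 0 < d := by rw [hd]; positivity
  have hC1 : 0 ≤ C1 m B := by unfold C1; positivity
  set K' := K * (2 + C1 m B)^α with hK'
  have hK'0 : 0 < K' := by positivity
  have hw := h.wpos
  have t1 : Filter.Tendsto (fun q : ℕ => Real.exp (ϖ * (q * d) / 4)) Filter.atTop Filter.atTop := by
    refine Real.tendsto_exp_atTop.comp ?_
    have : (fun q : ℕ => ϖ * (q * d) / 4) = fun q : ℕ => (ϖ * d / 4) * (q:ℝ) := by ext; ring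
    rw [this]
    exact tendsto_natCast_atTop_atTop.const_mul_atTop (by positivity)
  have t2 : Filter.Tendsto (fun q : ℕ => Real.exp (s * (q * d) / 2)) Filter.atTop Filter.atTop := by
    refine Real.tendsto_exp_atTop.comp ?_
    have : (fun q : ℕ => s * (q * d) / 2) = fun q : ℕ => (s * d / 2) * (q:ℝ) := by ext; ring
    rw [this]
    exact tendsto_natCast_atTop_atTop.const_mul_atTop (by positivity)
  have t3 : Filter.Tendsto (fun q : ℕ => 2 * K' * (Θ ^ q * (1 - Θ)⁻¹)) Filter.atTop (nhds (2 * K' * (0 * (1 - Θ)⁻¹))) :=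
    ((tendsto_pow_atTop_nhds_zero_of_lt_one hΘ0.le hθ).mul_const _).const_mul _
  rw [zero_mul, mul_zero] at t3
  obtain ⟨q1, hq1⟩ := Filter.eventually_atTop.1 ((t1.eventually_ge_atTop (2 * B)).and
    ((t2.eventually_ge_atTop (2 * m * (m * (C * B)) * Real.exp ((1 + s) * d))).and (t3.eventually (gt_mem_nhds hδ))))
  set q0 := max q1 (max 1 k0) with hq0
  have hq01 : 1 ≤ q0 := by omega
  have hbig : ∀ q : ℕ, q0 ≤ q → 2 * B ≤ Real.exp (ϖ * (q * d) / 4) ∧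
      2 * m * (m * (C * B)) * Real.exp ((1 + s) * d) ≤ Real.exp (s * (q * d) / 2) := by
    intro q hq
    have := hq1 q (by omega)
    exact ⟨this.1, this.2.1⟩
  refine ⟨q0, fun p' p => ∑ q ∈ Finset.Icc q0 p, if p' = anc p q then K' * θ^q * 2^(p - anc p q) else 0, hq01,
    by omega, ?_, ?_, ?_, ?_⟩
  · intro p' p
    refine Finset.sum_nonneg fun q _ => ?_
    split_ifs <;> positivity
  · intro p' p hp
    ext i
    simp only [Set.mem_empty_iff_false, iff_false]
    rintro ⟨_, q, h1, h2, _⟩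
    omega
  · intro p' p hp i' hi' hal R hR
    classical
    set Rq : ℕ → Finset ℕ := fun q => if p' = anc p q then R.filter (fun i => Meets o j r φ φ1 lo hi s d p q i) else ∅ with hRq
    have hsubs : R ⊆ (Finset.Icc q0 p).biUnion Rq := by
      intro i hi
      obtain ⟨⟨_, q, h1, h2, h3, h4⟩, _⟩ := hR i hi
      rw [Finset.mem_biUnion]
      refine ⟨q, Finset.mem_Icc.2 ⟨h1, h2⟩, ?_⟩
      simp only [hRq, if_pos h3, Finset.mem_filter]
      exact ⟨hi, h4⟩
    have hc := (Finset.card_le_card hsubs).trans Finset.card_biUnion_le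
    have hc' : (R.card : ℝ) ≤ ∑ q ∈ Finset.Icc q0 p, ((Rq q).card : ℝ) := by exact_mod_cast hc
    refine hc'.trans (Finset.sum_le_sum fun q hq => ?_)
    rw [Finset.mem_Icc] at hq
    simp only [hRq]
    split_ifs with e
    · subst e
      refine H hm h hs hd hq01 hbig hq.1 hq.2 hi' hal _ fun i hi => ?_
      rw [Finset.mem_filter] at hi
      exact ⟨hi.2, (hR i hi.1).2⟩
    · simp
  · intro p
    simp only [Finset.sum_mul]
    rw [Finset.sum_comm]
    have hρ1 : 1 ≤ 2 / ρ := by rw [le_div_iff₀ hρ0]; linarith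
    have step : ∀ q ∈ Finset.Icc q0 p, ∑ p' ∈ Finset.range p,
        (if p' = anc p q then K' * θ^q * 2^(p - anc p q) else 0) * (ρ ^ (p - 1 - p'))⁻¹ ≤ 2 * K' * Θ^q := by
      intro q hq
      rw [Finset.mem_Icc] at hq
      simp only [ite_mul, zero_mul]
      rw [Finset.sum_ite_eq']
      split_ifs with e
      · rw [Finset.mem_range] at e
        set b := p - anc p q with hb
        have hb3 : b ≤ 3 * q := by rw [hb]; unfold anc; split_ifs <;> omega
        have hb1 : p - 1 - anc p q = b - 1 := by omega
        have hbb : b = (b - 1) + 1 := by omega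
        rw [hb1]
        have : (2:ℝ)^b * (ρ^(b-1))⁻¹ = ρ * (2/ρ)^b := by
          generalize b - 1 = b' at hbb
          rw [hbb, div_pow, pow_succ ρ]
          field_simp
        calc _ = K' * θ^q * (ρ * (2/ρ)^b) := by rw [← this]; ring
          _ ≤ K' * θ^q * (2 * (2/ρ)^(3*q)) := by
              gcongr
          _ = _ := by rw [hΘ, mul_pow, ← pow_mul]; ring
      · positivity
    refine (Finset.sum_le_sum step).trans ?_
    rw [← Finset.mul_sum]
    have g1 : ∑ q ∈ Finset.Icc q0 p, Θ^q ≤ Θ^q0 * (1 - Θ)⁻¹ := by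
      have hs := (summable_geometric_of_lt_one hΘ0.le hθ)
      have : Finset.Icc q0 p = Finset.Ico q0 (p+1) := by ext; simp
      rw [this, Finset.sum_Ico_eq_sum_range, ← tsum_geometric_of_lt_one hΘ0.le hθ]
      simp only [pow_add]
      rw [← Finset.mul_sum]
      gcongr
      exact hs.sum_le_tsum _ (fun _ _ => by positivity)
    exact (mul_le_mul_of_nonneg_left g1 (by positivity)).trans (hq1 q0 (by omega)).2.2.le

end
end BB

set_option linter.unusedVariables false
set_option linter.unusedSectionVars false
open MeasureTheory ENNReal

namespace BB

lemma lower_of_deriv {g g' : ℝ → ℝ} {u v l : ℝ} (hd : ∀ x ∈ Set.Icc u v, HasDerivAt g (g' x) x)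
    (hl : ∀ x ∈ Set.Icc u v, l ≤ |g' x|) {x y : ℝ} (hx : x ∈ Set.Icc u v) (hy : y ∈ Set.Icc u v) :
    l * |x - y| ≤ |g x - g y| := by
  have key : ∀ x y, x ∈ Set.Icc u v → y ∈ Set.Icc u v → x < y → l * |x - y| ≤ |g x - g y| := by
    intro x y hx hy hxy
    have hsub : ∀ z, z ∈ Set.Icc x y → z ∈ Set.Icc u v := fun z hz => ⟨hx.1.trans hz.1, hz.2.trans hy.2⟩
    obtain ⟨ξ, hξ, e⟩ := exists_hasDerivAt_eq_slope g g' hxy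
      (fun z hz => (hd z (hsub z hz)).continuousAt.continuousWithinAt)
      (fun z hz => hd z (hsub z (Set.Ioo_subset_Icc_self hz)))
    have h1 : 0 < y - x := by linarith
    rw [eq_div_iff h1.ne'] at e
    rw [abs_sub_comm (g x), ← e, abs_mul, abs_sub_comm x]
    exact mul_le_mul_of_nonneg_right (hl ξ (hsub ξ (Set.Ioo_subset_Icc_self hξ))) (abs_nonneg _)
  rcases lt_trichotomy x y with e | e | e
  · exact key x y hx hy e
  · subst e; simp
  · have := key y x hy hx e
    rwa [abs_sub_comm x, abs_sub_comm (g x)]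

section
variable {ι : Type} [Fintype ι] [DecidableEq ι]
variable {o j : ι} {r : ι → ℝ} {ϖ C B lo hi : ℝ} {φ φ1 φ2 : ι → ℝ → ℝ}

lemma lin_le {m : ℕ} (hm : Fintype.card ι ≤ m) {b : ι → ℝ} {ψ : ι → ℝ → ℝ} {x H B : ℝ} (hH : 0 ≤ H) (hB : 0 ≤ B)
    (ho : ψ o x = 0) (hψ : ∀ i, |ψ i x| ≤ B) (hb : ∀ i, i ≠ o → |b i| ≤ H) : |lin b ψ x| ≤ m * B * H := by
  rw [lin]
  refine (Finset.abs_sum_le_sum_abs _ _).trans ?_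
  refine (Finset.sum_le_card_nsmul _ _ (H * B) fun i' hi' => ?_).trans ?_
  · rw [abs_mul]
    by_cases e : i' = o
    · rw [e, ho, abs_zero, mul_zero]; positivity
    · exact mul_le_mul (hb i' e) (hψ i') (abs_nonneg _) hH
  · rw [nsmul_eq_mul, Finset.card_univ]
    have : (Fintype.card ι : ℝ) ≤ m := by exact_mod_cast hm
    calc _ ≤ m * (H * B) := by gcongr
      _ = _ := by ring

/-- generic vectors -/
def Gen (o : ι) (r : ι → ℝ) (φ : ι → ℝ → ℝ) (c t x : ℝ) (a : ι → ℤ) : Prop :=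
  a ≠ 0 ∧ (∀ i, i ≠ o → |toR a i| ≤ Real.exp (r i * t)) ∧ |lin (toR a) φ x| ≤ c * Real.exp (-t)

lemma co_sub (a a' : ι → ℤ) (x : ℝ) (i : ι) :
    co o j φ φ1 (toR (a - a')) x i = co o j φ φ1 (toR a) x i - co o j φ φ1 (toR a') x i := by
  have : toR (a - a') = toR a - toR a' := by ext; simp [toR]
  rw [this]
  unfold co
  split_ifs
  · simp [lin, sub_mul, Finset.sum_sub_distrib]
  · simp [lin, sub_mul, Finset.sum_sub_distrib]
  · rfl

lemma Sys.wt0 (h : Sys o j r ϖ C B lo hi φ φ1 φ2) {t τ : ℝ} (hτ : 0 ≤ τ) (i : ι) :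
    wt o j r t τ i ≤ Real.exp τ * wt o j r t 0 i := by
  unfold wt
  rw [← Real.exp_add]
  refine Real.exp_le_exp.2 ?_
  unfold ex
  split_ifs with e1 e2
  · linarith
  · linarith
  · have h4 : 0 ≤ r i := h.wpos.le.trans (h.rge i e1)
    nlinarith

lemma Sys.count2 (h : Sys o j r ϖ C B lo hi φ φ1 φ2) {m : ℕ} (hm : Fintype.card ι ≤ m) {s t τ c lo' hi' δ' : ℝ}
    (hs : 0 ≤ s) (ht : 0 ≤ t) (hτ : 0 ≤ τ) (hc : 0 < c) (hc1 : c ≤ 1)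
    (hlo : lo ≤ lo') (hhi : hi' ≤ hi) (hlen : hi' - lo' = (hi - lo) * Real.exp (-((1 + r j) * t)))
    (hal : ∀ x ∈ Set.Icc lo' hi', ∀ a, ¬ Box o j r φ φ1 1 s t τ x a)
    (hcτ : c * Real.exp τ ≤ 1) (hbig : 2 * (m * B) * Real.exp τ ≤ Real.exp t)
    (hδ : 4 * c * Real.exp τ * Real.exp (-((1 + r j) * t)) ≤ δ') :
    (∀ A : Finset (ι → ℤ), (∀ a ∈ A, ∃ x ∈ Set.Icc lo' hi', Gen o r φ c t x a) →
      A.card ≤ (2 * ⌈(1 + m * B) * Real.exp τ⌉₊ + 3) ^ m) ∧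
    (∀ a x y, x ∈ Set.Icc lo' hi' → y ∈ Set.Icc lo' hi' → Gen o r φ c t x a → Gen o r φ c t y a → |x - y| ≤ δ') := by
  have hB := h.hB
  have hγ : 0 < r j := h.wpos.trans_le h.rj
  have hm0 : (0:ℝ) ≤ m := by positivity
  have hsub : Set.Icc lo' hi' ⊆ Set.Icc lo hi := Set.Icc_subset_Icc hlo hhi
  have hlt : lo' < hi' := by
    have : 0 < (hi - lo) * Real.exp (-((1 + r j) * t)) := mul_pos (by linarith [h.lohi]) (Real.exp_pos _)
    linarith
  have hL1 : hi' - lo' ≤ Real.exp (-((1 + r j) * t)) := by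
    rw [hlen]; exact mul_le_of_le_one_left (Real.exp_pos _).le h.len
  have dist : ∀ x ∈ Set.Icc lo' hi', ∀ y ∈ Set.Icc lo' hi', |y - x| ≤ Real.exp (-((1 + r j) * t)) := by
    intro x hx y hy
    refine le_trans ?_ hL1
    rw [abs_le]; constructor <;> linarith [hx.1, hx.2, hy.1, hy.2]
  have hcoef : ∀ {x a}, Gen o r φ c t x a → ∀ i, i ≠ o → |toR a i| ≤ Real.exp (r j * t) := by
    intro x a ha i hi
    refine (ha.2.1 i hi).trans (Real.exp_le_exp.2 ?_)
    have := h.rle i hi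
    gcongr
  have hF1 : ∀ {x a}, Gen o r φ c t x a → ∀ y ∈ Set.Icc lo' hi', |lin (toR a) φ1 y| ≤ m * B * Real.exp (r j * t) :=
    fun ha y hy => lin_le hm (Real.exp_pos _).le (by linarith) (h.fs.one1 y) (fun i => h.b1 i y (hsub hy)) (hcoef ha)
  have hF2 : ∀ {x a}, Gen o r φ c t x a → ∀ y ∈ Set.Icc lo' hi', |lin (toR a) φ2 y| ≤ m * B * Real.exp (r j * t) :=
    fun ha y hy => lin_le hm (Real.exp_pos _).le (by linarith) (h.fs.one2 y) (fun i => h.b2 i y (hsub hy)) (hcoef ha)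
  constructor
  · intro A hA
    have hlo' : lo' ∈ Set.Icc lo' hi' := ⟨le_rfl, hlt.le⟩
    set G := 1 + m * B with hG
    set K := ⌈G * Real.exp τ⌉₊ with hK
    set z : (ι → ℤ) → ι → ℝ := fun a i => Real.exp τ * (wt o j r t 0 i * co o j φ φ1 (toR a) lo' i) with hz
    have hzb : ∀ a ∈ A, ∀ i, |z a i| ≤ G * Real.exp τ := by
      intro a ha i
      obtain ⟨x, hx, hg⟩ := hA a ha
      simp only [hz]
      rw [abs_mul, Real.abs_exp, mul_comm]
      refine mul_le_mul_of_nonneg_right ?_ (Real.exp_pos _).le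
      rw [abs_mul, abs_of_pos (wt_pos _ _ _ _ _ _), wt, ← le_div_iff₀' (Real.exp_pos _), div_eq_mul_inv,
        ← Real.exp_neg]
      by_cases hio : i = o
      · subst hio
        simp only [co, ex, if_true, add_zero]
        have e1 := abs_sub_le_of_deriv (g := lin (toR a) φ) (g' := lin (toR a) φ1)
          (fun z hz => h.fs.hd0 _ (hsub hz)) (hF1 hg) hlo' hx
        have e2 : m * B * Real.exp (r j * t) * |lo' - x| ≤ m * B * Real.exp (-t) := by
          calc _ ≤ m * B * Real.exp (r j * t) * Real.exp (-((1 + r j) * t)) := by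
                gcongr; exact dist x hx lo' hlo'
            _ = m * B * Real.exp (-t) := by rw [mul_assoc, ← Real.exp_add]; ring_nf
        have e3 := abs_sub_abs_le_abs_sub (lin (toR a) φ lo') (lin (toR a) φ x)
        have e4 := hg.2.2
        have : c * Real.exp (-t) ≤ 1 * Real.exp (-t) := by gcongr
        rw [hG]; linarith
      · by_cases hij : i = j
        · subst hij
          simp only [co, ex, hio, if_false, if_true, zero_sub, neg_neg]
          refine (hF1 hg lo' hlo').trans ?_
          gcongr
          rw [hG]; linarith
        · simp only [co, ex, hio, hij, if_false, add_zero, neg_neg]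
          refine (hg.2.1 i hio).trans ?_
          have : 1 ≤ G := by rw [hG]; nlinarith
          exact le_mul_of_one_le_left (Real.exp_pos _).le this
    have hinj : Set.InjOn (fun a i => ⌊z a i⌋) (A : Set (ι → ℤ)) := by
      intro a ha a' ha' e
      by_contra hne
      refine hal lo' hlo' (a - a') ⟨sub_ne_zero.2 hne, fun i => ?_⟩
      have e1 : ⌊z a i⌋ = ⌊z a' i⌋ := congrFun e i
      have e2 := (Int.abs_sub_lt_one_of_floor_eq_floor e1).le
      have e3 : |z a i - z a' i| = Real.exp τ * (wt o j r t 0 i * |co o j φ φ1 (toR (a - a')) lo' i|) := by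
        simp only [hz]
        rw [co_sub, ← mul_sub, ← mul_sub, abs_mul, abs_mul, Real.abs_exp, abs_of_pos (wt_pos _ _ _ _ _ _)]
      rw [e3, ← mul_assoc] at e2
      have e4 := mul_le_mul_of_nonneg_right (h.wt0 (t := t) hτ i) (abs_nonneg (co o j φ φ1 (toR (a - a')) lo' i))
      have e5 : 1 ≤ Real.exp (s * τ) := Real.one_le_exp (by positivity)
      linarith
    have hmaps : ∀ a ∈ A, (fun i => ⌊z a i⌋) ∈ Fintype.piFinset (fun _ : ι => Finset.Icc (-(K:ℤ) - 1) (K + 1)) := by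
      intro a ha
      rw [Fintype.mem_piFinset]
      intro i
      have h1 := abs_le.1 (hzb a ha i)
      have h2 : G * Real.exp τ ≤ K := Nat.le_ceil _
      rw [Finset.mem_Icc]
      constructor
      · rw [Int.le_floor]; push_cast; linarith
      · have : (⌊z a i⌋ : ℝ) ≤ K := (Int.floor_le _).trans (h1.2.trans h2)
        have : ⌊z a i⌋ ≤ (K:ℤ) := by exact_mod_cast this
        omega
    have hcard := Finset.card_le_card_of_injOn _ hmaps hinj
    refine hcard.trans ?_
    rw [Fintype.card_piFinset, Finset.prod_const, Finset.card_univ, Int.card_Icc]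
    have : (K + 1 + 1 - (-(K:ℤ) - 1)).toNat = 2 * K + 3 := by omega
    rw [this]
    exact Nat.pow_le_pow_right (by omega) hm
  · intro a x y hx hy hgx hgy
    have h1 : Real.exp (r j * t - τ) ≤ |lin (toR a) φ1 x| := by
      by_contra hcon
      push Not at hcon
      refine hal x hx a ⟨hgx.1, fun i => ?_⟩
      have e5 : 1 ≤ Real.exp (s * τ) := Real.one_le_exp (by positivity)
      refine le_trans ?_ (by linarith : (1:ℝ) ≤ 1 * Real.exp (s * τ))
      rw [wt, ← le_div_iff₀' (Real.exp_pos _), one_div, ← Real.exp_neg]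
      by_cases hio : i = o
      · subst hio
        simp only [co, ex, if_true]
        refine hgx.2.2.trans ?_
        have : Real.exp (-(t + τ)) = Real.exp (-t) * Real.exp (-τ) := by rw [← Real.exp_add]; ring_nf
        rw [this, mul_comm]
        gcongr
        rw [Real.exp_neg, ← one_div, le_div_iff₀ (Real.exp_pos _)]
        exact hcτ
      · by_cases hij : i = j
        · subst hij
          simp only [co, ex, hio, if_false, if_true]
          refine hcon.le.trans (le_of_eq ?_)
          ring_nf
        · simp only [co, ex, hio, hij, if_false, neg_neg]
          refine (hgx.2.1 i hio).trans (Real.exp_le_exp.2 ?_)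
          have h4 : 0 ≤ r i := h.wpos.le.trans (h.rge i hio)
          nlinarith
    have h2 : ∀ z ∈ Set.Icc lo' hi', Real.exp (r j * t - τ) / 2 ≤ |lin (toR a) φ1 z| := by
      intro z hz
      have e1 := abs_sub_le_of_deriv (g := lin (toR a) φ1) (g' := lin (toR a) φ2)
        (fun z hz => h.fs.hd1 _ (hsub hz)) (hF2 hgx) hx hz
      have e2 : m * B * Real.exp (r j * t) * |x - z| ≤ m * B * Real.exp (-t) := by
        calc _ ≤ m * B * Real.exp (r j * t) * Real.exp (-((1 + r j) * t)) := by
              gcongr; exact dist z hz x hx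
          _ = m * B * Real.exp (-t) := by rw [mul_assoc, ← Real.exp_add]; ring_nf
      have e3 := abs_sub_abs_le_abs_sub (lin (toR a) φ1 x) (lin (toR a) φ1 z)
      have e4 : 2 * (m * B * Real.exp (-t)) ≤ Real.exp (r j * t - τ) := by
        have f1 : Real.exp (-t) * Real.exp t = 1 := by rw [← Real.exp_add]; simp
        have f2 : Real.exp (-τ) * Real.exp τ = 1 := by rw [← Real.exp_add]; simp
        have f3 := mul_le_mul_of_nonneg_left hbig (mul_pos (Real.exp_pos (-t)) (Real.exp_pos (-τ))).le
        have f4 : Real.exp (-τ) ≤ Real.exp (r j * t - τ) := Real.exp_le_exp.2 (by nlinarith)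
        calc _ = Real.exp (-t) * Real.exp (-τ) * (2 * (m * B) * Real.exp τ) := by
              linear_combination (- 2 * m * B * Real.exp (-t)) * f2
          _ ≤ _ := f3
          _ = Real.exp (-τ) := by linear_combination (Real.exp (-τ)) * f1
          _ ≤ _ := f4
      linarith
    have h3 := lower_of_deriv (g := lin (toR a) φ) (g' := lin (toR a) φ1) (fun z hz => h.fs.hd0 _ (hsub hz)) h2 hx hy
    have h4 : |lin (toR a) φ x - lin (toR a) φ y| ≤ 2 * c * Real.exp (-t) := by
      refine (abs_sub _ _).trans ?_
      linarith [hgx.2.2, hgy.2.2]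
    refine le_trans ?_ hδ
    have h5 : Real.exp (r j * t - τ) * |x - y| ≤ 4 * c * Real.exp (-t) := by linarith
    rw [← le_div_iff₀' (Real.exp_pos _), div_eq_mul_inv, ← Real.exp_neg] at h5
    refine h5.trans (le_of_eq ?_)
    have e1 : Real.exp (-t) * Real.exp (-(r j * t - τ)) = Real.exp τ * Real.exp (-((1 + r j) * t)) := by
      rw [← Real.exp_add, ← Real.exp_add]; ring_nf
    linear_combination (4 * c) * e1

/-- second removal strategy -/
def Z2 (o : ι) (r : ι → ℝ) (φ : ι → ℝ → ℝ) (lo hi c d : ℝ) (p1 M p' p : ℕ) : Set ℕ :=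
  {i | i < 2 ^ p ∧ p1 ≤ p' ∧ p = p' + M ∧ ∃ x ∈ J lo (hi - lo) p i, ∃ a, Gen o r φ c (p' * d) x a}

/-- dual form of bad approximability -/
def DualBad (o : ι) (r : ι → ℝ) (φ : ι → ℝ → ℝ) (d x : ℝ) : Prop :=
  ∃ c > 0, ∃ p1 : ℕ, ∀ p, p1 ≤ p → ∀ a, ¬ Gen o r φ c (p * d) x a

lemma card_close {R : Finset ℕ} (h : ∀ i ∈ R, ∀ k ∈ R, i ≤ k + 2) : R.card ≤ 3 := by
  rcases R.eq_empty_or_nonempty with e | e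
  · simp [e]
  · have h1 := R.min'_mem e
    have : R ⊆ Finset.Icc (R.min' e) (R.min' e + 2) := by
      intro i hi
      rw [Finset.mem_Icc]
      exact ⟨R.min'_le i hi, h i hi _ h1⟩
    refine (Finset.card_le_card this).trans ?_
    rw [Nat.card_Icc]; omega

lemma close_of_J {lo L : ℝ} (hL : 0 < L) {p i k : ℕ} {x y : ℝ} (hx : x ∈ J lo L p i) (hy : y ∈ J lo L p k)
    (hxy : |x - y| ≤ L / 2^p) : i ≤ k + 2 := by
  have hδ : 0 < L / 2^p := by positivity
  have h1 := (abs_le.1 hxy).2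
  have h2 : (i:ℝ) * (L/2^p) ≤ (k + 2) * (L/2^p) := by
    have := hx.1; have := hy.2; linarith
  have h3 := le_of_mul_le_mul_right h2 hδ
  exact_mod_cast h3

lemma strat2 (C : ℝ) (hC : 1 ≤ C) (m : ℕ) : ∃ α : ℝ, 0 < α ∧
    ∀ {ι : Type} [Fintype ι] [DecidableEq ι], Fintype.card ι ≤ m →
    ∀ {o j : ι} {r : ι → ℝ} {ϖ B lo hi : ℝ} {φ φ1 φ2 : ι → ℝ → ℝ}, Sys o j r ϖ C B lo hi φ φ1 φ2 →
    ∀ {s d ρ : ℝ}, 0 < s → s = ϖ / (2 * m) → d = Real.log 2 / (1 + r j) → 1 < ρ → ρ ≤ 2 →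
      Real.exp (-(α * s / 4 * Real.log 2)) * (2 / ρ) ^ 3 < 1 →
    ∀ δ : ℝ, 0 < δ → ∀ k0 : ℕ, ∃ Z h, Strat ρ δ k0 Z h ∧
      ∀ x, (∀ p, ∃ i, i < 2 ^ p ∧ x ∈ J lo (hi - lo) p i ∧ ∀ p' < p, i ∉ Z p' p) → DualBad o r φ d x := by
  obtain ⟨α, hα, H⟩ := strat1 C hC m
  refine ⟨α, hα, ?_⟩
  intro ι _ _ hm o j r ϖ B lo hi φ φ1 φ2 h s d ρ hs0 hs hd hρ1 hρ2 hθ δ hδ k0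
  obtain ⟨q0, h1, hq0, hk0, S1⟩ := H hm h hs0 hs hd (by linarith) hρ2 hθ (δ/2) (by positivity) k0
  have hB := h.hB
  have hγ : 0 < r j := h.wpos.trans_le h.rj
  have hlog : 0 < Real.log 2 := Real.log_pos (by norm_num)
  have hd0 : 0 < d := by rw [hd]; positivity
  have hL : 0 < hi - lo := by linarith [h.lohi]
  set τ := q0 * d with hτ
  have hτ0 : 0 ≤ τ := by positivity
  set N0 : ℕ := (2 * ⌈(1 + m * B) * Real.exp τ⌉₊ + 3) ^ m with hN0
  -- choose M
  have t1 : Filter.Tendsto (fun M : ℕ => (3 * N0 : ℝ) * (ρ⁻¹) ^ M) Filter.atTop (nhds ((3 * N0 : ℝ) * 0)) :=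
    (tendsto_pow_atTop_nhds_zero_of_lt_one (by positivity) (inv_lt_one_of_one_lt₀ hρ1)).const_mul _
  rw [mul_zero] at t1
  obtain ⟨M', hM'⟩ := (t1.eventually (gt_mem_nhds (half_pos hδ))).exists
  set M := M' + 1 with hM
  -- choose p1
  have t2 : Filter.Tendsto (fun p : ℕ => Real.exp (p * d)) Filter.atTop Filter.atTop :=
    Real.tendsto_exp_atTop.comp (tendsto_natCast_atTop_atTop.atTop_mul_const hd0)
  obtain ⟨p2, hp2⟩ := Filter.eventually_atTop.1 (t2.eventually_ge_atTop (2 * (m * B) * Real.exp τ))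
  set p1 := max p2 q0 with hp1
  -- choose c
  set c := min (Real.exp (-τ)) ((hi - lo) / (2 ^ M * 4 * Real.exp τ)) with hc
  have hc0 : 0 < c := by rw [hc]; refine lt_min (Real.exp_pos _) (by positivity)
  have hcτ : c * Real.exp τ ≤ 1 := by
    have : c ≤ Real.exp (-τ) := min_le_left _ _
    calc _ ≤ Real.exp (-τ) * Real.exp τ := by gcongr
      _ = 1 := by rw [← Real.exp_add]; simp
  have hc1 : c ≤ 1 := (min_le_left _ _).trans (Real.exp_le_one_iff.2 (by linarith))
  have hcM : 4 * c * Real.exp τ ≤ (hi - lo) / 2 ^ M := by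
    have : c ≤ (hi - lo) / (2 ^ M * 4 * Real.exp τ) := min_le_right _ _
    rw [le_div_iff₀ (by positivity)] at this
    rw [le_div_iff₀ (by positivity)]
    linarith
  set z1 := Z1 o j r φ φ1 lo hi s d q0 with hz1
  set z2 := Z2 o r φ lo hi c d p1 M with hz2
  refine ⟨fun p' p => z1 p' p ∪ z2 p' p, fun p' p => h1 p' p + (if p = p' + M then (3 * N0 : ℝ) else 0), ⟨?_, ?_, ?_, ?_⟩, ?_⟩
  · intro p' p
    have := S1.nonneg p' p
    split_ifs <;> positivity
  · intro p' p hp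
    rw [S1.empty p' p hp, Set.empty_union]
    ext i
    simp only [Set.mem_empty_iff_false, iff_false]
    rintro ⟨_, h3, h4, _⟩
    omega
  · intro p' p hp i' hi' hal R hR
    classical
    have hal1 : ∀ p'' < p', i' ∉ z1 p'' p' := fun p'' hp'' e => hal p'' hp'' (Or.inl e)
    have hsplit : R = R.filter (fun i => i ∈ z1 p' p) ∪ R.filter (fun i => i ∈ z2 p' p) := by
      ext i
      rw [Finset.mem_union, Finset.mem_filter, Finset.mem_filter]
      constructor
      · intro hi
        rcases (hR i hi).1 with e | e
        · exact Or.inl ⟨hi, e⟩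
        · exact Or.inr ⟨hi, e⟩
      · rintro (e | e) <;> exact e.1
    have hcardR : (R.card : ℝ) ≤ (R.filter (fun i => i ∈ z1 p' p)).card + (R.filter (fun i => i ∈ z2 p' p)).card := by
      have := Finset.card_union_le (R.filter (fun i => i ∈ z1 p' p)) (R.filter (fun i => i ∈ z2 p' p))
      rw [← hsplit] at this
      exact_mod_cast this
    refine hcardR.trans (add_le_add ?_ ?_)
    · refine S1.count p' p hp i' hi' hal1 _ fun i hi => ?_
      rw [Finset.mem_filter] at hi
      exact ⟨hi.2, (hR i hi.1).2⟩
    · set R2 := R.filter (fun i => i ∈ z2 p' p) with hR2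
      have hR2' : ∀ i ∈ R2, i ∈ z2 p' p ∧ i / 2 ^ (p - p') = i' := fun i hi => by
        rw [hR2, Finset.mem_filter] at hi
        exact ⟨hi.2, (hR i hi.1).2⟩
      split_ifs with hpM
      · by_cases hp1' : p1 ≤ p'
        · have hsub := J_sub_root (lo := lo) hL.le hi'
          rw [show lo + (hi - lo) = hi by ring] at hsub
          set lo' := lo + i' * ((hi - lo) / 2 ^ p') with hlo'
          set hi'' := lo + (i' + 1) * ((hi - lo) / 2 ^ p') with hhi'
          have hJ : J lo (hi - lo) p' i' = Set.Icc lo' hi'' := rfl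
          have hlen : hi'' - lo' = (hi - lo) / 2^p' := by rw [hhi', hlo']; ring
          have hlt : lo' < hi'' := by
            have : 0 < (hi - lo) / 2^p' := by positivity
            linarith
          have e1 : lo ≤ lo' := (hsub ⟨le_rfl, hlt.le⟩).1
          have e2 : hi'' ≤ hi := (hsub ⟨hlt.le, le_rfl⟩).2
          have hexp : Real.exp (-((1 + r j) * (p' * d))) = (2^p')⁻¹ := by rw [hd]; exact exp_d hγ.le p'
          obtain ⟨cA, cB⟩ := h.count2 hm (t := p' * d) (τ := τ) (δ' := (hi - lo) / 2^p) hs0.le (by positivity) hτ0 hc0 hc1 e1 e2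
            (by rw [hexp, hlen]; rfl)
            (fun x hx a ha => not_meets hq0 hi' hal1 le_rfl (by omega) ⟨x, hx, a, ha⟩) hcτ
            (hp2 p' (by omega)) (by
              rw [hexp, hpM, pow_add]
              calc _ ≤ (hi - lo) / 2 ^ M * (2 ^ p')⁻¹ := by gcongr
                _ = _ := by field_simp)
          have hch : ∀ i : ℕ, ∃ x a, i ∈ R2 → x ∈ J lo (hi - lo) p i ∧ Gen o r φ c (p' * d) x a := by
            intro i
            by_cases hi : i ∈ R2
            · obtain ⟨_, _, _, x, hx, a, ha⟩ := (hR2' i hi).1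
              exact ⟨x, a, fun _ => ⟨hx, ha⟩⟩
            · exact ⟨0, 0, fun e => absurd e hi⟩
          choose X A hXA using hch
          have hin : ∀ i ∈ R2, X i ∈ Set.Icc lo' hi'' := fun i hi => by
            have := J_sub (lo := lo) hL.le (i := i) hp.le (hXA i hi).1
            rwa [(hR2' i hi).2] at this
          have hA := cA (R2.image A) (fun a ha => by
            rw [Finset.mem_image] at ha
            obtain ⟨i, hi, rfl⟩ := ha
            exact ⟨X i, hin i hi, (hXA i hi).2⟩)
          have hfib := Finset.card_le_mul_card_image (f := A) R2 3 (fun a ha => by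
            refine card_close fun i hi k hk => ?_
            rw [Finset.mem_filter] at hi hk
            refine close_of_J hL (hXA i hi.1).1 (hXA k hk.1).1 ?_
            refine cB a _ _ (hin i hi.1) (hin k hk.1) ?_ ?_
            · rw [← hi.2]; exact (hXA i hi.1).2
            · rw [← hk.2]; exact (hXA k hk.1).2)
          have : R2.card ≤ 3 * N0 := hfib.trans (Nat.mul_le_mul_left 3 hA)
          exact_mod_cast this
        · have : R2 = ∅ := by
            ext i
            simp only [Finset.notMem_empty, iff_false]
            intro hi
            exact hp1' (hR2' i hi).1.2.1
          rw [this]; simp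
      · have : R2 = ∅ := by
          ext i
          simp only [Finset.notMem_empty, iff_false]
          intro hi
          exact hpM (hR2' i hi).1.2.2.1
        rw [this]; simp
  · intro p
    simp only [add_mul]
    rw [Finset.sum_add_distrib]
    have hh := S1.cost p
    have hh2 : ∑ p' ∈ Finset.range p, (if p = p' + M then (3 * N0 : ℝ) else 0) * (ρ ^ (p - 1 - p'))⁻¹ ≤ δ / 2 := by
      by_cases hpM : M ≤ p
      · rw [Finset.sum_eq_single (p - M)]
        · rw [if_pos (by omega), show p - 1 - (p - M) = M' by omega, ← inv_pow]
          exact hM'.le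
        · intro b _ hb
          rw [if_neg (by omega), zero_mul]
        · intro hb
          rw [Finset.mem_range] at hb
          omega
      · rw [Finset.sum_eq_zero]
        · positivity
        · intro b _
          rw [if_neg (by omega), zero_mul]
    linarith
  · intro x hx
    refine ⟨c, hc0, p1, fun p hp a ha => ?_⟩
    obtain ⟨i, hi, hxi, hZ⟩ := hx (p + M)
    exact hZ p (by omega) (Or.inr ⟨hi, hp, rfl, x, hxi, a, ha⟩)

end
end BB

set_option linter.unusedVariables false
set_option linter.unusedSectionVars false
open MeasureTheory ENNReal

namespace BB

open Classical in
/-- surviving dyadic intervals -/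
noncomputable def Surv (Z : ℕ → ℕ → Set ℕ) : ℕ → Finset ℕ
  | 0 => {0}
  | p + 1 => (Finset.range (2 ^ (p + 1))).filter (fun i => i / 2 ∈ Surv Z p ∧ ∀ p' < p + 1, i ∉ Z p' (p + 1))

lemma mem_Surv_succ {Z : ℕ → ℕ → Set ℕ} {p i : ℕ} :
    i ∈ Surv Z (p + 1) ↔ i < 2 ^ (p + 1) ∧ i / 2 ∈ Surv Z p ∧ ∀ p' < p + 1, i ∉ Z p' (p + 1) := by
  classical
  rw [Surv, Finset.mem_filter, Finset.mem_range]

lemma Surv_lt {Z : ℕ → ℕ → Set ℕ} : ∀ {p i : ℕ}, i ∈ Surv Z p → i < 2 ^ p ∧ ∀ p' < p, i ∉ Z p' p := by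
  intro p
  cases p with
  | zero => intro i hi; rw [Surv, Finset.mem_singleton] at hi; subst hi; simp
  | succ p => intro i hi; rw [mem_Surv_succ] at hi; exact ⟨hi.1, hi.2.2⟩

lemma Surv_anc {Z : ℕ → ℕ → Set ℕ} {p' : ℕ} : ∀ (e : ℕ) {i : ℕ}, i ∈ Surv Z (p' + e) → i / 2 ^ e ∈ Surv Z p' := by
  intro e
  induction e with
  | zero => intro i hi; simpa using hi
  | succ e ih =>
    intro i hi
    have := ih (mem_Surv_succ.1 hi).2.1
    rwa [Nat.div_div_eq_div_mul, ← pow_succ'] at this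

lemma Surv_growth {ρ : ℝ} {Z : ℕ → ℕ → Set ℕ} {h : ℕ → ℕ → ℝ} (hρ : 0 < ρ)
    (S : Strat ρ (2 - ρ) 0 Z h) : ∀ p, ρ * (Surv Z p).card ≤ (Surv Z (p+1)).card := by
  intro p
  induction p using Nat.strong_induction_on with
  | _ p ih =>
  classical
  have hprev : ∀ e p', p' + e = p → ((Surv Z p').card : ℝ) ≤ (ρ ^ e)⁻¹ * (Surv Z p).card := by
    intro e
    induction e with
    | zero => intro p' hp; simp at hp; subst hp; simp
    | succ e ihe =>
      intro p' hp
      have h1 := ihe (p' + 1) (by omega)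
      have h2 := ih p' (by omega)
      have h3 : ((Surv Z p').card : ℝ) ≤ ρ⁻¹ * (Surv Z (p'+1)).card := by
        rw [inv_mul_eq_div, le_div_iff₀ hρ]; linarith
      refine h3.trans ((mul_le_mul_of_nonneg_left h1 (by positivity)).trans (le_of_eq ?_))
      rw [pow_succ, mul_inv]; ring
  -- children
  set Ch := (Finset.range (2 ^ (p + 1))).filter (fun i => i / 2 ∈ Surv Z p) with hCh
  have hcard : 2 * (Surv Z p).card ≤ Ch.card := by
    have e1 : ((Surv Z p) ×ˢ Finset.range 2).card = (Surv Z p).card * 2 := by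
      rw [Finset.card_product, Finset.card_range]
    rw [mul_comm, ← e1]
    refine Finset.card_le_card_of_injOn (fun x => 2 * x.1 + x.2) ?_ ?_
    · rintro ⟨a, b⟩ hab
      simp only [Finset.coe_product, Set.mem_prod, Finset.mem_coe, Finset.mem_range] at hab
      have := (Surv_lt hab.1).1
      simp only [hCh, Finset.coe_filter, Set.mem_ofPred_eq, Finset.mem_range]
      refine ⟨by rw [pow_succ]; omega, ?_⟩
      rw [show (2 * a + b) / 2 = a by omega]; exact hab.1
    · rintro ⟨a, b⟩ hab ⟨a', b'⟩ hab' heq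
      simp only [Finset.coe_product, Set.mem_prod, Finset.mem_coe, Finset.mem_range] at hab hab' heq
      ext <;> simp <;> omega
  set Rm := fun p' => Ch.filter (fun i => i ∈ Z p' (p+1)) with hRm
  have hsplit : Ch ⊆ Surv Z (p+1) ∪ (Finset.range (p+1)).biUnion Rm := by
    intro i hi
    rw [Finset.mem_union, Finset.mem_biUnion]
    have hi' := hi
    rw [hCh, Finset.mem_filter, Finset.mem_range] at hi'
    by_cases hz : ∀ p' < p + 1, i ∉ Z p' (p + 1)
    · exact Or.inl (mem_Surv_succ.2 ⟨hi'.1, hi'.2, hz⟩)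
    · push Not at hz
      obtain ⟨p', hp', hz⟩ := hz
      exact Or.inr ⟨p', Finset.mem_range.2 hp', Finset.mem_filter.2 ⟨hi, hz⟩⟩
  have hR : ∀ p' ∈ Finset.range (p+1), ((Rm p').card : ℝ) ≤ h p' (p+1) * (ρ ^ (p + 1 - 1 - p'))⁻¹ * (Surv Z p).card := by
    intro p' hp'
    rw [Finset.mem_range] at hp'
    have hm : ∀ i ∈ Rm p', i / 2 ^ (p + 1 - p') ∈ Surv Z p' := by
      intro i hi
      rw [hRm, Finset.mem_filter, hCh, Finset.mem_filter] at hi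
      have := Surv_anc (p - p') (i := i / 2) (Z := Z) (p' := p') (by rw [show p' + (p - p') = p by omega]; exact hi.1.2)
      rwa [Nat.div_div_eq_div_mul, ← pow_succ', show p - p' + 1 = p + 1 - p' by omega] at this
    have h1 : ((Rm p').card : ℝ) ≤ (Surv Z p').card * h p' (p+1) := by
      rw [Finset.card_eq_sum_card_fiberwise (f := fun i => i / 2 ^ (p + 1 - p')) (t := Surv Z p') hm]
      push_cast
      rw [← nsmul_eq_mul]
      refine Finset.sum_le_card_nsmul _ _ _ fun i' hi' => ?_
      refine S.count p' (p+1) hp' i' (Surv_lt hi').1 (Surv_lt hi').2 _ fun i hi => ?_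
      rw [Finset.mem_filter, hRm, Finset.mem_filter] at hi
      exact ⟨hi.1.2, hi.2⟩
    have h2 := hprev (p - p') p' (by omega)
    refine h1.trans ((mul_le_mul_of_nonneg_right h2 (S.nonneg _ _)).trans (le_of_eq ?_))
    rw [show p + 1 - 1 - p' = p - p' by omega]; ring
  have h1 : (Ch.card : ℝ) ≤ (Surv Z (p+1)).card + ∑ p' ∈ Finset.range (p+1), ((Rm p').card : ℝ) := by
    have a1 := Finset.card_le_card hsplit
    have a2 := Finset.card_union_le (Surv Z (p+1)) ((Finset.range (p+1)).biUnion Rm)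
    have a3 := Finset.card_biUnion_le (s := Finset.range (p+1)) (t := Rm)
    exact_mod_cast (a1.trans a2).trans (Nat.add_le_add_left a3 _)
  have h2 := Finset.sum_le_sum hR
  rw [← Finset.sum_mul] at h2
  have h3 := mul_le_mul_of_nonneg_right (S.cost (p+1)) (Nat.cast_nonneg (α := ℝ) (Surv Z p).card)
  have h4 : (2:ℝ) * (Surv Z p).card ≤ Ch.card := by exact_mod_cast hcard
  linarith

/-- x avoids the strategy -/
def Good (lo L : ℝ) (Z : ℕ → ℕ → Set ℕ) (x : ℝ) : Prop :=
  ∀ p, ∃ i, i < 2 ^ p ∧ x ∈ J lo L p i ∧ ∀ p' < p, i ∉ Z p' p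

lemma exists_good {ρ lo L : ℝ} {Z : ℕ → ℕ → Set ℕ} {h : ℕ → ℕ → ℝ} (hρ : 0 < ρ) (hL : 0 ≤ L)
    (S : Strat ρ (2 - ρ) 0 Z h) : ∃ x, Good lo L Z x := by
  have hne : ∀ p, (Surv Z p).Nonempty := by
    intro p
    induction p with
    | zero => simp [Surv]
    | succ p ih =>
      have h1 := Surv_growth hρ S p
      have h2 : 0 < ((Surv Z p).card : ℝ) := by exact_mod_cast ih.card_pos
      have : 0 < ((Surv Z (p+1)).card : ℝ) := lt_of_lt_of_le (by positivity) h1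
      exact Finset.card_pos.1 (by exact_mod_cast this)
  obtain ⟨x, hx⟩ := IsCompact.nonempty_iInter_of_sequence_nonempty_isCompact_isClosed
    (fun p => ⋃ i ∈ Surv Z p, J lo L p i) (by
      intro p x hx
      simp only [Set.mem_iUnion] at hx ⊢
      obtain ⟨i, hi, hx⟩ := hx
      refine ⟨i / 2, (mem_Surv_succ.1 hi).2.1, ?_⟩
      have := J_sub (lo := lo) hL (i := i) (Nat.le_succ p) hx
      simpa using this) (by
      intro p
      obtain ⟨i, hi⟩ := hne p
      refine ⟨lo + i * (L / 2 ^ p), Set.mem_biUnion hi ⟨le_rfl, ?_⟩⟩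
      have : 0 ≤ L / 2^p := by positivity
      linarith) (by simp only [Surv, Finset.mem_singleton, Set.iUnion_iUnion_eq_left]; exact isCompact_Icc) (by
      intro p
      exact Set.Finite.isClosed_biUnion (Finset.finite_toSet _) (fun i _ => isClosed_Icc))
  refine ⟨x, fun p => ?_⟩
  have := Set.mem_iInter.1 hx p
  simp only [Set.mem_iUnion] at this
  obtain ⟨i, hi, hx⟩ := this
  exact ⟨i, (Surv_lt hi).1, hx, (Surv_lt hi).2⟩

lemma Strat.union {ρ δ : ℝ} (hρ : 0 < ρ) {D : ℕ → ℝ} {Z : ℕ → ℕ → ℕ → Set ℕ} {h : ℕ → ℕ → ℕ → ℝ}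
    (S : ∀ k, Strat ρ (D k) k (Z k) (h k)) (hD : ∀ p, ∑ k ∈ Finset.range (p+1), D k ≤ δ) :
    Strat ρ δ 0 (fun p' p => ⋃ k, Z k p' p) (fun p' p => ∑ k ∈ Finset.range (p+1), h k p' p) := by
  classical
  refine ⟨fun p' p => Finset.sum_nonneg fun k _ => (S k).nonneg _ _, fun p' p hp => absurd hp (by omega), ?_, ?_⟩
  · intro p' p hp i' hi' hsurv R hR
    have hsub : R ⊆ (Finset.range (p+1)).biUnion (fun k => R.filter (fun i => i ∈ Z k p' p)) := by
      intro i hi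
      obtain ⟨k, hk⟩ := Set.mem_iUnion.1 (hR i hi).1
      rw [Finset.mem_biUnion]
      refine ⟨k, ?_, Finset.mem_filter.2 ⟨hi, hk⟩⟩
      rw [Finset.mem_range]
      by_contra hc
      rw [(S k).empty p' p (by omega)] at hk
      exact hk
    have h1 := (Finset.card_le_card hsub).trans Finset.card_biUnion_le
    have h2 : (R.card : ℝ) ≤ ∑ k ∈ Finset.range (p+1), ((R.filter (fun i => i ∈ Z k p' p)).card : ℝ) := by
      exact_mod_cast h1
    refine h2.trans (Finset.sum_le_sum fun k _ => ?_)
    refine (S k).count p' p hp i' hi' (fun p'' hp'' hz => hsurv p'' hp'' (Set.mem_iUnion.2 ⟨k, hz⟩)) _ fun i hi => ?_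
    rw [Finset.mem_filter] at hi
    exact ⟨hi.2, (hR i hi.1).2⟩
  · intro p
    simp only [Finset.sum_mul]
    rw [Finset.sum_comm]
    exact (Finset.sum_le_sum fun k _ => (S k).cost p).trans (hD p)

lemma cover_strat {ρ δ lo L : ℝ} (hρ : 1 < ρ) (hρ2 : ρ ≤ 2) (hL : 0 < L) (hδ1 : δ < 1) {U : ℕ → Set ℝ} {q : ℕ → ℕ}
    (hU : ∀ n, ∀ x ∈ U n, ∀ y ∈ U n, |x - y| ≤ L / 2 ^ q n)
    (hs : Summable fun n => (ρ⁻¹) ^ q n) (hδ : 6 * ∑' n, (ρ⁻¹) ^ q n ≤ δ) :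
    ∃ Z h, Strat ρ δ 0 Z h ∧ ∀ x, Good lo L Z x → ∀ n, x ∉ U n := by
  classical
  have hρ0 : 0 < ρ := by linarith
  have hterm : ∀ n, (ρ⁻¹) ^ q n ≤ ∑' n, (ρ⁻¹) ^ q n := fun n => hs.le_tsum n (fun m _ => by positivity)
  have hq : ∀ n, 1 ≤ q n := by
    intro n
    by_contra hc
    have h0 : q n = 0 := by omega
    have := hterm n
    rw [h0, pow_zero] at this
    linarith
  have hfin : ∀ p, {n | q n = p}.Finite := by
    intro p
    have h1 := hs.tendsto_cofinite_zero
    have h2 := h1.eventually (gt_mem_nhds (show (0:ℝ) < (ρ⁻¹)^p by positivity))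
    rw [Filter.eventually_cofinite] at h2
    refine h2.subset fun n hn => ?_
    simp only [Set.mem_ofPred_eq] at hn ⊢
    rw [hn]; exact lt_irrefl _
  have hcard : ∀ p, ((hfin p).toFinset.card : ℝ) * (ρ⁻¹)^p ≤ ∑' n, (ρ⁻¹) ^ q n := by
    intro p
    have := hs.sum_le_tsum (hfin p).toFinset (fun m _ => by positivity)
    rw [Finset.sum_congr rfl (g := fun _ => (ρ⁻¹)^p) (fun n hn => by
      rw [Set.Finite.mem_toFinset] at hn; rw [hn])] at this
    simpa using this
  refine ⟨fun p' p => {i | p' = 0 ∧ ∃ n, q n = p ∧ ∃ x ∈ J lo L p i, x ∈ U n},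
    fun p' p => if p' = 0 then (3 * (hfin p).toFinset.card : ℝ) else 0, ⟨?_, ?_, ?_, ?_⟩, ?_⟩
  · intro p' p
    split_ifs <;> positivity
  · intro p' p hp; omega
  · intro p' p hp i' hi' _ R hR
    split_ifs with h0
    · have hsub : R ⊆ (hfin p).toFinset.biUnion (fun n => R.filter (fun i => ∃ x ∈ J lo L p i, x ∈ U n)) := by
        intro i hi
        obtain ⟨_, n, hn, hx⟩ := (hR i hi).1
        rw [Finset.mem_biUnion]
        exact ⟨n, (Set.Finite.mem_toFinset _).2 hn, Finset.mem_filter.2 ⟨hi, hx⟩⟩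
      have h1 := (Finset.card_le_card hsub).trans (Finset.card_biUnion_le_card_mul _ _ 3 (fun n hn => by
        rw [Set.Finite.mem_toFinset] at hn
        refine card_close fun i hi k hk => ?_
        rw [Finset.mem_filter] at hi hk
        obtain ⟨_, x, hx, hxU⟩ := hi
        obtain ⟨_, y, hy, hyU⟩ := hk
        refine close_of_J hL hx hy ?_
        rw [← show q n = p from hn]
        exact hU n x hxU y hyU))
      rw [mul_comm]
      exact_mod_cast h1
    · have : R = ∅ := by
        ext i
        simp only [Finset.notMem_empty, iff_false]
        intro hi
        exact h0 (hR i hi).1.1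
      rw [this]; simp
  · intro p
    have hS0 : 0 ≤ ∑' n, (ρ⁻¹) ^ q n := tsum_nonneg fun n => by positivity
    cases p with
    | zero => simp; linarith
    | succ p =>
      rw [Finset.sum_eq_single 0]
      · rw [if_pos rfl, ← inv_pow, show p + 1 - 1 - 0 = p by omega]
        have h1 := hcard (p+1)
        have h2 : (ρ⁻¹)^p = ρ * (ρ⁻¹)^(p+1) := by rw [pow_succ]; field_simp
        rw [h2]
        have h3 : (0:ℝ) ≤ ((hfin (p+1)).toFinset.card : ℝ) * (ρ⁻¹)^(p+1) := by positivity
        nlinarith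
      · intro b _ hb
        rw [if_neg hb, zero_mul]
      · intro hb; simp at hb
  · intro x hx n hxn
    obtain ⟨i, hi, hxi, hz⟩ := hx (q n)
    exact hz 0 (hq n) ⟨rfl, n, rfl, x, hxi, hxn⟩

end BB

set_option linter.unusedVariables false
set_option linter.unusedSectionVars false
open MeasureTheory ENNReal

namespace BB

lemma pick_q {ρ s L A : ℝ} (hs : 0 < s) (h2 : (2:ℝ) ^ s ≤ ρ) (hL : 0 < L) (hA : 0 < A) (hAL : A ≤ L ^ s) :
    ∃ q : ℕ, (∀ u, 0 ≤ u → u ^ s ≤ A → u ≤ L / 2 ^ q) ∧ (ρ⁻¹) ^ q ≤ (2 / L) ^ s * A := by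
  set d := A ^ s⁻¹ with hd
  have hd0 : 0 < d := Real.rpow_pos_of_pos hA _
  have hdA : d ^ s = A := Real.rpow_inv_rpow hA.le hs.ne'
  have hdL : d ≤ L := by
    rw [← Real.rpow_le_rpow_iff hd0.le hL.le hs, hdA]; exact hAL
  obtain ⟨q, hq1, hq2⟩ := exists_nat_pow_near (x := L / d) (y := (2:ℝ)) (by rwa [le_div_iff₀ hd0, one_mul]) (by norm_num)
  refine ⟨q, fun u hu huA => ?_, ?_⟩
  · have h1 : u ≤ d := by
      rw [← Real.rpow_le_rpow_iff hu hd0.le hs, hdA]; exact huA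
    refine h1.trans ?_
    rw [le_div_iff₀ (by positivity)]
    rw [le_div_iff₀ hd0] at hq1
    linarith
  · have h3 : (ρ⁻¹) ^ q ≤ (((2:ℝ) ^ s)⁻¹) ^ q := by
      have : (0:ℝ) < 2 ^ s := by positivity
      have : 0 < ρ := this.trans_le h2
      gcongr
    refine h3.trans ?_
    have h4 : (((2:ℝ) ^ s)⁻¹) ^ q = ((2 ^ q : ℝ)⁻¹) ^ s := by
      rw [← Real.inv_rpow (by norm_num), ← Real.rpow_natCast, ← Real.rpow_mul (by norm_num), mul_comm, Real.rpow_mul (by norm_num), Real.rpow_natCast, inv_pow]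
    rw [h4, ← hdA, ← Real.mul_rpow (by positivity) hd0.le]
    refine Real.rpow_le_rpow (by positivity) ?_ hs.le
    rw [inv_le_iff_one_le_mul₀ (by positivity)]
    rw [div_lt_iff₀ hd0, pow_succ] at hq2
    rw [div_mul_eq_mul_div, mul_comm, ← mul_div_assoc, le_div_iff₀ hL]
    linarith

lemma dim_lower {ρ lo L s : ℝ} (hρ : 1 < ρ) (hρ2 : ρ < 2) (hs : 0 < s) (h2s : (2:ℝ) ^ s ≤ ρ) (hL : 0 < L)
    {Z : ℕ → ℕ → ℕ → Set ℕ} {h : ℕ → ℕ → ℕ → ℝ}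
    (S : ∀ k, Strat ρ ((2 - ρ) / 2 ^ (k + 2)) (k + 1) (Z k) (h k)) :
    μH[s] {x : ℝ | ∀ k, Good lo L (Z k) x} ≠ 0 := by
  intro h0
  set E := {x : ℝ | ∀ k, Good lo L (Z k) x} with hE
  set K := (2 / L) ^ s with hK
  have hK0 : 0 < K := by positivity
  set η := min (L ^ s / 2) ((2 - ρ) / 2 / (12 * K)) with hη
  have hη0 : 0 < η := lt_min (by positivity) (div_pos (by linarith) (by positivity))
  have hη1 : 2 * η ≤ L ^ s := by have := min_le_left (L ^ s / 2) ((2 - ρ) / 2 / (12 * K)); linarith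
  have hη2 : 6 * (K * (2 * η)) ≤ (2 - ρ) / 2 := by
    have := min_le_right (L ^ s / 2) ((2 - ρ) / 2 / (12 * K))
    rw [le_div_iff₀ (by positivity)] at this
    rw [← hη] at this
    linarith
  rw [Measure.hausdorffMeasure_apply] at h0
  simp only [ENNReal.iSup_eq_zero] at h0
  have h1 := h0 1 one_pos
  have h2 : _ < ENNReal.ofReal η := h1.trans_lt (ENNReal.ofReal_pos.2 hη0)
  simp only [iInf_lt_iff] at h2
  obtain ⟨t, hts, ht, hsum⟩ := h2
  set e : ℕ → ENNReal := fun n => ⨆ _ : (t n).Nonempty, Metric.ediam (t n) ^ s with he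
  have hfin : ∑' n, e n ≠ ⊤ := (hsum.trans ENNReal.ofReal_lt_top).ne
  have hen : ∀ n, e n ≠ ⊤ := ENNReal.ne_top_of_tsum_ne_top hfin
  have hsumm : Summable fun n => (e n).toReal := ENNReal.summable_toReal hfin
  have htsum : ∑' n, (e n).toReal ≤ η := by
    rw [← ENNReal.tsum_toReal_eq hen]
    exact ENNReal.toReal_le_of_le_ofReal hη0.le hsum.le
  set A : ℕ → ℝ := fun n => (e n).toReal + η / 2 / 2 ^ n with hA
  have hgeo : HasSum (fun n : ℕ => η / 2 / 2 ^ n) η := hasSum_geometric_two' η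
  have hAs : HasSum A (∑' n, (e n).toReal + η) := hsumm.hasSum.add hgeo
  have hA0 : ∀ n, 0 < A n := fun n => by
    have : 0 ≤ (e n).toReal := ENNReal.toReal_nonneg
    have : 0 < η / 2 / 2 ^ n := by positivity
    simp only [hA]; linarith
  have hAle : ∀ n, A n ≤ 2 * η := fun n => (le_hasSum hAs n fun m _ => (hA0 m).le).trans (by linarith)
  choose q hq1 hq2 using fun n => pick_q hs h2s hL (hA0 n) ((hAle n).trans hη1)
  have hU : ∀ n, ∀ x ∈ t n, ∀ y ∈ t n, |x - y| ≤ L / 2 ^ q n := by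
    intro n x hx y hy
    refine hq1 n _ (abs_nonneg _) ?_
    have a1 : edist x y ^ s ≤ e n := by
      simp only [he]
      rw [iSup_pos ⟨x, hx⟩]
      exact ENNReal.rpow_le_rpow (Metric.edist_le_ediam_of_mem hx hy) hs.le
    have a2 := ENNReal.toReal_mono (hen n) a1
    rw [← ENNReal.toReal_rpow, edist_dist, ENNReal.toReal_ofReal dist_nonneg, Real.dist_eq] at a2
    have : 0 < η / 2 / 2 ^ n := by positivity
    simp only [hA]; linarith
  have hKs : Summable fun n => K * A n := hAs.summable.mul_left K
  have hqs : Summable fun n => (ρ⁻¹) ^ q n := Summable.of_nonneg_of_le (fun n => by positivity) hq2 hKs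
  have hqt : ∑' n, (ρ⁻¹) ^ q n ≤ K * (2 * η) := by
    refine (hqs.tsum_le_tsum hq2 hKs).trans ?_
    rw [tsum_mul_left, hAs.tsum_eq]
    gcongr; linarith
  obtain ⟨Z0, h0', S0, hgood⟩ := cover_strat (δ := (2 - ρ) / 2) (lo := lo) hρ hρ2.le hL (by linarith) hU hqs (by linarith)
  have SU := Strat.union (ρ := ρ) (δ := 2 - ρ) (by linarith) (D := fun k => Nat.casesOn k ((2 - ρ)/2) (fun k => (2 - ρ) / 2 ^ (k+2)))
    (Z := fun k => Nat.casesOn k Z0 Z) (h := fun k => Nat.casesOn k h0' h) (by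
      intro k
      cases k with
      | zero => exact S0
      | succ k => exact S k) (by
      intro p
      have : ∀ p : ℕ, ∑ k ∈ Finset.range (p+1), (Nat.casesOn k ((2 - ρ)/2) (fun k => (2 - ρ) / 2 ^ (k+2)) : ℝ) = (2 - ρ) * (1 - 1 / 2^(p+1)) := by
        intro p
        induction p with
        | zero => simp; ring
        | succ p ih =>
          rw [Finset.sum_range_succ, ih]
          simp only
          field_simp
          ring
      rw [this]
      have h3 : 0 < (1:ℝ) / 2^(p+1) := by positivity
      nlinarith)
  obtain ⟨x, hx⟩ := exists_good (lo := lo) (by linarith) hL.le SU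
  have hk : ∀ k : ℕ, Good lo L (Nat.casesOn k Z0 Z : ℕ → ℕ → Set ℕ) x := by
    intro k p
    obtain ⟨i, hi, hxi, hz⟩ := hx p
    exact ⟨i, hi, hxi, fun p' hp' hc => hz p' hp' (Set.mem_iUnion.2 ⟨k, hc⟩)⟩
  have hxE : x ∈ E := fun k => hk (k+1)
  obtain ⟨n, hn⟩ := Set.mem_iUnion.1 (hts hxE)
  exact hgood x (hk 0) n hn

end BB

set_option linter.unusedVariables false
set_option linter.unusedSectionVars false
open MeasureTheory ENNReal

namespace BB

lemma pigeon {σ : Type} [Fintype σ] [DecidableEq σ] [Nonempty σ] {u : σ → ℝ} (hu : ∀ i, 0 < u i) {q : ℕ} (hq : 1 ≤ q)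
    (hprod : (q:ℝ) ≤ ∏ i, u i) (z : σ → ℤ) :
    ∃ a : σ → ℤ, ∃ a0 : ℤ, a ≠ 0 ∧ (∀ i, |(a i : ℝ)| ≤ u i) ∧ ∑ i, a i * z i = - (q * a0) := by
  have : NeZero q := ⟨by omega⟩
  have hcard : Fintype.card (ZMod q) < Fintype.card (∀ i : σ, Fin (⌊u i⌋₊ + 1)) := by
    rw [ZMod.card, Fintype.card_pi]
    simp only [Fintype.card_fin]
    have : (q:ℝ) < ∏ i, ((⌊u i⌋₊ + 1 : ℕ) : ℝ) := by
      refine hprod.trans_lt ?_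
      refine Finset.prod_lt_prod_of_nonempty (fun i _ => hu i) (fun i _ => ?_) Finset.univ_nonempty
      push_cast
      exact Nat.lt_floor_add_one _
    exact_mod_cast this
  obtain ⟨w, v, hvw', he⟩ := Fintype.exists_ne_map_eq_of_card_lt
    (fun v : (∀ i : σ, Fin (⌊u i⌋₊ + 1)) => ((∑ i, ((v i : ℕ) : ℤ) * z i : ℤ) : ZMod q)) hcard
  have hvw := Ne.symm hvw'
  rw [ZMod.intCast_eq_intCast_iff_dvd_sub] at he
  obtain ⟨k, hk⟩ := he
  refine ⟨fun i => ((v i : ℕ) : ℤ) - ((w i : ℕ) : ℤ), -k, ?_, ?_, ?_⟩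
  · intro h0
    apply hvw
    funext i
    have := congrFun h0 i
    simp only [Pi.zero_apply] at this
    exact Fin.ext (by omega)
  · intro i
    have h1 : (((v i : ℕ)) : ℝ) ≤ u i := by
      refine le_trans ?_ (Nat.floor_le (hu i).le)
      exact_mod_cast Nat.lt_succ_iff.1 (v i).2
    have h2 : (((w i : ℕ)) : ℝ) ≤ u i := by
      refine le_trans ?_ (Nat.floor_le (hu i).le)
      exact_mod_cast Nat.lt_succ_iff.1 (w i).2
    have h3 : (0:ℝ) ≤ ((v i : ℕ) : ℝ) := Nat.cast_nonneg _
    have h4 : (0:ℝ) ≤ ((w i : ℕ) : ℝ) := Nat.cast_nonneg _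
    push_cast
    rw [abs_le]; constructor <;> linarith
  · simp only [sub_mul]
    rw [Finset.sum_sub_distrib]
    linarith

lemma dual {σ : Type} [Fintype σ] [DecidableEq σ] [Nonempty σ] {r : Option σ → ℝ} {φ : Option σ → ℝ → ℝ} {x d ϖ : ℝ}
    (hφ : φ none x = 1) (hϖ : 0 < ϖ) (hr : ∀ i : σ, ϖ ≤ r (some i)) (hsum : ∑ i : σ, r (some i) = 1) (hd : 0 < d)
    (h : DualBad none r φ d x) :
    ∃ c' : ℝ, 0 < c' ∧ ∀ q : ℕ, 1 ≤ q → ∃ i : σ, ∀ z : ℤ, (c' * (q:ℝ)⁻¹) ^ r (some i) ≤ |q * φ (some i) x - z| := by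
  obtain ⟨c, hc, p1, hp⟩ := h
  set T := Real.exp ((p1 + 1) * d) with hT
  have hT0 : 0 < T := Real.exp_pos _
  set N : ℝ := (Fintype.card σ : ℝ) with hN
  have hN0 : 0 < N := by rw [hN]; exact_mod_cast Fintype.card_pos
  set θ := min 1 ((c / (T * N)) ^ ϖ⁻¹) with hθ
  have hθ0 : 0 < θ := lt_min one_pos (Real.rpow_pos_of_pos (by positivity) _)
  have hθϖ : θ ^ ϖ ≤ c / (T * N) := by
    refine (Real.rpow_le_rpow hθ0.le (min_le_right _ _) hϖ.le).trans (le_of_eq ?_)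
    exact Real.rpow_inv_rpow (by positivity) hϖ.ne'
  refine ⟨θ / T, by positivity, fun q hq => ?_⟩
  by_contra hcon
  push Not at hcon
  choose z hz using hcon
  have hq1 : (1:ℝ) ≤ q := by exact_mod_cast hq
  have hq0 : (0:ℝ) < q := by linarith
  set p := max p1 ⌈Real.log q / d⌉₊ with hpd
  set t : ℝ := p * d with ht
  have ht1 : (q:ℝ) ≤ Real.exp t := by
    rw [← Real.log_le_iff_le_exp hq0, ht, ← div_le_iff₀ hd]
    exact (Nat.le_ceil _).trans (by exact_mod_cast le_max_right _ _)
  have ht2 : Real.exp t ≤ q * T := by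
    rw [hT, ← Real.exp_log hq0, ← Real.exp_add]
    refine Real.exp_le_exp.2 ?_
    have hl : 0 ≤ Real.log q / d := div_nonneg (Real.log_nonneg hq1) hd.le
    have : (p:ℝ) ≤ Real.log q / d + (p1 + 1) := by
      rw [hpd]; push_cast
      refine max_le ?_ ?_
      · linarith
      · have := (Nat.ceil_lt_add_one hl).le
        have : (0:ℝ) ≤ p1 := Nat.cast_nonneg _
        linarith
    have := mul_le_mul_of_nonneg_right this hd.le
    rw [add_mul, div_mul_cancel₀ _ hd.ne'] at this
    exact this
  obtain ⟨a, a0, ha, hab, hsum0⟩ := pigeon (u := fun i => Real.exp (r (some i) * t)) (fun i => Real.exp_pos _) hq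
    (by rw [← Real.exp_sum, ← Finset.sum_mul, hsum, one_mul]; exact ht1) z
  refine hp p (le_max_left _ _) (fun i => Option.elim i a0 a) ⟨?_, ?_, ?_⟩
  · intro h0
    apply ha
    funext i
    exact congrFun h0 (some i)
  · intro i hi
    cases i with
    | none => exact absurd rfl hi
    | some i => exact hab i
  · have e1 : lin (toR fun i => Option.elim i a0 a) φ x = (q:ℝ)⁻¹ * ∑ i, (a i : ℝ) * (q * φ (some i) x - z i) := by
      rw [lin, Fintype.sum_option]
      simp only [toR, Option.elim, hφ, mul_sub]
      rw [Finset.sum_sub_distrib]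
      have : ∑ i, (a i : ℝ) * (z i : ℝ) = - (q * a0) := by exact_mod_cast hsum0
      have e2 : ∑ i, (a i : ℝ) * (q * φ (some i) x) = q * ∑ i, (a i : ℝ) * φ (some i) x := by
        rw [Finset.mul_sum]
        exact Finset.sum_congr rfl fun i _ => by ring
      rw [this, e2]
      field_simp
      ring
    have e3 : ∀ i ∈ Finset.univ, |(a i : ℝ) * (q * φ (some i) x - z i)| ≤ c / (T * N) := by
      intro i _
      rw [abs_mul]
      refine (mul_le_mul (hab i) (hz i).le (abs_nonneg _) (Real.exp_pos _).le).trans ?_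
      have : Real.exp (r (some i) * t) = (Real.exp t) ^ r (some i) := by
        rw [← Real.exp_mul, mul_comm]
      rw [this, ← Real.mul_rpow (Real.exp_pos _).le (by positivity)]
      have h1 : Real.exp t * (θ / T * (q:ℝ)⁻¹) ≤ θ := by
        rw [← div_eq_mul_inv, div_div, ← mul_div_assoc, div_le_iff₀ (by positivity)]
        have := mul_le_mul_of_nonneg_right ht2 hθ0.le
        linarith
      refine (Real.rpow_le_rpow (by positivity) h1 (hϖ.le.trans (hr i))).trans ?_
      exact (Real.rpow_le_rpow_of_exponent_ge hθ0 (min_le_left _ _) (hr i)).trans hθϖ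
    have e4 := (Finset.abs_sum_le_sum_abs (fun i => (a i : ℝ) * (q * φ (some i) x - z i)) Finset.univ).trans
      (Finset.sum_le_card_nsmul _ _ _ e3)
    rw [nsmul_eq_mul, Finset.card_univ, ← hN] at e4
    have e5 : N * (c / (T * N)) = c / T := by field_simp
    rw [e5] at e4
    rw [e1, abs_mul, abs_of_pos (inv_pos.2 hq0), Real.exp_neg]
    refine (mul_le_mul_of_nonneg_left e4 (by positivity)).trans ?_
    have e6 : (q:ℝ)⁻¹ * (c / T) = c * (q * T)⁻¹ := by field_simp
    rw [e6]
    refine mul_le_mul_of_nonneg_left ?_ hc.le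
    exact inv_anti₀ (Real.exp_pos _) ht2

end BB

set_option linter.unusedVariables false
set_option linter.unusedSectionVars false
open MeasureTheory ENNReal

namespace BB

/-- constants for the mean value lemma -/
def Kc : ℕ → ℝ
  | 0 => 1
  | i + 1 => 6 * 3 ^ i * Kc i

lemma Kc_pos : ∀ i, 1 ≤ Kc i
  | 0 => le_rfl
  | i + 1 => by
    have h1 := Kc_pos i
    have h2 : (1:ℝ) ≤ 3 ^ i := one_le_pow₀ (by norm_num)
    have h3 : (1:ℝ) * 1 ≤ 3 ^ i * Kc i := mul_le_mul h2 h1 (by norm_num) (by positivity)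
    rw [Kc]; linarith

lemma Kc_mono : Monotone Kc := by
  refine monotone_nat_of_le_succ fun i => ?_
  have h1 := Kc_pos i
  have h2 : (1:ℝ) ≤ 3 ^ i := one_le_pow₀ (by norm_num)
  rw [Kc]
  nlinarith

lemma small_point {g : ℕ → ℝ → ℝ} {S : ℝ} : ∀ (i : ℕ) {u v : ℝ}, u < v →
    (∀ k < i, ∀ x ∈ Set.Icc u v, HasDerivAt (g k) (g (k+1) x) x) →
    (∀ x ∈ Set.Icc u v, |g 0 x| ≤ S) → ∃ ξ ∈ Set.Icc u v, |g i ξ| ≤ Kc i * S / (v - u) ^ i := by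
  intro i
  induction i with
  | zero =>
    intro u v huv _ hS
    refine ⟨u, ⟨le_rfl, huv.le⟩, ?_⟩
    have := hS u ⟨le_rfl, huv.le⟩
    simpa [Kc] using this
  | succ i ih =>
    intro u v huv hd hS
    set l := (v - u) / 3 with hl
    have hl0 : 0 < l := by rw [hl]; linarith
    have hv : v = u + 3 * l := by rw [hl]; ring
    have s1 : ∀ x ∈ Set.Icc u (u + l), x ∈ Set.Icc u v := fun x hx => ⟨hx.1, by linarith [hx.2]⟩
    have s2 : ∀ x ∈ Set.Icc (u + 2 * l) v, x ∈ Set.Icc u v := fun x hx => ⟨by linarith [hx.1], hx.2⟩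
    obtain ⟨x, hx, hgx⟩ := ih (u := u) (v := u + l) (by linarith) (fun k hk x hx => hd k (by omega) x (s1 x hx)) (fun x hx => hS x (s1 x hx))
    obtain ⟨y, hy, hgy⟩ := ih (u := u + 2 * l) (v := v) (by linarith) (fun k hk x hx => hd k (by omega) x (s2 x hx)) (fun x hx => hS x (s2 x hx))
    rw [show u + l - u = l by ring] at hgx
    rw [show v - (u + 2 * l) = l by rw [hv]; ring] at hgy
    have hxy : x + l ≤ y := by linarith [hx.2, hy.1]
    have hsub : ∀ z ∈ Set.Icc x y, z ∈ Set.Icc u v := fun z hz => ⟨(s1 x hx).1.trans hz.1, hz.2.trans (s2 y hy).2⟩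
    obtain ⟨ξ, hξ, e⟩ := exists_hasDerivAt_eq_slope (g i) (g (i+1)) (show x < y by linarith)
      (fun z hz => (hd i (by omega) z (hsub z hz)).continuousAt.continuousWithinAt)
      (fun z hz => hd i (by omega) z (hsub z (Set.Ioo_subset_Icc_self hz)))
    refine ⟨ξ, hsub ξ (Set.Ioo_subset_Icc_self hξ), ?_⟩
    rw [e, abs_div, abs_of_pos (show 0 < y - x by linarith)]
    have h1 : |g i y - g i x| ≤ 2 * (Kc i * S / l ^ i) := by
      have := abs_sub (g i y) (g i x); linarith
    have h0 : 0 ≤ 2 * (Kc i * S / l ^ i) := (abs_nonneg _).trans h1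
    refine (div_le_div₀ h0 h1 hl0 (show l ≤ y - x by linarith)).trans (le_of_eq ?_)
    rw [show v - u = 3 * l by rw [hv]; ring, Kc, mul_pow, pow_succ, pow_succ]
    field_simp
    ring

lemma lin_hasDeriv {ι : Type} [Fintype ι] {φ ψ : ι → ℝ → ℝ} {x : ℝ} (b : ι → ℝ)
    (h : ∀ i, HasDerivAt (φ i) (ψ i x) x) : HasDerivAt (lin b φ) (lin b ψ x) x := by
  unfold lin
  exact HasDerivAt.fun_sum fun i _ => (h i).const_mul (b i)

lemma inv_bound {n : ℕ} (D : Matrix (Fin n) (Fin n) ℝ) (hD : D.det ≠ 0) :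
    ∃ Q : ℝ, 0 ≤ Q ∧ ∀ b : Fin n → ℝ, ∀ Y : ℝ, (∀ i, |∑ j, D i j * b j| ≤ Y) → ∀ j, |b j| ≤ Q * Y := by
  refine ⟨∑ j, ∑ i, |D⁻¹ j i|, Finset.sum_nonneg fun j _ => Finset.sum_nonneg fun i _ => abs_nonneg _, ?_⟩
  intro b Y hY j
  have hu : IsUnit D.det := isUnit_iff_ne_zero.2 hD
  have hb : b = D⁻¹.mulVec (D.mulVec b) := by
    rw [Matrix.mulVec_mulVec, Matrix.nonsing_inv_mul _ hu, Matrix.one_mulVec]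
  have hY0 : 0 ≤ Y := (abs_nonneg _).trans (hY j)
  have e : b j = ∑ i, D⁻¹ j i * ∑ k, D i k * b k := by
    conv_lhs => rw [hb]
    rfl
  rw [e]
  refine (Finset.abs_sum_le_sum_abs _ _).trans ?_
  have h1 : ∑ i, |D⁻¹ j i * ∑ k, D i k * b k| ≤ (∑ i, |D⁻¹ j i|) * Y := by
    rw [Finset.sum_mul]
    refine Finset.sum_le_sum fun i _ => ?_
    rw [abs_mul]
    exact mul_le_mul_of_nonneg_left (hY i) (abs_nonneg _)
  refine h1.trans (mul_le_mul_of_nonneg_right ?_ hY0)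
  exact Finset.single_le_sum (f := fun j => ∑ i, |D⁻¹ j i|) (fun j _ => Finset.sum_nonneg fun i _ => abs_nonneg _) (Finset.mem_univ j)

lemma core {n : ℕ} (hn : 2 ≤ n) {Φ : ℕ → Option (Fin n) → ℝ → ℝ} {x₀ η₁ : ℝ} (hη₁ : 0 < η₁)
    (hder : ∀ k < n, ∀ i, ∀ x ∈ Set.Ioo (x₀ - η₁) (x₀ + η₁), HasDerivAt (Φ k i) (Φ (k+1) i x) x)
    (hcont : ∀ k ≤ n, ∀ i, ContinuousAt (Φ k i) x₀)
    (h0 : ∀ x, Φ 0 none x = 1) (h1 : ∀ k x, Φ (k+1) none x = 0)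
    (hdet : (Matrix.of fun i j : Fin n => Φ (i.1 + 1) (some j) x₀).det ≠ 0) :
    ∃ η > 0, η ≤ η₁ ∧ ∃ C : ℝ, 1 ≤ C ∧ ∀ u v, x₀ - η < u → u < v → v < x₀ + η →
      (∀ b S, (∀ z ∈ Set.Icc u v, |lin b (Φ 0) z| ≤ S) → ∀ z ∈ Set.Icc u v,
        |lin b (Φ 1) z| ≤ C * S / (v - u) ∧ |lin b (Φ 2) z| ≤ C * S / (v - u) ^ 2) ∧
      ∃ B, ∀ b S, (∀ z ∈ Set.Icc u v, |lin b (Φ 0) z| ≤ S) → ∀ i, |b i| ≤ B * S := by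
  obtain ⟨Q, hQ, hQb⟩ := inv_bound _ hdet
  have hnR : (0:ℝ) < n := by exact_mod_cast (show 0 < n by omega)
  set ε : ℝ := 1 / (2 * (Q + 1) * n) with hε
  have hε0 : 0 < ε := by positivity
  have hev : ∀ᶠ x in nhds x₀, ∀ k ∈ Finset.range (n+1), ∀ i, |Φ k i x - Φ k i x₀| ≤ ε := by
    rw [Filter.eventually_all_finset]
    intro k hk
    rw [Filter.eventually_all]
    intro i
    have := Metric.continuousAt_iff'.1 (hcont k (by rw [Finset.mem_range] at hk; omega) i) ε hε0
    filter_upwards [this] with x hx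
    rw [Real.dist_eq] at hx; exact hx.le
  obtain ⟨η₂, hη₂, hb⟩ := Metric.eventually_nhds_iff.1 hev
  set η := min (min η₁ η₂) (1/2) with hη
  have hK1 := Kc_pos n
  refine ⟨η, lt_min (lt_min hη₁ hη₂) (by norm_num), (min_le_left _ _).trans (min_le_left _ _),
    n * ((1 + 2 * Q) * Kc n), ?_, ?_⟩
  · have a1 : (1:ℝ) ≤ n := by exact_mod_cast (show 1 ≤ n by omega)
    have a2 : 1 ≤ (1 + 2 * Q) * Kc n := one_le_mul_of_one_le_of_one_le (by linarith) hK1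
    exact one_le_mul_of_one_le_of_one_le a1 a2
  intro u v hu huv hv
  have hη1 : η ≤ η₁ := (min_le_left _ _).trans (min_le_left _ _)
  have hη2 : η ≤ η₂ := (min_le_left _ _).trans (min_le_right _ _)
  have hη3 : η ≤ 1/2 := min_le_right _ _
  have hl0 : 0 < v - u := by linarith
  have hl1 : v - u ≤ 1 := by linarith
  set l := v - u with hl
  have hin : ∀ x ∈ Set.Icc u v, x ∈ Set.Ioo (x₀ - η₁) (x₀ + η₁) := fun x hx => ⟨by linarith [hx.1], by linarith [hx.2]⟩
  have hosc0 : ∀ x ∈ Set.Icc u v, ∀ k ≤ n, ∀ i, |Φ k i x - Φ k i x₀| ≤ ε := by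
    intro x hx k hk i
    refine hb ?_ k (Finset.mem_range.2 (by omega)) i
    rw [Real.dist_eq, abs_lt]
    constructor <;> linarith [hx.1, hx.2]
  have key : ∀ b S, (∀ z ∈ Set.Icc u v, |lin b (Φ 0) z| ≤ S) →
      0 ≤ S ∧ (∀ j, |b (some j)| ≤ 2 * Q * Kc n * S / l ^ n) ∧
      ∀ e k, 1 ≤ k → k + e = n → ∀ z ∈ Set.Icc u v, |lin b (Φ k) z| ≤ (e + 1) * ((1 + 2 * Q) * Kc n) * S / l ^ k := by
    intro b S hS
    have hS0 : 0 ≤ S := (abs_nonneg _).trans (hS u ⟨le_rfl, huv.le⟩)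
    obtain ⟨M0, hM0, hbM, hmin⟩ : ∃ M0 : ℝ, 0 ≤ M0 ∧ (∀ j : Fin n, |b (some j)| ≤ M0) ∧
        ∀ M, (∀ j : Fin n, |b (some j)| ≤ M) → M0 ≤ M := by
      have : Nonempty (Fin n) := ⟨⟨0, by omega⟩⟩
      obtain ⟨j0, hj0⟩ := Finite.exists_max (fun j : Fin n => |b (some j)|)
      exact ⟨_, abs_nonneg _, hj0, fun M hM => hM j0⟩
    have hosc : ∀ x ∈ Set.Icc u v, ∀ k, k + 1 ≤ n → |lin b (Φ (k+1)) x - lin b (Φ (k+1)) x₀| ≤ n * ε * M0 := by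
      intro x hx k hk
      rw [lin, lin, Fintype.sum_option, Fintype.sum_option, h1, h1]
      have : (b none * 0 + ∑ i, b (some i) * Φ (k+1) (some i) x) - (b none * 0 + ∑ i, b (some i) * Φ (k+1) (some i) x₀)
          = ∑ i, b (some i) * (Φ (k+1) (some i) x - Φ (k+1) (some i) x₀) := by
        simp only [mul_sub]
        rw [Finset.sum_sub_distrib]; ring
      rw [this]
      refine (Finset.abs_sum_le_sum_abs _ _).trans ((Finset.sum_le_card_nsmul _ _ (M0 * ε) fun i _ => ?_).trans (le_of_eq ?_))
      · rw [abs_mul]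
        exact mul_le_mul (hbM i) (hosc0 x hx _ hk _) (abs_nonneg _) hM0
      · rw [Finset.card_univ, Fintype.card_fin, nsmul_eq_mul]; ring
    have hnε : n * ε = 1 / (2 * (Q + 1)) := by rw [hε]; field_simp
    have hnε1 : n * ε ≤ 1/2 := by
      rw [hnε, div_le_div_iff₀ (by positivity) (by norm_num)]; linarith
    have hnε2 : Q * (n * ε) ≤ 1/2 := by
      rw [hnε, ← mul_div_assoc, div_le_div_iff₀ (by positivity) (by norm_num)]; linarith
    have hpt : ∀ k ≤ n, ∃ ξ ∈ Set.Icc u v, |lin b (Φ k) ξ| ≤ Kc n * S / l ^ k := by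
      intro k hk
      obtain ⟨ξ, hξ, h⟩ := small_point (g := fun k => lin b (Φ k)) k huv
        (fun m hm x hx => lin_hasDeriv b fun i => hder m (by omega) i x (hin x hx)) hS
      refine ⟨ξ, hξ, h.trans ?_⟩
      have := Kc_mono hk
      gcongr
    have hmain : M0 ≤ 2 * Q * Kc n * S / l ^ n := by
      have hY := hQb (fun j => b (some j)) (Kc n * S / l ^ n + n * ε * M0) (by
        intro i
        have e : ∑ j, (Matrix.of fun i j : Fin n => Φ (i.1 + 1) (some j) x₀) i j * b (some j) = lin b (Φ (i.1 + 1)) x₀ := by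
          rw [lin, Fintype.sum_option, h1]
          simp [mul_comm]
        rw [e]
        obtain ⟨ξ, hξ, h⟩ := hpt (i.1 + 1) (by omega)
        have h2 := hosc ξ hξ i.1 (by omega)
        have h3 : Kc n * S / l ^ (i.1 + 1) ≤ Kc n * S / l ^ n := by
          refine div_le_div_of_nonneg_left (by positivity) (by positivity) ?_
          exact pow_le_pow_of_le_one hl0.le hl1 (by omega)
        have h4 := abs_sub_abs_le_abs_sub (lin b (Φ (i.1 + 1)) x₀) (lin b (Φ (i.1 + 1)) ξ)
        rw [abs_sub_comm] at h4
        linarith)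
      have h5 := hmin _ hY
      have h6 : Q * (n * ε * M0) ≤ 1/2 * M0 := by
        have := mul_le_mul_of_nonneg_right hnε2 hM0; linarith
      have h7 : 2 * Q * Kc n * S / l ^ n = 2 * (Q * (Kc n * S / l ^ n)) := by ring
      rw [h7]; linarith
    refine ⟨hS0, fun j => (hbM j).trans hmain, ?_⟩
    intro e
    induction e with
    | zero =>
      intro k hk1 hkn z hz
      obtain ⟨ξ, hξ, h⟩ := hpt k (by omega)
      obtain ⟨k', rfl⟩ : ∃ k', k = k' + 1 := ⟨k - 1, by omega⟩
      have a1 := hosc ξ hξ k' (by omega)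
      have a2 := hosc z hz k' (by omega)
      have hpw : l ^ n = l ^ (k' + 1) := by congr 1; omega
      have a3 := abs_sub_abs_le_abs_sub (lin b (Φ (k' + 1)) z) (lin b (Φ (k' + 1)) x₀)
      have a4 := abs_sub_abs_le_abs_sub (lin b (Φ (k' + 1)) x₀) (lin b (Φ (k' + 1)) ξ)
      rw [abs_sub_comm (lin b (Φ (k' + 1)) x₀)] at a4
      have a5 : n * ε * M0 ≤ 1/2 * M0 := mul_le_mul_of_nonneg_right hnε1 hM0
      have a6 : ((0:ℕ):ℝ) + 1 = 1 := by simp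
      rw [a6]
      have a7 : 1 * ((1 + 2 * Q) * Kc n) * S / l ^ (k' + 1) = Kc n * S / l ^ (k' + 1) + 2 * Q * Kc n * S / l ^ (k' + 1) := by ring
      rw [a7]
      rw [hpw] at hmain
      linarith
    | succ e ih =>
      intro k hk1 hkn z hz
      obtain ⟨ξ, hξ, h⟩ := hpt k (by omega)
      have ih' := ih (k+1) (by omega) (by omega)
      have a1 : |lin b (Φ k) z - lin b (Φ k) ξ| ≤ (e + 1) * ((1 + 2 * Q) * Kc n) * S / l ^ (k+1) * |z - ξ| := by
        have := Convex.norm_image_sub_le_of_norm_hasDerivWithin_le (f := lin b (Φ k)) (f' := lin b (Φ (k+1)))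
          (s := Set.Icc u v) (C := (e + 1) * ((1 + 2 * Q) * Kc n) * S / l ^ (k+1))
          (fun x hx => (lin_hasDeriv b fun i => hder k (by omega) i x (hin x hx)).hasDerivWithinAt)
          (fun x hx => ih' x hx) (convex_Icc u v) hξ hz
        simpa using this
      have a2 : |z - ξ| ≤ l := by
        rw [abs_le]; constructor <;> linarith [hz.1, hz.2, hξ.1, hξ.2]
      have a3 : (e + 1) * ((1 + 2 * Q) * Kc n) * S / l ^ (k+1) * |z - ξ| ≤ (e + 1) * ((1 + 2 * Q) * Kc n) * S / l ^ (k+1) * l :=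
        mul_le_mul_of_nonneg_left a2 (by positivity)
      have a4 : (e + 1) * ((1 + 2 * Q) * Kc n) * S / l ^ (k+1) * l = (e + 1) * ((1 + 2 * Q) * Kc n) * S / l ^ k := by
        rw [pow_succ]; field_simp
      have a5 := abs_sub_abs_le_abs_sub (lin b (Φ k) z) (lin b (Φ k) ξ)
      have a6 : Kc n * S / l ^ k ≤ (1 + 2 * Q) * Kc n * S / l ^ k := by
        gcongr
        nlinarith
      have a7 : (((e+1:ℕ):ℝ) + 1) * ((1 + 2 * Q) * Kc n) * S / l ^ k = (e + 1) * ((1 + 2 * Q) * Kc n) * S / l ^ k + (1 + 2 * Q) * Kc n * S / l ^ k := by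
        push_cast; ring
      rw [a7]; linarith
  refine ⟨?_, ?_⟩
  · intro b S hS z hz
    obtain ⟨hS0, _, hk⟩ := key b S hS
    constructor
    · refine (hk (n-1) 1 le_rfl (by omega) z hz).trans (le_of_eq ?_)
      rw [pow_one, Nat.cast_sub (by omega)]; simp
    · refine (hk (n-2) 2 (by omega) (by omega) z hz).trans ?_
      rw [Nat.cast_sub (by omega)]
      push_cast
      refine div_le_div_of_nonneg_right (mul_le_mul_of_nonneg_right (mul_le_mul_of_nonneg_right ?_ (by positivity)) hS0) (by positivity)
      linarith
  · refine ⟨1 + 2 * Q * Kc n / l ^ n * (1 + ∑ j, |Φ 0 (some j) u|), fun b S hS i => ?_⟩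
    obtain ⟨hS0, hbj, _⟩ := key b S hS
    have hSig : 0 ≤ ∑ j, |Φ 0 (some j) u| := Finset.sum_nonneg fun _ _ => abs_nonneg _
    have hT : 0 ≤ 2 * Q * Kc n / l ^ n := by positivity
    cases i with
    | some j =>
      refine (hbj j).trans ?_
      have : 2 * Q * Kc n * S / l ^ n = 2 * Q * Kc n / l ^ n * S := by ring
      rw [this]
      refine mul_le_mul_of_nonneg_right ?_ hS0
      nlinarith
    | none =>
      have hu' := hS u ⟨le_rfl, huv.le⟩
      rw [lin, Fintype.sum_option, h0, mul_one] at hu'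
      have a1 : |∑ j, b (some j) * Φ 0 (some j) u| ≤ 2 * Q * Kc n / l ^ n * S * ∑ j, |Φ 0 (some j) u| := by
        refine (Finset.abs_sum_le_sum_abs _ _).trans ?_
        rw [Finset.mul_sum]
        refine Finset.sum_le_sum fun j _ => ?_
        rw [abs_mul]
        refine mul_le_mul_of_nonneg_right ((hbj j).trans (le_of_eq ?_)) (abs_nonneg _)
        ring
      have a2 := abs_sub_abs_le_abs_sub (b none) (-∑ j, b (some j) * Φ 0 (some j) u)
      rw [sub_neg_eq_add, abs_neg] at a2
      have a3 : 0 ≤ 2 * Q * Kc n / l ^ n * S := by positivity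
      nlinarith
end BB

set_option linter.unusedVariables false
set_option linter.unusedSectionVars false
open MeasureTheory ENNReal

namespace BB

/-- the function system attached to a curve -/
noncomputable def Phi {n : ℕ} (f : ℝ → Fin n → ℝ) (k : ℕ) (i : Option (Fin n)) : ℝ → ℝ :=
  Option.elim i (fun _ => if k = 0 then 1 else 0) (fun j => iteratedDeriv k (fun x => f x j))

/-- good interval radius `1/t` and constant `t` -/
def CoreAt {n : ℕ} (f : ℝ → Fin n → ℝ) (x₀ t : ℝ) : Prop :=
  0 < t ∧ 1 ≤ t ∧
  (∀ k < n, ∀ i, ∀ x ∈ Set.Ioo (x₀ - 1/t) (x₀ + 1/t), HasDerivAt (Phi f k i) (Phi f (k+1) i x) x) ∧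
  (∀ k ≤ n, ∀ i, ∀ x ∈ Set.Ioo (x₀ - 1/t) (x₀ + 1/t), ContinuousAt (Phi f k i) x) ∧
  ∀ u v, x₀ - 1/t < u → u < v → v < x₀ + 1/t →
      (∀ b S, (∀ z ∈ Set.Icc u v, |lin b (Phi f 0) z| ≤ S) → ∀ z ∈ Set.Icc u v,
        |lin b (Phi f 1) z| ≤ t * S / (v - u) ∧ |lin b (Phi f 2) z| ≤ t * S / (v - u) ^ 2) ∧
      ∃ B, ∀ b S, (∀ z ∈ Set.Icc u v, |lin b (Phi f 0) z| ≤ S) → ∀ i, |b i| ≤ B * S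

lemma smooth_pt {n : ℕ} {g : ℝ → ℝ} {V : Set ℝ} (hV : IsOpen V) (hg : ContDiffOn ℝ n g V) :
    (∀ k < n, ∀ x ∈ V, HasDerivAt (iteratedDeriv k g) (iteratedDeriv (k+1) g x) x) ∧
    (∀ k ≤ n, ∀ x ∈ V, ContinuousAt (iteratedDeriv k g) x) := by
  refine ⟨fun k hk x hx => ?_, fun k hk x hx => ?_⟩
  · have h1 := (hg.differentiableOn_iteratedDerivWithin (m := k) (by exact_mod_cast hk) hV.uniqueDiffOn).congr
      (iteratedDerivWithin_of_isOpen hV).symm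
    have h2 := (h1.differentiableAt (hV.mem_nhds hx)).hasDerivAt
    rwa [← iteratedDeriv_succ] at h2
  · have h1 := (hg.continuousOn_iteratedDerivWithin (m := k) (by exact_mod_cast hk) hV.uniqueDiffOn).congr
      (iteratedDerivWithin_of_isOpen hV).symm
    exact h1.continuousAt (hV.mem_nhds hx)

lemma coreAt {n : ℕ} (hn : 2 ≤ n) {f : ℝ → Fin n → ℝ} {x₀ : ℝ} (hf : NondegAt f x₀) :
    ∀ᶠ t in Filter.atTop, CoreAt f x₀ t := by
  obtain ⟨⟨U, hU, hsm⟩, hdet⟩ := hf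
  obtain ⟨η₁, hη₁, hball⟩ := Metric.mem_nhds_iff.1 hU
  rw [Real.ball_eq_Ioo] at hball
  have hsm' := fun j => smooth_pt isOpen_Ioo ((hsm j).mono hball)
  have hder : ∀ k < n, ∀ i, ∀ x ∈ Set.Ioo (x₀ - η₁) (x₀ + η₁), HasDerivAt (Phi f k i) (Phi f (k+1) i x) x := by
    intro k hk i x hx
    cases i with
    | none =>
      simp only [Phi, Option.elim]
      simpa using hasDerivAt_const x _
    | some j => exact (hsm' j).1 k hk x hx
  have hcont : ∀ k ≤ n, ∀ i, ∀ x ∈ Set.Ioo (x₀ - η₁) (x₀ + η₁), ContinuousAt (Phi f k i) x := by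
    intro k hk i x hx
    cases i with
    | none => exact continuousAt_const
    | some j => exact (hsm' j).2 k hk x hx
  obtain ⟨η, hη, hη1, C, hC, hcore⟩ := core hn (Φ := Phi f) hη₁ hder
    (fun k hk i => hcont k hk i x₀ ⟨by linarith, by linarith⟩) (fun x => by simp [Phi]) (fun k x => by simp [Phi]) hdet
  filter_upwards [Filter.eventually_ge_atTop (max C (1/η))] with t ht
  have ht1 : C ≤ t := (le_max_left _ _).trans ht
  have ht2 : 1/η ≤ t := (le_max_right _ _).trans ht
  have ht0 : 0 < t := by linarith
  have ht3 : 1/t ≤ η := by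
    rw [div_le_iff₀ hη] at ht2
    rw [div_le_iff₀ ht0]; linarith
  have hsub : ∀ x ∈ Set.Ioo (x₀ - 1/t) (x₀ + 1/t), x ∈ Set.Ioo (x₀ - η₁) (x₀ + η₁) :=
    fun x hx => ⟨by linarith [hx.1], by linarith [hx.2]⟩
  refine ⟨ht0, by linarith, fun k hk i x hx => hder k hk i x (hsub x hx), fun k hk i x hx => hcont k hk i x (hsub x hx), ?_⟩
  intro u v hu huv hv
  obtain ⟨hM, hN⟩ := hcore u v (by linarith) huv (by linarith)
  refine ⟨fun b S hS z hz => ?_, hN⟩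
  have hS0 : 0 ≤ S := (abs_nonneg _).trans (hS u ⟨le_rfl, huv.le⟩)
  have hl : 0 < v - u := by linarith
  obtain ⟨a1, a2⟩ := hM b S hS z hz
  have a3 := mul_le_mul_of_nonneg_right ht1 hS0
  exact ⟨a1.trans (div_le_div_of_nonneg_right a3 hl.le), a2.trans (div_le_div_of_nonneg_right a3 (by positivity))⟩

/-- any subinterval contains one on which the derivative does not vanish -/
lemma CoreAt.shrink {n : ℕ} (hn : 2 ≤ n) {f : ℝ → Fin n → ℝ} {x₀ t : ℝ} (h : CoreAt f x₀ t) (j : Fin n) {u v : ℝ}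
    (hu : x₀ - 1/t < u) (huv : u < v) (hv : v < x₀ + 1/t) :
    ∃ u' v', u ≤ u' ∧ u' < v' ∧ v' ≤ v ∧ ∀ x ∈ Set.Icc u' v', Phi f 1 (some j) x ≠ 0 := by
  obtain ⟨ht, ht1, hder, hcont, hMN⟩ := h
  have hin : ∀ x ∈ Set.Icc u v, x ∈ Set.Ioo (x₀ - 1/t) (x₀ + 1/t) := fun x hx => ⟨by linarith [hx.1], by linarith [hx.2]⟩
  obtain ⟨x, hx, hne⟩ : ∃ x ∈ Set.Ioo u v, Phi f 1 (some j) x ≠ 0 := by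
    by_contra hcon
    push Not at hcon
    obtain ⟨_, B, hB⟩ := hMN u v hu huv hv
    have hconst : ∀ z ∈ Set.Icc u v, Phi f 0 (some j) z = Phi f 0 (some j) u := by
      intro z hz
      rcases eq_or_lt_of_le hz.1 with e | hlt
      · rw [e]
      · have hs : ∀ y ∈ Set.Icc u z, y ∈ Set.Icc u v := fun y hy => ⟨hy.1, hy.2.trans hz.2⟩
        obtain ⟨ξ, hξ, e⟩ := exists_hasDerivAt_eq_slope (Phi f 0 (some j)) (Phi f 1 (some j)) hlt
          (fun y hy => (hder 0 (by omega) _ y (hin y (hs y hy))).continuousAt.continuousWithinAt)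
          (fun y hy => hder 0 (by omega) _ y (hin y (hs y (Set.Ioo_subset_Icc_self hy))))
        rw [hcon ξ ⟨hξ.1, hξ.2.trans_le hz.2⟩] at e
        have h1 : z - u ≠ 0 := by linarith
        rw [eq_comm, div_eq_iff h1, zero_mul] at e
        linarith
    have := hB (fun i => Option.elim i (-(Phi f 0 (some j) u)) (fun k => if k = j then 1 else 0)) 0 (by
      intro z hz
      rw [lin, Fintype.sum_option]
      have e0 : Phi f 0 none z = 1 := by simp [Phi]
      rw [e0]
      simp only [Option.elim, ite_mul, one_mul, zero_mul, Finset.sum_ite_eq', Finset.mem_univ, if_true, mul_one]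
      rw [hconst z hz]; simp) (some j)
    simp at this
    linarith
  have hc := (hcont 1 (by omega) (some j) x (hin x (Set.Ioo_subset_Icc_self hx))).eventually_ne hne
  obtain ⟨δ, hδ, hb⟩ := Metric.eventually_nhds_iff.1 hc
  refine ⟨x, min v (x + δ/2), hx.1.le, lt_min hx.2 (by linarith), min_le_left _ _, fun y hy => hb ?_⟩
  rw [Real.dist_eq, abs_lt]
  have := hy.2.trans (min_le_right _ _)
  constructor <;> linarith [hy.1]

lemma shrink_all {n : ℕ} (hn : 2 ≤ n) {x₀ t : ℝ} {u v : ℝ}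
    (hu : x₀ - 1/t < u) (huv : u < v) (hv : v < x₀ + 1/t) (T : Finset ((ℝ → Fin n → ℝ) × Fin n)) :
    (∀ y ∈ T, CoreAt y.1 x₀ t) →
    ∃ u' v', u ≤ u' ∧ u' < v' ∧ v' ≤ v ∧ ∀ y ∈ T, ∀ x ∈ Set.Icc u' v', Phi y.1 1 (some y.2) x ≠ 0 := by
  classical
  induction T using Finset.induction_on with
  | empty => intro _; exact ⟨u, v, le_rfl, huv, le_rfl, by simp⟩
  | insert y T hy ih =>
    intro hT
    obtain ⟨u', v', h1, h2, h3, h4⟩ := ih (fun z hz => hT z (Finset.mem_insert_of_mem hz))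
    obtain ⟨u'', v'', g1, g2, g3, g4⟩ := (hT y (Finset.mem_insert_self _ _)).shrink hn y.2 (u := u') (v := v') (by linarith) h2 (by linarith)
    refine ⟨u'', v'', by linarith, g2, by linarith, fun z hz x hx => ?_⟩
    rcases Finset.mem_insert.1 hz with rfl | hz
    · exact g4 x hx
    · exact h4 z hz x ⟨g1.trans hx.1, hx.2.trans g3⟩

end BB

set_option linter.unusedVariables false
set_option linter.unusedSectionVars false
open MeasureTheory ENNReal

namespace BB

/-- support of a weight -/
abbrev Sup {n : ℕ} (r : Fin n → ℝ) : Type := {i : Fin n // 0 < r i}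

/-- restricted system -/
noncomputable def PhiR {n : ℕ} (f : ℝ → Fin n → ℝ) (r : Fin n → ℝ) (k : ℕ) (i : Option (Sup r)) : ℝ → ℝ :=
  Phi f k (Option.map Subtype.val i)

/-- restricted weight -/
def rR {n : ℕ} (r : Fin n → ℝ) (i : Option (Sup r)) : ℝ := Option.elim i 0 (fun k => r k.1)

lemma emb_inj {n : ℕ} (r : Fin n → ℝ) : Function.Injective (Option.map Subtype.val : Option (Sup r) → Option (Fin n)) :=
  Option.map_injective Subtype.val_injective

noncomputable instance {n : ℕ} (r : Fin n → ℝ) : Fintype (Sup r) := Fintype.ofFinite _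
noncomputable instance {n : ℕ} (r : Fin n → ℝ) : DecidableEq (Sup r) := Classical.decEq _

lemma lin_ext {n : ℕ} (f : ℝ → Fin n → ℝ) (r : Fin n → ℝ) (k : ℕ) (b : Option (Sup r) → ℝ) (x : ℝ) :
    lin b (PhiR f r k) x = lin (Function.extend (Option.map Subtype.val) b 0) (Phi f k) x := by
  unfold lin
  refine Fintype.sum_of_injective _ (emb_inj r) _ _ (fun i hi => ?_) (fun i => ?_)
  · rw [Function.extend_apply' _ _ _ (by simpa using hi)]; simp
  · rw [(emb_inj r).extend_apply]; rfl

lemma sup_sum {n : ℕ} {r : Fin n → ℝ} (hr : r ∈ Weights n) : ∑ i : Sup r, r i.1 = 1 := by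
  rw [← hr.1]
  refine Fintype.sum_of_injective _ Subtype.val_injective _ _ (fun i hi => ?_) (fun i => rfl)
  have := hr.2 i
  by_contra hne
  exact hi ⟨⟨i, lt_of_le_of_ne this (Ne.symm hne)⟩, rfl⟩

lemma sup_nonempty {n : ℕ} {r : Fin n → ℝ} (hr : r ∈ Weights n) : Nonempty (Sup r) := by
  by_contra hne
  rw [not_nonempty_iff] at hne
  have := sup_sum hr
  simp at this

lemma sup_card {n : ℕ} (r : Fin n → ℝ) : Fintype.card (Option (Sup r)) ≤ n + 1 := by
  rw [Fintype.card_option]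
  have := Fintype.card_le_of_injective (Subtype.val : Sup r → Fin n) Subtype.val_injective
  rw [Fintype.card_fin, ← Nat.card_eq_fintype_card] at this
  rw [← Nat.card_eq_fintype_card]
  exact Nat.add_le_add_right this 1

lemma bdd_Icc {g : ℝ → ℝ} {lo hi : ℝ} (hg : ∀ x ∈ Set.Icc lo hi, ContinuousAt g x) :
    ∀ᶠ B in Filter.atTop, ∀ x ∈ Set.Icc lo hi, |g x| ≤ B := by
  obtain ⟨C, hC⟩ := isCompact_Icc.exists_bound_of_continuousOn (f := g) (s := Set.Icc lo hi)
    (fun x hx => (hg x hx).continuousWithinAt)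
  filter_upwards [Filter.eventually_ge_atTop C] with B hB x hx
  exact (hC x hx).trans hB

lemma mkSys {n : ℕ} (hn : 2 ≤ n) {f : ℝ → Fin n → ℝ} {x₀ t lo hi ϖ : ℝ} {r : Fin n → ℝ} (h : CoreAt f x₀ t)
    (h1 : x₀ - 1/t < lo) (hlh : lo < hi) (h2 : hi < x₀ + 1/t) (hlen : hi - lo ≤ 1)
    (hne : ∀ j, ∀ x ∈ Set.Icc lo hi, Phi f 1 (some j) x ≠ 0) (hr : r ∈ Weights n) (hϖ : 0 < ϖ)
    (hrϖ : ∀ i, 0 < r i → ϖ ≤ r i) :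
    ∃ j B, 0 < rR r j ∧ Sys (none : Option (Sup r)) j (rR r) ϖ t B lo hi (PhiR f r 0) (PhiR f r 1) (PhiR f r 2) := by
  obtain ⟨ht, ht1, hder, hcont, hMN⟩ := h
  have hin : ∀ x ∈ Set.Icc lo hi, x ∈ Set.Ioo (x₀ - 1/t) (x₀ + 1/t) := fun x hx => ⟨by linarith [hx.1], by linarith [hx.2]⟩
  have := sup_nonempty hr
  obtain ⟨j, hj⟩ := Finite.exists_max (fun i : Sup r => r i.1)
  have e1 : ∀ᶠ B in Filter.atTop, ∀ i : Option (Sup r), ∀ x ∈ Set.Icc lo hi, |PhiR f r 1 i x| ≤ B := by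
    rw [Filter.eventually_all]
    exact fun i => bdd_Icc fun x hx => hcont 1 (by omega) _ x (hin x hx)
  have e2 : ∀ᶠ B in Filter.atTop, ∀ i : Option (Sup r), ∀ x ∈ Set.Icc lo hi, |PhiR f r 2 i x| ≤ B := by
    rw [Filter.eventually_all]
    exact fun i => bdd_Icc fun x hx => hcont 2 (by omega) _ x (hin x hx)
  have e3 : ∀ᶠ B in Filter.atTop, ∀ x ∈ Set.Icc lo hi, |(PhiR f r 1 (some j) x)⁻¹| ≤ B :=
    bdd_Icc (g := fun x => (PhiR f r 1 (some j) x)⁻¹) fun x hx => (hcont 1 (by omega) _ x (hin x hx)).inv₀ (hne j.1 x hx)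
  obtain ⟨BN, hBN⟩ := (hMN lo hi h1 hlh h2).2
  have hl0 : 0 < hi - lo := by linarith
  obtain ⟨B, e1, e2, e3, e4, e5, e6⟩ := (e1.and (e2.and (e3.and ((Filter.eventually_ge_atTop BN).and
    ((Filter.eventually_ge_atTop 1).and (Filter.eventually_ge_atTop (1 / (hi - lo)))))))).exists
  refine ⟨some j, B, j.2, ?_⟩
  refine { fs := ⟨ht1, ?_, ?_, ?_, ?_, ?_, ?_⟩, oj := by simp, rsum := ?_, rge := ?_, rle := ?_, wpos := hϖ, hB := e5, lohi := hlh,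
           len := hlen, lenB := ?_, b1 := e1, b2 := e2, low := ?_, N := ?_ }
  · exact fun i x hx => hder 0 (by omega) _ x (hin x hx)
  · exact fun i x hx => hder 1 (by omega) _ x (hin x hx)
  · intro x; simp [PhiR, Phi]
  · intro x; simp [PhiR, Phi]
  · intro x; simp [PhiR, Phi]
  · intro b u v hu huv hv S hS z hz
    rw [lin_ext, lin_ext]
    exact (hMN u v (by linarith) huv (by linarith)).1 _ S (fun y hy => by rw [← lin_ext]; exact hS y hy) z hz
  · rw [Fintype.sum_option]
    simp only [if_true, reduceCtorEq, if_false, zero_add]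
    exact sup_sum hr
  · intro i hi
    cases i with
    | none => exact absurd rfl hi
    | some i => exact hrϖ _ i.2
  · intro i hi
    cases i with
    | none => exact absurd rfl hi
    | some i => exact hj i
  · rwa [div_le_iff₀ hl0] at e6
  · intro x hx
    have a := e3 x hx
    have hp : 0 < |PhiR f r 1 (some j) x| := abs_pos.2 (hne j.1 x hx)
    rw [abs_inv, inv_le_iff_one_le_mul₀ hp] at a
    exact a
  · intro b S hS i
    have hS0 : 0 ≤ S := (abs_nonneg _).trans (hS lo ⟨le_rfl, hlh.le⟩)
    have := hBN (Function.extend (Option.map Subtype.val) b 0) S (fun y hy => by rw [← lin_ext]; exact hS y hy) (Option.map Subtype.val i)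
    rw [(emb_inj r).extend_apply] at this
    exact this.trans (mul_le_mul_of_nonneg_right e4 hS0)

lemma tau_le {n : ℕ} {r : Fin n → ℝ} {i : Fin n} (hi : 0 < r i) : tauW r ≤ r i :=
  csInf_le ⟨0, fun t ht => ht.1.le⟩ ⟨hi, i, rfl⟩

lemma bad_of_dual {n : ℕ} {f : ℝ → Fin n → ℝ} {r : Fin n → ℝ} {ϖ d x : ℝ} (hr : r ∈ Weights n) (hϖ : 0 < ϖ)
    (hrϖ : ∀ i, 0 < r i → ϖ ≤ r i) (hd : 0 < d) (h : DualBad (none : Option (Sup r)) (rR r) (PhiR f r 0) d x) :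
    f x ∈ BadSet r := by
  have := sup_nonempty hr
  obtain ⟨c, hc, hq⟩ := dual (by simp [PhiR, Phi]) hϖ (fun i => hrϖ _ i.2) (sup_sum hr) hd h
  refine ⟨c, hc, fun q hq1 => ?_⟩
  obtain ⟨i, hi⟩ := hq q hq1
  refine ⟨i.1, ?_⟩
  have hi0 : 0 < r i.1 := i.2
  rw [badPow, if_neg hi0.ne']
  have e : ∀ x, PhiR f r 0 (some i) x = f x i.1 := fun x => by simp [PhiR, Phi]
  have hle : (c * (q:ℝ)⁻¹) ^ r i.1 ≤ distNearestInt (q * f x i.1) := by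
    refine le_ciInf fun z => ?_
    have := hi z
    rw [e] at this
    exact this
  have hq0 : 0 ≤ c * (q:ℝ)⁻¹ := by positivity
  have := Real.rpow_le_rpow (by positivity) hle (show 0 ≤ 1 / r i.1 by positivity)
  rw [one_div, Real.rpow_rpow_inv hq0 hi0.ne'] at this
  rwa [one_div]

end BB

set_option linter.unusedVariables false
set_option linter.unusedSectionVars false
open MeasureTheory ENNReal

namespace BB

lemma pick_rho {β s : ℝ} (hβ : 0 < β) (hs : s < 1) :
    ∃ ρ : ℝ, 1 < ρ ∧ ρ < 2 ∧ (2:ℝ) ^ s ≤ ρ ∧ Real.exp (-β) * (2 / ρ) ^ 3 < 1 := by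
  have h1 : ∀ᶠ ρ in nhdsWithin (2:ℝ) (Set.Iio 2), Real.exp (-β) * (2 / ρ) ^ 3 < 1 := by
    have hc : ContinuousAt (fun ρ : ℝ => Real.exp (-β) * (2 / ρ) ^ 3) 2 := by
      refine continuousAt_const.mul ((continuousAt_const.div continuousAt_id (by norm_num)).pow 3)
    refine (hc.eventually (gt_mem_nhds ?_)).filter_mono nhdsWithin_le_nhds
    norm_num
    exact hβ
  have h2 : ∀ᶠ ρ in nhdsWithin (2:ℝ) (Set.Iio 2), (2:ℝ) ^ s < ρ := by
    refine (lt_mem_nhds ?_).filter_mono nhdsWithin_le_nhds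
    calc (2:ℝ) ^ s < 2 ^ (1:ℝ) := Real.rpow_lt_rpow_of_exponent_lt (by norm_num) hs
      _ = 2 := by norm_num
  have h3 : ∀ᶠ ρ in nhdsWithin (2:ℝ) (Set.Iio 2), (1:ℝ) < ρ :=
    (lt_mem_nhds (by norm_num)).filter_mono nhdsWithin_le_nhds
  obtain ⟨ρ, a, b, c, d⟩ := (h1.and (h2.and (h3.and self_mem_nhdsWithin))).exists
  exact ⟨ρ, c, d, b.le, a⟩

theorem final (n : ℕ) (hn : 2 ≤ n) (a b : ℝ) (hab : a < b)
    (F : Set (ℝ → Fin n → ℝ)) (hFfin : F.Finite)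
    (x₀ : ℝ) (hx₀ : x₀ ∈ Set.Ioo a b) (hFnd : ∀ f ∈ F, NondegAt f x₀)
    (W : Set (Fin n → ℝ)) (hWcnt : W.Countable) (hWsub : W ⊆ Weights n)
    (hτ : ∃ ε > 0, ∀ r ∈ W, ε ≤ tauW r) :
    dimH (Set.Ioo a b ∩ ⋂ f ∈ F, ⋂ r ∈ W, f ⁻¹' BadSet r) = 1 := by
  classical
  refine le_antisymm ((dimH_mono (Set.subset_univ _)).trans (by rw [Real.dimH_univ])) ?_
  rcases (F ×ˢ W).eq_empty_or_nonempty with hemp | hnemp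
  · have : Set.Ioo a b ∩ ⋂ f ∈ F, ⋂ r ∈ W, f ⁻¹' BadSet r = Set.Ioo a b := by
      refine Set.inter_eq_left.2 fun x _ => ?_
      simp only [Set.mem_iInter]
      intro f hf r hr
      exact absurd (show (f, r) ∈ F ×ˢ W from ⟨hf, hr⟩) (by rw [hemp]; simp)
    rw [this, Real.dimH_of_nonempty_interior (by rw [interior_Ioo]; exact Set.nonempty_Ioo.2 hab)]
    simp
  obtain ⟨ϖ, hϖ, hWϖ⟩ := hτ
  obtain ⟨e, he⟩ := (hFfin.countable.prod hWcnt).exists_eq_range hnemp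
  have hek : ∀ k, (e k).1 ∈ F ∧ (e k).2 ∈ W := fun k => by
    have : e k ∈ F ×ˢ W := by rw [he]; exact ⟨k, rfl⟩
    exact this
  -- the common radius
  have hev : ∀ᶠ t in Filter.atTop, ∀ f ∈ F, CoreAt f x₀ t :=
    (Filter.eventually_all_finite hFfin).2 fun f hf => coreAt hn (hFnd f hf)
  obtain ⟨t, ht, ht1⟩ := (hev.and (Filter.eventually_ge_atTop 1)).exists
  have ht0 : (0:ℝ) < 1 / t := by positivity
  have hT1 : 1 / t ≤ 1 := by rw [div_le_iff₀ (by linarith)]; linarith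
  set v0 := min b (x₀ + 1/t) with hv0
  have hv0' : x₀ < v0 := lt_min hx₀.2 (by linarith)
  have hv1 : v0 ≤ b := min_le_left _ _
  have hv2 : v0 ≤ x₀ + 1/t := min_le_right _ _
  obtain ⟨lo, hi, g1, g2, g3, g4⟩ := shrink_all hn (x₀ := x₀) (t := t) (u := x₀) (v := (x₀ + v0)/2) (by linarith) (by linarith)
    (by linarith) (hFfin.toFinset ×ˢ Finset.univ) (fun y hy => ht _ (by
      rw [Finset.mem_product, Set.Finite.mem_toFinset] at hy; exact hy.1))
  have hrϖ : ∀ r ∈ W, ∀ i, 0 < r i → ϖ ≤ r i := fun r hr i hi => (hWϖ r hr).trans (tau_le hi)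
  have hsys := fun k => mkSys (ϖ := ϖ) hn (ht _ (hek k).1) (lo := lo) (hi := hi) (by linarith) g2 (by linarith) (by linarith)
    (fun j x hx => g4 ((e k).1, j) (by
      rw [Finset.mem_product, Set.Finite.mem_toFinset]; exact ⟨(hek k).1, Finset.mem_univ _⟩) x hx)
    (hWsub (hek k).2) hϖ (hrϖ _ (hek k).2)
  choose j B hj hS using hsys
  obtain ⟨α, hα, hstr⟩ := strat2 t ht1 (n + 1)
  set s0 := ϖ / (2 * ((n + 1 : ℕ) : ℝ)) with hs0
  have hs0' : 0 < s0 := by positivity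
  refine le_of_forall_lt fun s hs => ?_
  obtain ⟨s', hs1, hs2⟩ := exists_between hs
  have hs'top : s' ≠ ⊤ := (hs2.trans ENNReal.one_lt_top).ne
  lift s' to NNReal using hs'top
  have hs'1 : (s' : ℝ) < 1 := by exact_mod_cast hs2
  have hs'0 : 0 < (s' : ℝ) := by
    have : (0:ENNReal) < s' := lt_of_le_of_lt zero_le hs1
    exact_mod_cast this
  obtain ⟨ρ, hρ1, hρ2, hρs, hρe⟩ := pick_rho (β := α * s0 / 4 * Real.log 2) (by
    have := Real.log_pos (show (1:ℝ) < 2 by norm_num); positivity) hs'1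
  have hst := fun k => hstr (sup_card _) (hS k) (s := s0) (d := Real.log 2 / (1 + rR _ (j k))) (ρ := ρ) hs0' hs0 rfl hρ1 hρ2.le hρe
    ((2 - ρ) / 2 ^ (k + 2)) (div_pos (by linarith) (by positivity)) (k + 1)
  choose Z h hSt hgood using hst
  refine hs1.trans_le ?_
  refine le_dimH_of_hausdorffMeasure_ne_zero ?_
  have hpos := dim_lower (lo := lo) hρ1 hρ2 hs'0 hρs (L := hi - lo) (by linarith) hSt
  intro hz
  refine hpos (measure_mono_null ?_ hz)
  intro x hx
  refine ⟨?_, ?_⟩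
  · obtain ⟨i, hi0, hxi, _⟩ := hx 0 0
    have := J_sub_root (lo := lo) (L := hi - lo) (by linarith) hi0 hxi
    exact ⟨by linarith [this.1, hx₀.1], by linarith [this.2]⟩
  · simp only [Set.mem_iInter]
    intro f hf r hr
    have hm : (f, r) ∈ F ×ˢ W := ⟨hf, hr⟩
    rw [he] at hm
    obtain ⟨k, hk⟩ := hm
    have := bad_of_dual (hWsub (hek k).2) hϖ (hrϖ _ (hek k).2) (div_pos (Real.log_pos (by norm_num)) (by linarith [hj k])) (hgood k x (hx k))
    rw [hk] at this
    exact this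

end BB

theorem stmt3 (n : ℕ) (hn : 2 ≤ n) (a b : ℝ) (hab : a < b)
    (I : Set ℝ) (hI : I = Set.Ioo a b)
    (F : Set (ℝ → Fin n → ℝ)) (hFfin : F.Finite)
    (x₀ : ℝ) (hx₀ : x₀ ∈ I) (hFnd : ∀ f ∈ F, NondegAt f x₀)
    (W : Set (Fin n → ℝ)) (hWcnt : W.Countable) (hWsub : W ⊆ Weights n)
    (hτ : ∃ ε > 0, ∀ r ∈ W, ε ≤ tauW r) :
    dimH (I ∩ ⋂ f ∈ F, ⋂ r ∈ W, f ⁻¹' BadSet r) = 1 := by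
  subst hI
  exact BB.final n hn a b hab F hFfin x₀ hx₀ hFnd W hWcnt hWsub hτ
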